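/- arXiv:2409.10886 — 5 statements merged into one kernel-verified Lean document; each statement's English description precedes it below -/
import Mathlib

section
/- Fix an integer K ≥ 3 and an integer d ≥ 1. There exists a constant C(d,K) > 0 depending only on d and K such that for every n ≥ 1 and every function f : Ω_K^n → ℂ of degree at most d, one has (∑_α |f̂(α)|^{2d/(d+1)})^{(d+1)/(2d)} ≤ C(d,K) · sup_{z ∈ Ω_K^n} |f(z)|. Moreover, if K is prime, the constant can be taken of the form C_K^{d²} for some constant C_K > 0 depending only on K. -/
open Finset

/-- A polynomial of degree at most `d` bounded by `M` on `[0, 1]` has linear coefficient at most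
`4 ^ (d ^ 2) * M`. -/
theorem norm_coeff_one_le_of_bounded_on_unit_interval (d : ℕ) (hd : 1 ≤ d) :
    ∀ (P : Polynomial ℂ) (M : ℝ), P.natDegree ≤ d →
      (∀ t : ℝ, 0 ≤ t → t ≤ 1 → ‖P.eval (t : ℂ)‖ ≤ M) → ‖P.coeff 1‖ ≤ 4 ^ (d ^ 2) * M := by
  induction d, hd using Nat.le_induction with
  | base =>
    intro P M hP hM
    have h0 := hM 0 le_rfl zero_le_one
    have h1 := hM 1 zero_le_one le_rfl
    have e : P.coeff 1 = P.eval ((1 : ℝ) : ℂ) - P.eval ((0 : ℝ) : ℂ) := by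
      rw [Polynomial.eq_X_add_C_of_natDegree_le_one hP]
      simp
    rw [e]
    have := norm_sub_le (P.eval ((1 : ℝ) : ℂ)) (P.eval ((0 : ℝ) : ℂ))
    have := norm_nonneg (P.eval ((0 : ℝ) : ℂ))
    rw [one_pow, pow_one]
    linarith
  | succ d hd ih =>
    intro P M hP hM
    set R : Polynomial ℂ :=
      Polynomial.C (2 ^ (d + 1)) * P.comp (Polynomial.C (1 / 2) * Polynomial.X) - P with hR
    have hco : ∀ k, R.coeff k = (2 ^ (d + 1) * (1 / 2) ^ k - 1) * P.coeff k := by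
      intro k
      rw [hR, Polynomial.coeff_sub, Polynomial.coeff_C_mul, Polynomial.comp_C_mul_X_coeff]
      ring
    have hdeg : R.natDegree ≤ d := by
      rw [Polynomial.natDegree_le_iff_coeff_eq_zero]
      intro k hk
      rw [hco]
      rcases Nat.eq_or_lt_of_le (Nat.succ_le_of_lt hk) with h | h
      · subst h
        have : (2 : ℂ) ^ (d + 1) * (1 / 2) ^ (d + 1) = 1 := by
          rw [← mul_pow]; norm_num
        simp only [Nat.succ_eq_add_one]
        rw [this]; ring
      · rw [Polynomial.coeff_eq_zero_of_natDegree_lt (lt_of_le_of_lt hP h), mul_zero]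
    have hM0 : 0 ≤ M := le_trans (norm_nonneg _) (hM 0 le_rfl zero_le_one)
    have hb : ∀ t : ℝ, 0 ≤ t → t ≤ 1 → ‖R.eval (t : ℂ)‖ ≤ (2 ^ (d + 1) + 1) * M := by
      intro t h0 h1
      have h2 := hM (t / 2) (by linarith) (by linarith)
      have h3 := hM t h0 h1
      have e : R.eval (t : ℂ) = 2 ^ (d + 1) * P.eval ((t / 2 : ℝ) : ℂ) - P.eval (t : ℂ) := by
        rw [hR]
        simp only [Polynomial.eval_sub, Polynomial.eval_mul, Polynomial.eval_C,
          Polynomial.eval_comp, Polynomial.eval_X]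
        push_cast
        rw [one_div_mul_eq_div]
      rw [e]
      refine (norm_sub_le _ _).trans ?_
      rw [norm_mul, norm_pow, Complex.norm_ofNat]
      have : (2 : ℝ) ^ (d + 1) * ‖P.eval ((t / 2 : ℝ) : ℂ)‖ ≤ 2 ^ (d + 1) * M := by gcongr
      linarith
    have h := ih R _ hdeg hb
    have h1 : ‖P.coeff 1‖ ≤ ‖R.coeff 1‖ := by
      rw [hco, norm_mul]
      have e : ((2 : ℂ) ^ (d + 1) * (1 / 2) ^ 1 - 1) = ((2 ^ d - 1 : ℝ) : ℂ) := by
        push_cast; ring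
      have h2 : (2 : ℝ) ≤ 2 ^ d := by
        simpa using pow_le_pow_right₀ (one_le_two : (1 : ℝ) ≤ 2) hd
      rw [e, Complex.norm_real, Real.norm_of_nonneg (by linarith)]
      nlinarith [norm_nonneg (P.coeff 1)]
    refine h1.trans (h.trans ?_)
    rw [← mul_assoc]
    gcongr
    have h3 : (2 : ℝ) ^ (d + 1) + 1 ≤ 4 ^ (d + 1) := by
      have : (4 : ℝ) = 2 * 2 := by norm_num
      rw [this, mul_pow]
      have : (2 : ℝ) ≤ 2 ^ (d + 1) := by
        simpa using pow_le_pow_right₀ (one_le_two : (1 : ℝ) ≤ 2) (Nat.le_add_left 1 d)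
      nlinarith
    calc (4 : ℝ) ^ d ^ 2 * (2 ^ (d + 1) + 1) ≤ 4 ^ d ^ 2 * 4 ^ (d + 1) := by gcongr
      _ = 4 ^ (d ^ 2 + (d + 1)) := (pow_add _ _ _).symm
      _ ≤ 4 ^ (d + 1) ^ 2 := by
        apply pow_le_pow_right₀ (by norm_num)
        nlinarith

theorem sum_norm_le_four_mul_of_norm_sum_subset_le {ι : Type*} [Fintype ι] (v : ι → ℂ) (R : ℝ)
    (h : ∀ S : Finset ι, ‖∑ j ∈ S, v j‖ ≤ R) : ∑ j, ‖v j‖ ≤ 4 * R := by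
  classical
  have hl : ∀ l : ℂ →+ ℝ, (∀ z, |l z| ≤ ‖z‖) → ∑ j, |l (v j)| ≤ 2 * R := by
    intro l hl
    have h1 := (hl _).trans (h (univ.filter fun j => 0 ≤ l (v j)))
    have h2 := (hl _).trans (h (univ.filter fun j => ¬ 0 ≤ l (v j)))
    rw [map_sum] at h1 h2
    rw [← sum_filter_add_sum_filter_not univ (fun j => 0 ≤ l (v j))]
    have e1 : ∑ j ∈ univ.filter (fun j => 0 ≤ l (v j)), |l (v j)|
        = ∑ j ∈ univ.filter (fun j => 0 ≤ l (v j)), l (v j) :=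
      sum_congr rfl fun j hj => abs_of_nonneg (mem_filter.1 hj).2
    have e2 : ∑ j ∈ univ.filter (fun j => ¬ 0 ≤ l (v j)), |l (v j)|
        = -∑ j ∈ univ.filter (fun j => ¬ 0 ≤ l (v j)), l (v j) := by
      rw [← sum_neg_distrib]
      exact sum_congr rfl fun j hj => abs_of_neg (not_le.1 (mem_filter.1 hj).2)
    rw [e1, e2]
    have := le_abs_self (∑ j ∈ univ.filter (fun j => 0 ≤ l (v j)), l (v j))
    have := neg_abs_le (∑ j ∈ univ.filter (fun j => ¬ 0 ≤ l (v j)), l (v j))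
    linarith
  have h1 := hl Complex.reAddGroupHom Complex.abs_re_le_norm
  have h2 := hl Complex.imAddGroupHom Complex.abs_im_le_norm
  calc ∑ j, ‖v j‖ ≤ ∑ j, (|(v j).re| + |(v j).im|) :=
        sum_le_sum fun j _ => Complex.norm_le_abs_re_add_abs_im _
    _ ≤ 4 * R := by
      rw [sum_add_distrib]
      simp only [Complex.coe_reAddGroupHom, Complex.coe_imAddGroupHom] at h1 h2
      linarith

/-- The expansion `∑ α, c α * ∏ j, e (x j) (α j)` in the tensor products of the columns of `e`. -/
def tensorExpansion {K n : ℕ} (e : Fin K → Fin K → ℂ) (c : (Fin n → Fin K) → ℂ)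
    (x : Fin n → Fin K) : ℂ :=
  ∑ α, c α * ∏ j, e (x j) (α j)

theorem sum_fin_succ_pi {K n : ℕ} {E : Type*} [AddCommMonoid E] (g : (Fin (n + 1) → Fin K) → E) :
    ∑ x, g x = ∑ w : Fin K, ∑ y : Fin n → Fin K, g (Fin.cons w y : Fin (n + 1) → Fin K) := by
  rw [← (Fin.consEquiv (fun _ : Fin (n + 1) => Fin K)).sum_comp, Fintype.sum_prod_type]
  rfl

theorem tensorExpansion_cons {K n : ℕ} (e : Fin K → Fin K → ℂ) (c : (Fin (n + 1) → Fin K) → ℂ)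
    (w : Fin K) (y : Fin n → Fin K) :
    tensorExpansion e c (Fin.cons w y : Fin (n + 1) → Fin K)
      = ∑ k, e w k * tensorExpansion e (fun β => c (Fin.cons k β : Fin (n + 1) → Fin K)) y := by
  unfold tensorExpansion
  rw [sum_fin_succ_pi]
  refine sum_congr rfl fun k _ => ?_
  rw [mul_sum]
  refine sum_congr rfl fun β _ => ?_
  rw [Fin.prod_univ_succ]
  simp only [Fin.cons_zero, Fin.cons_succ]
  ring

theorem tensorExpansion_sum_mul {K n : ℕ} (e : Fin K → Fin K → ℂ) {ι : Type*} (s : Finset ι)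
    (a : ι → ℂ) (c : ι → (Fin n → Fin K) → ℂ) (x : Fin n → Fin K) :
    tensorExpansion e (fun β => ∑ k ∈ s, a k * c k β) x
      = ∑ k ∈ s, a k * tensorExpansion e (c k) x := by
  unfold tensorExpansion
  simp only [sum_mul, mul_sum]
  rw [sum_comm]
  refine sum_congr rfl fun k _ => sum_congr rfl fun β _ => by ring

theorem sum_norm_sq_tensorExpansion {K : ℕ} (e : Fin K → Fin K → ℂ)
    (he : ∀ a : Fin K → ℂ, ∑ w, ‖∑ k, e w k * a k‖ ^ 2 = K * ∑ k, ‖a k‖ ^ 2) (n : ℕ) :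
    ∀ c : (Fin n → Fin K) → ℂ,
      ∑ x, ‖tensorExpansion e c x‖ ^ 2 = (K : ℝ) ^ n * ∑ α, ‖c α‖ ^ 2 := by
  induction n with
  | zero => intro c; simp [tensorExpansion]
  | succ n ih =>
    intro c
    rw [sum_fin_succ_pi, sum_fin_succ_pi, sum_comm]
    simp only [tensorExpansion_cons, he]
    rw [← mul_sum, sum_comm]
    simp only [ih]
    rw [← mul_sum]
    ring

theorem norm_add_pow_four_le (g h : ℂ) :
    ‖g + h‖ ^ 4 ≤ ‖g‖ ^ 4 + 4 * ‖g‖ ^ 2 * (h * (starRingEnd ℂ) g).re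
      + 8 * (‖g‖ ^ 2 * ‖h‖ ^ 2) + 3 * ‖h‖ ^ 4 := by
  set r := (h * (starRingEnd ℂ) g).re with hr
  have h1 : ‖g + h‖ ^ 2 = ‖g‖ ^ 2 + 2 * r + ‖h‖ ^ 2 := by
    rw [Complex.sq_norm, Complex.sq_norm, Complex.sq_norm, Complex.normSq_add, hr]
    simp only [Complex.mul_re, Complex.conj_re, Complex.conj_im]
    ring
  have h2 : r ^ 2 ≤ ‖g‖ ^ 2 * ‖h‖ ^ 2 := by
    have h3 : |r| ≤ ‖g‖ * ‖h‖ := by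
      refine (Complex.abs_re_le_norm _).trans ?_
      rw [norm_mul, Complex.norm_conj, mul_comm]
    rw [← mul_pow, ← sq_abs]
    gcongr
  have h4 : ‖g + h‖ ^ 4 = (‖g‖ ^ 2 + 2 * r + ‖h‖ ^ 2) ^ 2 := by rw [← h1]; ring
  rw [h4]
  nlinarith [sq_nonneg (r - ‖h‖ ^ 2)]

/-- The squared `ℓ²` norm of `c` in which `c α` carries a factor `4 * K` for every `j` with
`α j ≠ 0`. -/
noncomputable def weightedEnergy {K n : ℕ} [NeZero K] (c : (Fin n → Fin K) → ℂ) : ℝ :=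
  ∑ α, (∏ j, if α j = 0 then (1 : ℝ) else 4 * K) * ‖c α‖ ^ 2

theorem prod_weight_nonneg {K n : ℕ} [NeZero K] (α : Fin n → Fin K) :
    0 ≤ ∏ j, if α j = 0 then (1 : ℝ) else 4 * K :=
  prod_nonneg fun j _ => by split_ifs <;> positivity

theorem weightedEnergy_nonneg {K n : ℕ} [NeZero K] (c : (Fin n → Fin K) → ℂ) :
    0 ≤ weightedEnergy c :=
  sum_nonneg fun α _ => mul_nonneg (prod_weight_nonneg α) (sq_nonneg _)

theorem weightedEnergy_succ {K n : ℕ} [NeZero K] (c : (Fin (n + 1) → Fin K) → ℂ) :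
    weightedEnergy c = weightedEnergy (fun β => c (Fin.cons 0 β : Fin (n + 1) → Fin K))
      + 4 * K * ∑ k ∈ univ.erase (0 : Fin K),
          weightedEnergy (fun β => c (Fin.cons k β : Fin (n + 1) → Fin K)) := by
  unfold weightedEnergy
  rw [sum_fin_succ_pi, ← add_sum_erase univ _ (mem_univ (0 : Fin K)), mul_sum]
  congr 1
  · refine sum_congr rfl fun β _ => ?_
    rw [Fin.prod_univ_succ]
    simp
  · refine sum_congr rfl fun k hk => ?_
    rw [mul_sum]
    refine sum_congr rfl fun β _ => ?_
    rw [Fin.prod_univ_succ]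
    simp only [Fin.cons_zero, Fin.cons_succ, if_neg (ne_of_mem_erase hk)]
    ring

theorem weightedEnergy_sum_mul_le {K n : ℕ} [NeZero K] (s : Finset (Fin K)) (a : Fin K → ℂ)
    (ha : ∀ k, ‖a k‖ ≤ 1) (c : Fin K → (Fin n → Fin K) → ℂ) :
    weightedEnergy (fun β => ∑ k ∈ s, a k * c k β) ≤ K * ∑ k ∈ s, weightedEnergy (c k) := by
  unfold weightedEnergy
  rw [sum_comm, mul_sum]
  refine sum_le_sum fun β _ => ?_
  rw [← mul_sum, mul_left_comm]
  refine mul_le_mul_of_nonneg_left ?_ (prod_weight_nonneg β)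
  have h1 : ‖∑ k ∈ s, a k * c k β‖ ≤ ∑ k ∈ s, ‖c k β‖ := by
    refine (norm_sum_le _ _).trans (sum_le_sum fun k _ => ?_)
    rw [norm_mul]
    exact mul_le_of_le_one_left (norm_nonneg _) (ha k)
  have h2 : (s.card : ℝ) ≤ K := by
    have := card_le_univ s
    rw [Fintype.card_fin] at this
    exact_mod_cast this
  calc ‖∑ k ∈ s, a k * c k β‖ ^ 2 ≤ (∑ k ∈ s, ‖c k β‖) ^ 2 := by gcongr
    _ ≤ s.card * ∑ k ∈ s, ‖c k β‖ ^ 2 := sq_sum_le_card_mul_sum_sq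
    _ ≤ K * ∑ k ∈ s, ‖c k β‖ ^ 2 := by gcongr

/-- Hypercontractivity: the fourth moment is controlled by the weighted energy. -/
theorem sum_norm_pow_four_tensorExpansion_le {K : ℕ} [NeZero K] (e : Fin K → Fin K → ℂ)
    (h0 : ∀ w, e w 0 = 1) (hn : ∀ w k, ‖e w k‖ ≤ 1) (hs : ∀ k, k ≠ 0 → ∑ w, e w k = 0) (n : ℕ) :
    ∀ c : (Fin n → Fin K) → ℂ,
      ∑ x, ‖tensorExpansion e c x‖ ^ 4 ≤ (K : ℝ) ^ n * weightedEnergy c ^ 2 := by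
  induction n with
  | zero =>
    intro c
    simp [tensorExpansion, weightedEnergy]
    apply le_of_eq
    ring
  | succ n ih =>
    intro c
    set c' : Fin K → (Fin n → Fin K) → ℂ :=
      fun k β => c (Fin.cons k β : Fin (n + 1) → Fin K) with hc'
    set b : Fin K → (Fin n → Fin K) → ℂ :=
      fun w β => ∑ k ∈ univ.erase (0 : Fin K), e w k * c' k β with hb
    set G := weightedEnergy (c' 0) with hG
    set H := ∑ k ∈ univ.erase (0 : Fin K), weightedEnergy (c' k) with hH
    have hG0 : 0 ≤ G := weightedEnergy_nonneg _
    have hH0 : 0 ≤ H := sum_nonneg fun k _ => weightedEnergy_nonneg _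
    have hK0 : (0 : ℝ) ≤ K := Nat.cast_nonneg K
    have hsplit : ∀ w y, tensorExpansion e c (Fin.cons w y : Fin (n + 1) → Fin K)
        = tensorExpansion e (c' 0) y + tensorExpansion e (b w) y := by
      intro w y
      rw [tensorExpansion_cons, ← add_sum_erase univ _ (mem_univ (0 : Fin K)), h0, one_mul, hb,
        tensorExpansion_sum_mul]
    have hmean : ∀ y, ∑ w, tensorExpansion e (b w) y = 0 := by
      intro y
      simp only [hb, tensorExpansion_sum_mul]
      rw [sum_comm]
      refine sum_eq_zero fun k hk => ?_
      rw [← sum_mul, hs k (ne_of_mem_erase hk), zero_mul]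
    have hbE : ∀ w, weightedEnergy (b w) ≤ K * H := fun w =>
      weightedEnergy_sum_mul_le _ _ (hn w) _
    have hpt : ∀ y, ∑ w, ‖tensorExpansion e (c' 0) y + tensorExpansion e (b w) y‖ ^ 4
        ≤ ∑ w, (‖tensorExpansion e (c' 0) y‖ ^ 4
          + 8 * (‖tensorExpansion e (c' 0) y‖ ^ 2 * ‖tensorExpansion e (b w) y‖ ^ 2)
          + 3 * ‖tensorExpansion e (b w) y‖ ^ 4) := by
      intro y
      set g := tensorExpansion e (c' 0) y
      have hr : ∑ w, 4 * ‖g‖ ^ 2 * (tensorExpansion e (b w) y * (starRingEnd ℂ) g).re = 0 := by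
        rw [← mul_sum, ← Complex.re_sum, ← sum_mul, hmean]
        simp
      calc _ ≤ ∑ w, _ := sum_le_sum fun w _ => norm_add_pow_four_le g (tensorExpansion e (b w) y)
        _ = _ := by
          simp only [sum_add_distrib]
          rw [hr, add_zero]
    have i1 : ∑ y, ‖tensorExpansion e (c' 0) y‖ ^ 4 ≤ (K : ℝ) ^ n * G ^ 2 := ih (c' 0)
    have i2 : ∀ w, ∑ y, ‖tensorExpansion e (b w) y‖ ^ 4 ≤ (K : ℝ) ^ n * (K * H) ^ 2 := fun w =>
      (ih (b w)).trans (mul_le_mul_of_nonneg_left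
        (pow_le_pow_left₀ (weightedEnergy_nonneg _) (hbE w) 2) (pow_nonneg hK0 n))
    have hcross : ∀ w, ∑ y, ‖tensorExpansion e (c' 0) y‖ ^ 2 * ‖tensorExpansion e (b w) y‖ ^ 2
        ≤ (K : ℝ) ^ n * (G * (K * H)) := by
      intro w
      have hsq := sum_mul_sq_le_sq_mul_sq univ (fun y => ‖tensorExpansion e (c' 0) y‖ ^ 2)
        (fun y => ‖tensorExpansion e (b w) y‖ ^ 2)
      simp only [← pow_mul, Nat.reduceMul] at hsq
      have hR : 0 ≤ (K : ℝ) ^ n * (G * (K * H)) :=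
        mul_nonneg (pow_nonneg hK0 n) (mul_nonneg hG0 (mul_nonneg hK0 hH0))
      refine le_of_sq_le_sq (hsq.trans ?_) hR
      refine (mul_le_mul i1 (i2 w) (sum_nonneg fun _ _ => pow_nonneg (norm_nonneg _) 4)
        (mul_nonneg (pow_nonneg hK0 n) (sq_nonneg G))).trans (le_of_eq ?_)
      ring
    have hw : ∀ w, ∑ y, (‖tensorExpansion e (c' 0) y‖ ^ 4
          + 8 * (‖tensorExpansion e (c' 0) y‖ ^ 2 * ‖tensorExpansion e (b w) y‖ ^ 2)
          + 3 * ‖tensorExpansion e (b w) y‖ ^ 4)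
        ≤ (K : ℝ) ^ n * (G ^ 2 + 8 * (G * (K * H)) + 3 * (K * H) ^ 2) := by
      intro w
      rw [sum_add_distrib, sum_add_distrib, ← mul_sum, ← mul_sum]
      have i2 := i2 w
      have i3 := hcross w
      linarith
    rw [sum_fin_succ_pi, sum_comm]
    simp only [hsplit]
    refine (sum_le_sum fun y _ => hpt y).trans ?_
    rw [sum_comm]
    refine (sum_le_sum fun w _ => hw w).trans ?_
    rw [sum_const, card_univ, Fintype.card_fin, nsmul_eq_mul, weightedEnergy_succ,
      pow_succ' (K : ℝ) n, mul_assoc]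
    have hfin : G ^ 2 + 8 * (G * (K * H)) + 3 * (K * H) ^ 2 ≤ (G + 4 * K * H) ^ 2 := by
      nlinarith [sq_nonneg ((K : ℝ) * H)]
    exact mul_le_mul_of_nonneg_left (mul_le_mul_of_nonneg_left hfin (pow_nonneg hK0 n)) hK0

theorem weightedEnergy_le {K n d : ℕ} [NeZero K] (c : (Fin n → Fin K) → ℂ)
    (hc : ∀ α, c α ≠ 0 → #{j | α j ≠ 0} ≤ d) :
    weightedEnergy c ≤ (4 * K) ^ d * ∑ α, ‖c α‖ ^ 2 := by
  unfold weightedEnergy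
  rw [mul_sum]
  refine sum_le_sum fun α _ => ?_
  by_cases h : c α = 0
  · simp [h]
  · refine mul_le_mul_of_nonneg_right ?_ (sq_nonneg _)
    rw [prod_ite, prod_const_one, one_mul, prod_const]
    have : (1 : ℝ) ≤ K := by exact_mod_cast NeZero.one_le
    exact pow_le_pow_right₀ (by linarith) (hc α h)

/-- The `L²` norm of a function of low degree is controlled by its `L¹` norm. -/
theorem sqrt_sum_norm_sq_le_sum_norm_tensorExpansion {K n d : ℕ} [NeZero K]
    (e : Fin K → Fin K → ℂ)
    (he : ∀ a : Fin K → ℂ, ∑ w, ‖∑ k, e w k * a k‖ ^ 2 = K * ∑ k, ‖a k‖ ^ 2)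
    (h0 : ∀ w, e w 0 = 1) (hn : ∀ w k, ‖e w k‖ ≤ 1) (hs : ∀ k, k ≠ 0 → ∑ w, e w k = 0)
    (c : (Fin n → Fin K) → ℂ) (hc : ∀ α, c α ≠ 0 → #{j | α j ≠ 0} ≤ d) :
    (K : ℝ) ^ n * √(∑ α, ‖c α‖ ^ 2) ≤ 4 * (4 * K) ^ d * ∑ x, ‖tensorExpansion e c x‖ := by
  have hK : (1 : ℝ) ≤ K := by exact_mod_cast NeZero.one_le
  set S := ∑ α, ‖c α‖ ^ 2 with hS
  set σ := √S with hσ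
  have hS0 : 0 ≤ S := sum_nonneg fun _ _ => sq_nonneg _
  have hσS : σ ^ 2 = S := Real.sq_sqrt hS0
  have hσ0 : 0 ≤ σ := Real.sqrt_nonneg _
  rcases hσ0.eq_or_lt with h | hpos
  · rw [← h, mul_zero]
    positivity
  set b : ℝ := (4 * K) ^ d with hb
  have hbpos : 0 < b := by positivity
  set l := 2 * b * σ with hl
  have hlpos : 0 < l := by positivity
  have hpt : ∀ t : ℝ, 0 ≤ t → t ^ 2 ≤ l * t + t ^ 4 / l ^ 2 := by
    intro t ht
    rcases le_total t l with h | h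
    · have : 0 ≤ t ^ 4 / l ^ 2 := by positivity
      nlinarith
    · have : t ^ 2 ≤ t ^ 4 / l ^ 2 := by
        rw [le_div_iff₀ (by positivity)]
        have : l ^ 2 ≤ t ^ 2 := by gcongr
        nlinarith [sq_nonneg t]
      have : 0 ≤ l * t := by positivity
      linarith
  have h2 := sum_norm_sq_tensorExpansion e he n c
  have h4 := (sum_norm_pow_four_tensorExpansion_le e h0 hn hs n c).trans
    (mul_le_mul_of_nonneg_left (pow_le_pow_left₀ (weightedEnergy_nonneg _)
      (weightedEnergy_le c hc) 2) (by positivity : (0:ℝ) ≤ (K:ℝ) ^ n))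
  have hsum : ∑ x, ‖tensorExpansion e c x‖ ^ 2
      ≤ l * ∑ x, ‖tensorExpansion e c x‖ + (∑ x, ‖tensorExpansion e c x‖ ^ 4) / l ^ 2 := by
    rw [mul_sum, sum_div, ← sum_add_distrib]
    exact sum_le_sum fun x _ => hpt _ (norm_nonneg _)
  have h5 : (∑ x, ‖tensorExpansion e c x‖ ^ 4) / l ^ 2 ≤ (K : ℝ) ^ n * σ ^ 2 / 4 := by
    rw [div_le_iff₀ (by positivity)]
    refine h4.trans (le_of_eq ?_)
    rw [← hS, ← hb, ← hσS, hl]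
    ring
  rw [h2, ← hS, ← hσS] at hsum
  have hq : 0 ≤ (K : ℝ) ^ n * σ := by positivity
  have hkey : σ * ((K : ℝ) ^ n * σ) ≤ σ * (4 * b * ∑ x, ‖tensorExpansion e c x‖) := by
    have : l * ∑ x, ‖tensorExpansion e c x‖ = σ * (2 * b * ∑ x, ‖tensorExpansion e c x‖) := by
      rw [hl]; ring
    have : 0 ≤ σ * (b * ∑ x, ‖tensorExpansion e c x‖) := by positivity
    nlinarith
  exact le_of_mul_le_mul_left hkey hpos

theorem norm_average_tensorExpansion_le {K n : ℕ} (e : Fin K → Fin K → ℂ)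
    (c : (Fin n → Fin K) → ℂ) (M : ℝ) (hM : ∀ x, ‖tensorExpansion e c x‖ ≤ M)
    (p : Fin n → Fin K → ℝ) (hp : ∀ j w, 0 ≤ p j w) (hp1 : ∀ j, ∑ w, p j w = 1) :
    ‖∑ α, c α * ∏ j, ∑ w, (p j w : ℂ) * e w (α j)‖ ≤ M := by
  have h1 : ∑ α, c α * ∏ j, ∑ w, (p j w : ℂ) * e w (α j)
      = ∑ x : Fin n → Fin K, ((∏ j, p j (x j) : ℝ) : ℂ) * tensorExpansion e c x := by
    unfold tensorExpansion
    simp only [prod_univ_sum, Fintype.piFinset_univ, mul_sum]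
    rw [sum_comm]
    refine sum_congr rfl fun x _ => sum_congr rfl fun α _ => ?_
    rw [prod_mul_distrib]
    push_cast
    ring
  have h2 : ∑ x : Fin n → Fin K, ∏ j, p j (x j) = 1 := by
    rw [← Fintype.piFinset_univ, ← prod_univ_sum]
    simp [hp1]
  rw [h1]
  calc _ ≤ ∑ x : Fin n → Fin K, ‖((∏ j, p j (x j) : ℝ) : ℂ) * tensorExpansion e c x‖ :=
        norm_sum_le _ _
    _ ≤ ∑ x : Fin n → Fin K, (∏ j, p j (x j)) * M := by
      refine sum_le_sum fun x _ => ?_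
      have : 0 ≤ ∏ j, p j (x j) := prod_nonneg fun j _ => hp j _
      rw [norm_mul, Complex.norm_real, Real.norm_of_nonneg this]
      exact mul_le_mul_of_nonneg_left (hM x) this
    _ = M := by rw [← sum_mul, h2, one_mul]

/-- Restriction of the coefficients to the indices that involve the `j`-th variable. -/
def involving {K n : ℕ} [NeZero K] (c : (Fin n → Fin K) → ℂ) (j : Fin n) :
    (Fin n → Fin K) → ℂ :=
  fun α => if α j = 0 then 0 else c α

theorem norm_sum_involving_le {K n d : ℕ} [NeZero K] (hd : 1 ≤ d) (e : Fin K → Fin K → ℂ)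
    (h0 : ∀ w, e w 0 = 1) (hs : ∀ k, k ≠ 0 → ∑ w, e w k = 0)
    (c : (Fin n → Fin K) → ℂ) (hc : ∀ α, c α ≠ 0 → #{j | α j ≠ 0} ≤ d)
    (M : ℝ) (hM : ∀ x, ‖tensorExpansion e c x‖ ≤ M) (x : Fin n → Fin K) (S : Finset (Fin n)) :
    ‖∑ j ∈ S, tensorExpansion e (involving c j) x‖ ≤ 4 ^ (d ^ 2) * M := by
  have hK : (0 : ℝ) < K := by exact_mod_cast Nat.pos_of_neZero K
  set m : (Fin n → Fin K) → ℕ := fun α => #{j ∈ S | α j ≠ 0} with hm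
  set P : Polynomial ℂ := ∑ α : Fin n → Fin K,
    Polynomial.C (c α * ∏ j, e (x j) (α j)) * (1 - Polynomial.X) ^ m α with hP
  have hdeg : P.natDegree ≤ d := by
    refine Polynomial.natDegree_sum_le_of_forall_le _ _ fun α _ => ?_
    by_cases h : c α = 0
    · simp [h]
    · refine (Polynomial.natDegree_C_mul_le _ _).trans ?_
      refine Polynomial.natDegree_pow_le.trans ?_
      have h1 : (1 - Polynomial.X : Polynomial ℂ).natDegree ≤ 1 :=
        (Polynomial.natDegree_sub_le _ _).trans (by simp)
      have h2 : m α ≤ d := (card_le_card (filter_subset_filter _ (subset_univ S))).trans (hc α h)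
      nlinarith
  have hcoeff : P.coeff 1 = -∑ j ∈ S, tensorExpansion e (involving c j) x := by
    have h1 : P.coeff 1 = P.derivative.eval 0 := by
      rw [← Polynomial.coeff_zero_eq_eval_zero, Polynomial.coeff_derivative]
      simp
    have h2 : ∀ α, (m α : ℂ) = ∑ j ∈ S, if α j = 0 then 0 else 1 := by
      intro α
      rw [hm]
      simp only [card_filter, Nat.cast_sum, ite_not, Nat.cast_ite, Nat.cast_zero, Nat.cast_one]
    rw [h1, hP, Polynomial.derivative_sum, Polynomial.eval_finsetSum]
    unfold tensorExpansion
    rw [sum_comm, ← sum_neg_distrib]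
    refine sum_congr rfl fun α _ => ?_
    have h3 : ∑ j ∈ S, involving c j α * ∏ i, e (x i) (α i)
        = (m α : ℂ) * (c α * ∏ i, e (x i) (α i)) := by
      rw [h2, sum_mul]
      refine sum_congr rfl fun j _ => ?_
      unfold involving
      split_ifs <;> simp
    rw [h3]
    generalize c α * ∏ i, e (x i) (α i) = q
    simp [Polynomial.derivative_pow]
    ring
  have hbound : ∀ t : ℝ, 0 ≤ t → t ≤ 1 → ‖P.eval (t : ℂ)‖ ≤ M := by
    intro t ht0 ht1
    set s : Fin n → ℝ := fun j => if j ∈ S then t else 0 with hsdef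
    have hs0 : ∀ j, 0 ≤ s j := fun j => by simp only [hsdef]; split_ifs <;> simp [ht0]
    have hs1 : ∀ j, s j ≤ 1 := fun j => by simp only [hsdef]; split_ifs <;> simp [ht1]
    set p : Fin n → Fin K → ℝ := fun j w => (1 - s j) * (if w = x j then 1 else 0) + s j / K
      with hpdef
    have hp : ∀ j w, 0 ≤ p j w := by
      intro j w
      have := hs0 j
      have := sub_nonneg.2 (hs1 j)
      simp only [hpdef]
      split_ifs <;> positivity
    have hp1 : ∀ j, ∑ w, p j w = 1 := by
      intro j
      simp only [hpdef]
      rw [sum_add_distrib, ← mul_sum]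
      simp
      field_simp
      ring
    have hpe : ∀ j k, ∑ w, (p j w : ℂ) * e w k
        = e (x j) k * (if j ∈ S then (if k ≠ 0 then (1 - t : ℂ) else 1) else 1) := by
      intro j k
      have hKC : (K : ℂ) ≠ 0 := by exact_mod_cast hK.ne'
      have h1 : ∑ w, (p j w : ℂ) * e w k = (1 - s j) * e (x j) k + s j / K * ∑ w, e w k := by
        have h2 : ∀ w, (p j w : ℂ) * e w k
            = (if w = x j then (1 - s j) * e w k else 0) + s j / K * e w k := by
          intro w
          simp only [hpdef]
          split_ifs <;> push_cast <;> ring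
        simp only [h2, sum_add_distrib, ← mul_sum]
        simp
      rw [h1]
      by_cases hk : k = 0
      · subst hk
        simp only [h0]
        simp
      · rw [hs k hk]
        simp only [hsdef]
        split_ifs <;> simp [mul_comm]
    have heval : P.eval (t : ℂ) = ∑ α, c α * ∏ j, ∑ w, (p j w : ℂ) * e w (α j) := by
      rw [hP, Polynomial.eval_finsetSum]
      refine sum_congr rfl fun α _ => ?_
      simp only [hpe, prod_mul_distrib, prod_ite_mem, univ_inter]
      rw [prod_ite, prod_const, prod_const_one, mul_one]
      rw [← mul_assoc]
      generalize c α * ∏ i, e (x i) (α i) = q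
      simp [hm]
    rw [heval]
    exact norm_average_tensorExpansion_le e c M hM p hp hp1
  have := norm_coeff_one_le_of_bounded_on_unit_interval d hd P M hdeg hbound
  rwa [hcoeff, norm_neg] at this

/-- The `ℓ¹` norm of the `L²` influences is controlled by the supremum norm. -/
theorem sum_sqrt_sum_involving_le {K n d : ℕ} [NeZero K] (hd : 1 ≤ d) (e : Fin K → Fin K → ℂ)
    (he : ∀ a : Fin K → ℂ, ∑ w, ‖∑ k, e w k * a k‖ ^ 2 = K * ∑ k, ‖a k‖ ^ 2)
    (h0 : ∀ w, e w 0 = 1) (hn : ∀ w k, ‖e w k‖ ≤ 1) (hs : ∀ k, k ≠ 0 → ∑ w, e w k = 0)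
    (c : (Fin n → Fin K) → ℂ) (hc : ∀ α, c α ≠ 0 → #{j | α j ≠ 0} ≤ d)
    (M : ℝ) (hM : ∀ x, ‖tensorExpansion e c x‖ ≤ M) :
    ∑ j, √(∑ α, ‖involving c j α‖ ^ 2) ≤ 16 * (4 * K) ^ d * 4 ^ (d ^ 2) * M := by
  have hK : (0 : ℝ) < K := by exact_mod_cast Nat.pos_of_neZero K
  have h1 : ∀ j, (K : ℝ) ^ n * √(∑ α, ‖involving c j α‖ ^ 2)
      ≤ 4 * (4 * K) ^ d * ∑ x, ‖tensorExpansion e (involving c j) x‖ := fun j =>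
    sqrt_sum_norm_sq_le_sum_norm_tensorExpansion e he h0 hn hs _ fun α hα =>
      hc α fun h => hα (by simp [involving, h])
  have h2 : ∀ x, ∑ j, ‖tensorExpansion e (involving c j) x‖ ≤ 4 * (4 ^ (d ^ 2) * M) := fun x =>
    sum_norm_le_four_mul_of_norm_sum_subset_le _ _
      (norm_sum_involving_le hd e h0 hs c hc M hM x)
  have h3 : (K : ℝ) ^ n * ∑ j, √(∑ α, ‖involving c j α‖ ^ 2)
      ≤ (K : ℝ) ^ n * (16 * (4 * K) ^ d * 4 ^ (d ^ 2) * M) := by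
    calc _ ≤ ∑ j, 4 * (4 * K) ^ d * ∑ x, ‖tensorExpansion e (involving c j) x‖ := by
          rw [mul_sum]; exact sum_le_sum fun j _ => h1 j
      _ = 4 * (4 * K) ^ d * ∑ x, ∑ j, ‖tensorExpansion e (involving c j) x‖ := by
          rw [← mul_sum, sum_comm]
      _ ≤ 4 * (4 * K) ^ d * ∑ _x : Fin n → Fin K, 4 * (4 ^ (d ^ 2) * M) := by
          gcongr with x; exact h2 x
      _ = _ := by
          simp only [sum_const, card_univ, Fintype.card_pi, Fintype.card_fin, prod_const,
            nsmul_eq_mul, Nat.cast_pow]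
          ring
  exact le_of_mul_le_mul_left h3 (by positivity)

/-- The pointwise inequality behind the mixed-norm interpolation: if `a` is at most each of the
numbers `u j ≤ 1`, `j ∈ s`, then `a ^ (2d/(d+1))` is at most `∑ a² / u j + ∏ u j`. -/
theorem rpow_le_sum_div_add_prod {ι : Type*} {d : ℕ} (s : Finset ι) (hsd : #s ≤ d)
    (a : ℝ) (ha0 : 0 < a) (ha1 : a ≤ 1) (u : ι → ℝ) (hu0 : ∀ j ∈ s, 0 < u j)
    (hu1 : ∀ j ∈ s, u j ≤ 1) :
    a ^ ((2 * (d : ℝ)) / ((d : ℝ) + 1)) ≤ ∑ j ∈ s, a ^ 2 / u j + ∏ j ∈ s, u j := by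
  rcases s.eq_empty_or_nonempty with h | h
  · subst h
    simpa using Real.rpow_le_one ha0.le ha1 (by positivity)
  · obtain ⟨i, hi, hmin⟩ := exists_min_image s u h
    have hd : (0 : ℝ) < d + 1 := by positivity
    set y : ℝ := a ^ (2 / ((d : ℝ) + 1)) with hy
    have hy0 : 0 < y := Real.rpow_pos_of_pos ha0 _
    have hyd : a ^ ((2 * (d : ℝ)) / ((d : ℝ) + 1)) = y ^ d := by
      rw [hy, ← Real.rpow_natCast, ← Real.rpow_mul ha0.le]
      congr 1
      ring
    have hyd1 : a ^ 2 = y ^ (d + 1) := by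
      rw [hy, ← Real.rpow_natCast, ← Real.rpow_natCast, ← Real.rpow_mul ha0.le]
      congr 1
      push_cast
      field_simp
    have hprod : u i ^ d ≤ ∏ j ∈ s, u j := by
      calc u i ^ d ≤ u i ^ #s := pow_le_pow_of_le_one (hu0 i hi).le (hu1 i hi) hsd
        _ = ∏ _j ∈ s, u i := (prod_const _).symm
        _ ≤ ∏ j ∈ s, u j := prod_le_prod (fun j _ => (hu0 i hi).le) fun j hj => hmin j hj
    have hsum : a ^ 2 / u i ≤ ∑ j ∈ s, a ^ 2 / u j :=
      single_le_sum (f := fun j => a ^ 2 / u j)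
        (fun j hj => div_nonneg (sq_nonneg a) (hu0 j hj).le) hi
    rw [hyd]
    rcases le_total y (u i) with hle | hle
    · have : y ^ d ≤ u i ^ d := by gcongr
      have : 0 ≤ a ^ 2 / u i := div_nonneg (sq_nonneg a) (hu0 i hi).le
      linarith
    · have h1 : y ^ d ≤ a ^ 2 / u i := by
        rw [le_div_iff₀ (hu0 i hi), hyd1, pow_succ]
        gcongr
      have : 0 ≤ u i ^ d := pow_nonneg (hu0 i hi).le _
      linarith

/-- Mixed-norm interpolation, normalized. -/
theorem sum_rpow_le_of_sum_sqrt_le_one {K n d : ℕ} [NeZero K] (c : (Fin n → Fin K) → ℂ)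
    (hd : 1 ≤ d) (hc : ∀ α, c α ≠ 0 → #{j | α j ≠ 0} ≤ d) (hc1 : ∀ α, ‖c α‖ ≤ 1)
    (hu : ∑ j, √(∑ α, ‖involving c j α‖ ^ 2) ≤ 1) :
    ∑ α, ‖c α‖ ^ ((2 * (d : ℝ)) / ((d : ℝ) + 1)) ≤ 1 + Real.exp K := by
  set u : Fin n → ℝ := fun j => √(∑ α, ‖involving c j α‖ ^ 2) with hudef
  have hu0 : ∀ j, 0 ≤ u j := fun j => Real.sqrt_nonneg _
  have husq : ∀ j, u j ^ 2 = ∑ α, ‖involving c j α‖ ^ 2 := fun j =>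
    Real.sq_sqrt (sum_nonneg fun _ _ => sq_nonneg _)
  have hu1 : ∀ j, u j ≤ 1 := fun j =>
    (single_le_sum (f := u) (fun j _ => hu0 j) (mem_univ j)).trans hu
  have hupos : ∀ α, c α ≠ 0 → ∀ j, α j ≠ 0 → 0 < u j := by
    intro α hα j hj
    refine Real.sqrt_pos.2 (sum_pos' (fun _ _ => sq_nonneg _) ⟨α, mem_univ _, ?_⟩)
    simp only [involving, if_neg hj]
    positivity
  have hpt : ∀ α, ‖c α‖ ^ ((2 * (d : ℝ)) / ((d : ℝ) + 1))
      ≤ ∑ j, ‖involving c j α‖ ^ 2 / u j + ∏ j, (if α j = 0 then 1 else u j) := by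
    intro α
    have hprod : 0 ≤ ∏ j, (if α j = 0 then 1 else u j) :=
      prod_nonneg fun j _ => by split_ifs <;> simp [hu0]
    have hsum : 0 ≤ ∑ j, ‖involving c j α‖ ^ 2 / u j :=
      sum_nonneg fun j _ => div_nonneg (sq_nonneg _) (hu0 j)
    by_cases h : c α = 0
    · have hd' : (0 : ℝ) < d := by exact_mod_cast hd
      have : (2 * (d : ℝ)) / ((d : ℝ) + 1) ≠ 0 := by positivity
      rw [h, norm_zero, Real.zero_rpow this]
      linarith
    · refine (rpow_le_sum_div_add_prod ({j | α j ≠ 0} : Finset (Fin n)) (hc α h) ‖c α‖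
        (norm_pos_iff.2 h) (hc1 α) u (fun j hj => hupos α h j (mem_filter.1 hj).2)
        (fun j _ => hu1 j)).trans (le_of_eq ?_)
      rw [sum_filter, prod_filter]
      congr 1
      · refine sum_congr rfl fun j _ => ?_
        unfold involving
        split_ifs <;> simp_all
      · refine prod_congr rfl fun j _ => ?_
        split_ifs <;> simp_all
  have h1 : ∑ α, ∑ j, ‖involving c j α‖ ^ 2 / u j ≤ 1 := by
    rw [sum_comm]
    refine le_trans (le_of_eq (sum_congr rfl fun j _ => ?_)) hu
    rw [← sum_div, ← husq, sq, mul_self_div_self]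
  have h2 : ∑ α : Fin n → Fin K, ∏ j, (if α j = 0 then 1 else u j) ≤ Real.exp K := by
    have e : ∑ α : Fin n → Fin K, ∏ j, (if α j = 0 then 1 else u j)
        = ∏ j, ∑ k : Fin K, (if k = 0 then 1 else u j) := by
      rw [prod_univ_sum, Fintype.piFinset_univ]
    rw [e]
    have hle : ∀ j, ∑ k : Fin K, (if k = 0 then 1 else u j) ≤ Real.exp (K * u j) := by
      intro j
      calc ∑ k : Fin K, (if k = 0 then 1 else u j)
          ≤ ∑ k : Fin K, ((if k = 0 then 1 else 0) + u j) := by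
            refine sum_le_sum fun k _ => ?_
            have := hu0 j
            split_ifs <;> linarith
        _ = K * u j + 1 := by
            rw [sum_add_distrib]
            simp [add_comm]
        _ ≤ _ := Real.add_one_le_exp _
    calc _ ≤ ∏ j, Real.exp (K * u j) := by
          refine prod_le_prod (fun j _ => sum_nonneg fun k _ => ?_) fun j _ => hle j
          split_ifs <;> simp [hu0]
      _ = Real.exp (K * ∑ j, u j) := by rw [← Real.exp_sum, mul_sum]
      _ ≤ Real.exp K := Real.exp_le_exp.2 (mul_le_of_le_one_right (Nat.cast_nonneg K) hu)
  calc _ ≤ ∑ α, (∑ j, ‖involving c j α‖ ^ 2 / u j + ∏ j, (if α j = 0 then 1 else u j)) :=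
        sum_le_sum fun α _ => hpt α
    _ ≤ 1 + Real.exp K := by rw [sum_add_distrib]; linarith

/-- Mixed-norm interpolation. -/
theorem rpow_sum_rpow_le_of_sum_sqrt_le {K n d : ℕ} [NeZero K] (c : (Fin n → Fin K) → ℂ)
    (hd : 1 ≤ d) (hc : ∀ α, c α ≠ 0 → #{j | α j ≠ 0} ≤ d) (A : ℝ) (hA : 0 < A)
    (hcA : ∀ α, ‖c α‖ ≤ A) (hu : ∑ j, √(∑ α, ‖involving c j α‖ ^ 2) ≤ A) :
    (∑ α, ‖c α‖ ^ ((2 * (d : ℝ)) / ((d : ℝ) + 1))) ^ (((d : ℝ) + 1) / (2 * (d : ℝ)))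
      ≤ A * (1 + Real.exp K) := by
  have hd' : (1 : ℝ) ≤ d := by exact_mod_cast hd
  set p : ℝ := (2 * (d : ℝ)) / ((d : ℝ) + 1) with hp
  have hpq : ((d : ℝ) + 1) / (2 * (d : ℝ)) = p⁻¹ := by rw [hp, inv_div]
  have hp0 : 0 < p := by positivity
  have hp1 : p⁻¹ ≤ 1 := by
    rw [← hpq, div_le_one (by positivity)]
    linarith
  set a : (Fin n → Fin K) → ℂ := fun α => (A : ℂ)⁻¹ * c α with ha
  have hnorm : ∀ z : ℂ, ‖(A : ℂ)⁻¹ * z‖ = A⁻¹ * ‖z‖ := by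
    intro z
    rw [norm_mul, norm_inv, Complex.norm_real, Real.norm_of_nonneg hA.le]
  have hinv : ∀ j α, involving a j α = (A : ℂ)⁻¹ * involving c j α := by
    intro j α
    simp only [involving, ha]
    split_ifs <;> simp
  have h1 : ∑ α, ‖a α‖ ^ p ≤ 1 + Real.exp K := by
    refine sum_rpow_le_of_sum_sqrt_le_one a hd (fun α h => hc α fun h' => h ?_) (fun α => ?_) ?_
    · simp [ha, h']
    · rw [ha, hnorm, inv_mul_le_one₀ hA]
      exact hcA α
    · simp only [hinv, hnorm, mul_pow, ← mul_sum]
      have : ∀ t : ℝ, √((A⁻¹) ^ 2 * t) = A⁻¹ * √t := fun t => by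
        rw [Real.sqrt_mul (sq_nonneg _), Real.sqrt_sq (inv_nonneg.2 hA.le)]
      simp only [this, ← mul_sum]
      rwa [inv_mul_le_one₀ hA]
  have h2 : ∑ α, ‖c α‖ ^ p = A ^ p * ∑ α, ‖a α‖ ^ p := by
    rw [mul_sum]
    refine sum_congr rfl fun α _ => ?_
    rw [← Real.mul_rpow hA.le (norm_nonneg _)]
    simp only [ha, hnorm]
    rw [mul_inv_cancel_left₀ hA.ne']
  have h3 : 0 ≤ ∑ α, ‖a α‖ ^ p := sum_nonneg fun _ _ => by positivity
  rw [hpq, h2, Real.mul_rpow (by positivity) h3, Real.rpow_rpow_inv hA.le hp0.ne']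
  refine mul_le_mul_of_nonneg_left ?_ hA.le
  have h4 : (1 : ℝ) ≤ 1 + Real.exp K := by linarith [Real.exp_pos K]
  calc _ ≤ (1 + Real.exp K) ^ p⁻¹ := Real.rpow_le_rpow h3 h1 (by positivity)
    _ ≤ (1 + Real.exp K) ^ (1 : ℝ) := Real.rpow_le_rpow_of_exponent_le h4 hp1
    _ = _ := Real.rpow_one _

/-- The Bohnenblust–Hille inequality for expansions in tensor products of a bounded orthogonal
system containing the constants. -/
theorem rpow_sum_rpow_le_of_norm_tensorExpansion_le {K n d : ℕ} [NeZero K] (hd : 1 ≤ d)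
    (e : Fin K → Fin K → ℂ)
    (he : ∀ a : Fin K → ℂ, ∑ w, ‖∑ k, e w k * a k‖ ^ 2 = K * ∑ k, ‖a k‖ ^ 2)
    (h0 : ∀ w, e w 0 = 1) (hn : ∀ w k, ‖e w k‖ ≤ 1) (hs : ∀ k, k ≠ 0 → ∑ w, e w k = 0)
    (c : (Fin n → Fin K) → ℂ) (hc : ∀ α, c α ≠ 0 → #{j | α j ≠ 0} ≤ d)
    (M : ℝ) (hM : ∀ x, ‖tensorExpansion e c x‖ ≤ M) :
    (∑ α, ‖c α‖ ^ ((2 * (d : ℝ)) / ((d : ℝ) + 1))) ^ (((d : ℝ) + 1) / (2 * (d : ℝ)))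
      ≤ (256 * K * (1 + Real.exp K)) ^ (d ^ 2) * M := by
  have hK : (1 : ℝ) ≤ K := by exact_mod_cast NeZero.one_le
  have hM0 : 0 ≤ M := (norm_nonneg _).trans (hM fun _ => 0)
  have hcM : ∀ α, ‖c α‖ ≤ M := by
    have h1 : (K : ℝ) ^ n * ∑ α, ‖c α‖ ^ 2 ≤ (K : ℝ) ^ n * M ^ 2 := by
      rw [← sum_norm_sq_tensorExpansion e he n c]
      calc _ ≤ ∑ _x : Fin n → Fin K, M ^ 2 :=
            sum_le_sum fun x _ => pow_le_pow_left₀ (norm_nonneg _) (hM x) 2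
        _ = _ := by simp
    have h2 := le_of_mul_le_mul_left h1 (by positivity)
    intro α
    refine le_of_sq_le_sq ?_ hM0
    exact (single_le_sum (f := fun α => ‖c α‖ ^ 2) (fun _ _ => sq_nonneg _) (mem_univ α)).trans h2
  rcases hM0.eq_or_lt with h | hpos
  · have hz : ∀ α, ‖c α‖ = 0 := fun α => le_antisymm (h ▸ hcM α) (norm_nonneg _)
    have hd' : (0 : ℝ) < d := by exact_mod_cast hd
    simp only [hz]
    rw [Real.zero_rpow (by positivity), sum_const_zero, Real.zero_rpow (by positivity), ← h,
      mul_zero]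
  have hd2 : d ≤ d ^ 2 := by nlinarith
  have hone : (1 : ℝ) ≤ 4 * K := by linarith
  have hA := sum_sqrt_sum_involving_le hd e he h0 hn hs c hc M hM
  have hfac : (1 : ℝ) ≤ 16 * (4 * K) ^ d * 4 ^ (d ^ 2) := by
    have := one_le_pow₀ hone (n := d)
    have := one_le_pow₀ (by norm_num : (1 : ℝ) ≤ 4) (n := d ^ 2)
    nlinarith
  refine (rpow_sum_rpow_le_of_sum_sqrt_le c hd hc _ (by positivity) (fun α =>
    (hcM α).trans (le_mul_of_one_le_left hM0 hfac)) hA).trans ?_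
  have hE : (1 : ℝ) ≤ 1 + Real.exp K := by linarith [Real.exp_pos K]
  have hne : d ^ 2 ≠ 0 := by positivity
  calc 16 * (4 * K) ^ d * 4 ^ (d ^ 2) * M * (1 + Real.exp K)
      ≤ 16 ^ (d ^ 2) * (4 * K) ^ (d ^ 2) * 4 ^ (d ^ 2) * M * (1 + Real.exp K) ^ (d ^ 2) := by
        gcongr
        · exact le_self_pow₀ (by norm_num) hne
        · exact le_self_pow₀ hE hne
    _ = (256 * K * (1 + Real.exp K)) ^ (d ^ 2) * M := by
        rw [show (256 : ℝ) * K * (1 + Real.exp K) = 16 * (4 * K) * 4 * (1 + Real.exp K) by ring]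
        simp only [mul_pow]
        ring

theorem IsPrimitiveRoot.sum_norm_sq_sum_pow_mul {K : ℕ} {ζ : ℂ} (hζ : IsPrimitiveRoot ζ K)
    (hK : K ≠ 0) (a : Fin K → ℂ) :
    ∑ w : Fin K, ‖∑ k : Fin K, ζ ^ ((w : ℕ) * (k : ℕ)) * a k‖ ^ 2 = K * ∑ k, ‖a k‖ ^ 2 := by
  have hζ1 : ‖ζ‖ = 1 := hζ.norm'_eq_one hK
  have hζ0 : ζ ≠ 0 := hζ.ne_zero hK
  have hconj : (starRingEnd ℂ) ζ = ζ⁻¹ := (Complex.inv_eq_conj hζ1).symm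
  have horth : ∀ k l : Fin K, ∑ w : Fin K, ζ ^ ((w : ℕ) * (k : ℕ)) *
      (starRingEnd ℂ) (ζ ^ ((w : ℕ) * (l : ℕ))) = if k = l then (K : ℂ) else 0 := by
    intro k l
    have h1 : ∀ w : ℕ, ζ ^ (w * (k : ℕ)) * (starRingEnd ℂ) (ζ ^ (w * (l : ℕ)))
        = (ζ ^ (k : ℕ) * (ζ ^ (l : ℕ))⁻¹) ^ w := by
      intro w
      rw [map_pow, hconj, mul_pow, ← inv_pow, ← pow_mul, ← pow_mul, mul_comm w, mul_comm w]
    simp only [h1]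
    rw [Fin.sum_univ_eq_sum_range (fun w => (ζ ^ (k : ℕ) * (ζ ^ (l : ℕ))⁻¹) ^ w)]
    split_ifs with h
    · subst h
      simp [hζ0]
    · have hq : ζ ^ (k : ℕ) * (ζ ^ (l : ℕ))⁻¹ ≠ 1 := by
        intro hq
        rw [mul_inv_eq_one₀ (pow_ne_zero _ hζ0)] at hq
        exact h (Fin.ext (hζ.pow_inj k.2 l.2 hq))
      rw [geom_sum_eq hq, mul_pow, inv_pow, ← pow_mul, ← pow_mul, mul_comm (k : ℕ),
        pow_mul, mul_comm (l : ℕ), pow_mul, hζ.pow_eq_one]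
      simp
  have key : ((∑ w : Fin K, ‖∑ k : Fin K, ζ ^ ((w : ℕ) * (k : ℕ)) * a k‖ ^ 2 : ℝ) : ℂ)
      = ((K * ∑ k, ‖a k‖ ^ 2 : ℝ) : ℂ) := by
    push_cast
    simp only [← Complex.mul_conj', map_sum, map_mul, sum_mul_sum]
    have h2 : ∀ w k l : Fin K, ζ ^ ((w : ℕ) * (k : ℕ)) * a k *
        ((starRingEnd ℂ) (ζ ^ ((w : ℕ) * (l : ℕ))) * (starRingEnd ℂ) (a l))
        = ζ ^ ((w : ℕ) * (k : ℕ)) * (starRingEnd ℂ) (ζ ^ ((w : ℕ) * (l : ℕ)))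
          * (a k * (starRingEnd ℂ) (a l)) := fun w k l => by ring
    simp only [h2]
    rw [sum_comm, mul_sum]
    refine sum_congr rfl fun k _ => ?_
    rw [sum_comm]
    simp only [← sum_mul, horth, ite_mul, zero_mul]
    simp
  exact_mod_cast key

theorem IsPrimitiveRoot.sum_fin_pow_mul_eq_zero {K : ℕ} [NeZero K] {ζ : ℂ}
    (hζ : IsPrimitiveRoot ζ K) (k : Fin K) (hk : k ≠ 0) :
    ∑ w : Fin K, ζ ^ ((w : ℕ) * (k : ℕ)) = 0 := by
  have hk' : (k : ℕ) ≠ 0 := fun h => hk (Fin.ext (by simpa using h))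
  have h1 : ∀ w : ℕ, ζ ^ (w * (k : ℕ)) = (ζ ^ (k : ℕ)) ^ w := fun w => by
    rw [← pow_mul, mul_comm]
  simp only [h1]
  rw [Fin.sum_univ_eq_sum_range (fun w => (ζ ^ (k : ℕ)) ^ w),
    geom_sum_eq (hζ.pow_ne_one_of_pos_of_lt hk' k.2), ← pow_mul, mul_comm, pow_mul,
    hζ.pow_eq_one]
  simp

/-- The Bohnenblust–Hille inequality on cyclic groups with constant `C ^ (d ^ 2)`. -/
theorem bohnenblust_hille_cyclic (K : ℕ) [NeZero K] (d : ℕ) (hd : 1 ≤ d) (n : ℕ)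
    (c : (Fin n → Fin K) → ℂ) (hc : ∀ α : Fin n → Fin K, d < ∑ j, (α j : ℕ) → c α = 0) :
    (∑ α : Fin n → Fin K, ‖c α‖ ^ ((2 * (d : ℝ)) / ((d : ℝ) + 1)))
        ^ (((d : ℝ) + 1) / (2 * (d : ℝ)))
      ≤ (256 * K * (1 + Real.exp K)) ^ (d ^ 2) * ⨆ (z : Fin n → ℂ) (_ : ∀ j, z j ^ K = 1),
          ‖∑ α : Fin n → Fin K, c α * ∏ j, z j ^ (α j : ℕ)‖ := by
  have hK : K ≠ 0 := NeZero.ne K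
  have hζ := Complex.isPrimitiveRoot_exp K hK
  set ζ := Complex.exp (2 * Real.pi * Complex.I / K) with hζdef
  have hζ1 : ‖ζ‖ = 1 := hζ.norm'_eq_one hK
  have hsupp : ∀ α, c α ≠ 0 → #{j | α j ≠ 0} ≤ d := by
    intro α hα
    refine le_trans ?_ (not_lt.1 fun h => hα (hc α h))
    rw [card_filter]
    refine sum_le_sum fun j _ => ?_
    split_ifs with h
    · exact Nat.one_le_iff_ne_zero.2 fun h' => h (Fin.ext (by simpa using h'))
    · exact Nat.zero_le _
  refine rpow_sum_rpow_le_of_norm_tensorExpansion_le hd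
    (fun w k => ζ ^ ((w : ℕ) * (k : ℕ))) (hζ.sum_norm_sq_sum_pow_mul hK) (by simp)
    (by simp [hζ1]) hζ.sum_fin_pow_mul_eq_zero c hsupp _ fun x => ?_
  have hbdd : BddAbove (Set.range fun z : Fin n → ℂ => ⨆ (_ : ∀ j, z j ^ K = 1),
      ‖∑ α : Fin n → Fin K, c α * ∏ j, z j ^ (α j : ℕ)‖) := by
    refine ⟨∑ α, ‖c α‖, ?_⟩
    rintro _ ⟨z, rfl⟩
    refine Real.iSup_le (fun hz => ?_) (sum_nonneg fun _ _ => norm_nonneg _)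
    refine (norm_sum_le _ _).trans (sum_le_sum fun α _ => le_of_eq ?_)
    have : ∀ j, ‖z j‖ = 1 := fun j => Complex.norm_eq_one_of_pow_eq_one (hz j) hK
    simp [norm_prod, this]
  have hx : ∀ j, (ζ ^ (x j : ℕ)) ^ K = 1 := fun j => by
    rw [← pow_mul, mul_comm, pow_mul, hζ.pow_eq_one, one_pow]
  refine le_trans (le_of_eq ?_) (le_ciSup hbdd fun j => ζ ^ (x j : ℕ))
  rw [ciSup_pos hx]
  simp only [tensorExpansion, pow_mul]

/-- Bohnenblust–Hille inequality on cyclic groups `Ω_K` (`K ≥ 3`): for each `d ≥ 1` there is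
`C(d,K) > 0` such that for all `n ≥ 1` and every `f : Ω_Kⁿ → ℂ` of degree at most `d`,
`(∑_α |f̂(α)|^{2d/(d+1)})^{(d+1)/(2d)} ≤ C(d,K) · sup_{z ∈ Ω_Kⁿ} |f(z)|`; moreover, if `K` is
prime the constant may be taken of the form `C_K^{d²}` with `C_K` depending only on `K`. -/
theorem stmt11 (K : ℕ) (hK : 3 ≤ K) :
    (∀ d : ℕ, 1 ≤ d →
      ∃ C : ℝ, 0 < C ∧ ∀ n : ℕ, 1 ≤ n → ∀ c : (Fin n → Fin K) → ℂ,
        (∀ α : Fin n → Fin K, d < ∑ j, (α j : ℕ) → c α = 0) →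
        (∑ α : Fin n → Fin K, ‖c α‖ ^ ((2 * (d : ℝ)) / ((d : ℝ) + 1)))
            ^ (((d : ℝ) + 1) / (2 * (d : ℝ)))
          ≤ C * ⨆ (z : Fin n → ℂ) (_ : ∀ j, z j ^ K = 1),
              ‖∑ α : Fin n → Fin K, c α * ∏ j, z j ^ (α j : ℕ)‖) ∧
    (Nat.Prime K →
      ∃ CK : ℝ, 0 < CK ∧ ∀ d : ℕ, 1 ≤ d → ∀ n : ℕ, 1 ≤ n → ∀ c : (Fin n → Fin K) → ℂ,
        (∀ α : Fin n → Fin K, d < ∑ j, (α j : ℕ) → c α = 0) →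
        (∑ α : Fin n → Fin K, ‖c α‖ ^ ((2 * (d : ℝ)) / ((d : ℝ) + 1)))
            ^ (((d : ℝ) + 1) / (2 * (d : ℝ)))
          ≤ CK ^ (d ^ 2) * ⨆ (z : Fin n → ℂ) (_ : ∀ j, z j ^ K = 1),
              ‖∑ α : Fin n → Fin K, c α * ∏ j, z j ^ (α j : ℕ)‖) := by
  have : NeZero K := ⟨by omega⟩
  have hpos : (0 : ℝ) < 256 * K * (1 + Real.exp K) := by
    have : (0 : ℝ) < K := by exact_mod_cast Nat.pos_of_neZero K
    positivity
  exact ⟨fun d hd => ⟨_, pow_pos hpos (d ^ 2), fun n _ c hc =>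
      bohnenblust_hille_cyclic K d hd n c hc⟩,
    fun _ => ⟨_, hpos, fun d hd n _ c hc => bohnenblust_hille_cyclic K d hd n c hc⟩⟩
end

section
/- Fix a prime number K ≥ 3 and an integer d ≥ 1. There exists a constant C(d,K) > 0 depending only on d and K such that for every n ≥ 1 and every observable A ∈ M_K(ℂ)^{⊗n} of degree at most d (with respect to the Heisenberg–Weyl basis), one has (∑_{(ℓ⃗,m⃗)} |Â(ℓ⃗,m⃗)|^{2d/(d+1)})^{(d+1)/(2d)} ≤ C(d,K) ‖A‖, where ‖A‖ is the operator norm. -/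
open Finset

/-- The clock matrix `Z` of size `K`: `Z|j⟩ = ω^j |j⟩` with `ω = e^{2πi/K}`. -/
noncomputable def clockMat (K : ℕ) : Matrix (Fin K) (Fin K) ℂ :=
  Matrix.diagonal fun j => Complex.exp (2 * Real.pi * Complex.I * (j : ℕ) / K)

/-- The shift matrix `X` of size `K`: `X|j⟩ = |j+1⟩` (mod `K`). -/
noncomputable def shiftMat (K : ℕ) : Matrix (Fin K) (Fin K) ℂ :=
  Matrix.of fun i j => if (i : ℕ) = ((j : ℕ) + 1) % K then 1 else 0

/-- The tensor product `X^{ℓ₁}Z^{m₁} ⊗ ⋯ ⊗ X^{ℓₙ}Z^{mₙ}` as a matrix indexed by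
`(Fin n → Fin K)`. -/
noncomputable def hwTensor {K n : ℕ} (l m : Fin n → Fin K) :
    Matrix (Fin n → Fin K) (Fin n → Fin K) ℂ :=
  Matrix.of fun x y => ∏ j, ((shiftMat K ^ (l j : ℕ)) * (clockMat K ^ (m j : ℕ))) (x j) (y j)

/-- The multilinear form `v ↦ ∑ α, g α * ∏ j, v j (α j)` with coefficients `g`. -/
noncomputable def multiEval {T : Type*} [Fintype T] {n : ℕ} (g : (Fin n → T) → ℂ)
    (v : Fin n → T → ℂ) : ℂ :=
  ∑ α, g α * ∏ j, v j (α j)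

/-- The tensor product `W (α 0) ⊗ ⋯ ⊗ W (α (n - 1))`. -/
def matTensor {T κ : Type*} {n : ℕ} (W : T → Matrix κ κ ℂ) (α : Fin n → T) :
    Matrix (Fin n → κ) (Fin n → κ) ℂ :=
  Matrix.of fun x y => ∏ j, W (α j) (x j) (y j)

/-- The values `τ ↦ tr (W τ * ρ)` for density matrices `ρ = B * Bᴴ`. -/
def stateValues {T κ : Type*} [Fintype κ] (W : T → Matrix κ κ ℂ) : Set (T → ℂ) :=
  {v | ∃ B : Matrix κ κ ℂ, ∑ r, ∑ x, ‖B x r‖ ^ 2 = 1 ∧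
    v = fun τ => Matrix.trace (W τ * (B * B.conjTranspose))}

lemma trace_mul_mul_conjTranspose {κ : Type*} [Fintype κ] (M B : Matrix κ κ ℂ) :
    Matrix.trace (M * (B * B.conjTranspose)) =
      ∑ r, ∑ x, ∑ y, star (B x r) * M x y * B y r := by
  simp only [Matrix.trace, Matrix.diag, Matrix.mul_apply, Matrix.conjTranspose_apply,
    Finset.mul_sum]
  rw [Finset.sum_comm' (s := univ) (t := fun _ => univ) (t' := univ) (s' := fun _ => univ)
    (by simp)]
  rw [Finset.sum_congr rfl fun y _ => Finset.sum_comm]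
  rw [Finset.sum_comm]
  refine Finset.sum_congr rfl fun r _ => ?_
  rw [Finset.sum_comm]
  refine Finset.sum_congr rfl fun x _ => Finset.sum_congr rfl fun y _ => ?_
  ring

lemma prod_sum_three {κ : Type*} [Fintype κ] {n : ℕ} {R : Type*} [CommSemiring R]
    (f : Fin n → κ → κ → κ → R) :
    ∏ j, ∑ r, ∑ x, ∑ y, f j r x y =
      ∑ r : Fin n → κ, ∑ x : Fin n → κ, ∑ y : Fin n → κ, ∏ j, f j (r j) (x j) (y j) := by
  classical
  simp only [Fintype.prod_sum]

lemma norm_multiEval_le_of_mem_stateValues {T κ : Type*} [Fintype T] [Fintype κ] [DecidableEq κ]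
    {n : ℕ} (W : T → Matrix κ κ ℂ) (g : (Fin n → T) → ℂ) (v : Fin n → T → ℂ)
    (hv : ∀ j, v j ∈ stateValues W) :
    ‖multiEval g v‖ ≤ ‖Matrix.toEuclideanCLM (𝕜 := ℂ) (∑ α, g α • matTensor W α)‖ := by
  classical
  choose B hB hvB using hv
  set L := Matrix.toEuclideanCLM (𝕜 := ℂ) (∑ α, g α • matTensor W α) with hL
  let b : (Fin n → κ) → EuclideanSpace ℂ (Fin n → κ) :=
    fun r => WithLp.toLp 2 fun x => ∏ j, B j (x j) (r j)
  have key : multiEval g v = ∑ r, inner ℂ (b r) (L (b r)) := by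
    have h1 : ∀ r, inner ℂ (b r) (L (b r)) =
        ∑ α, g α * ∑ x : Fin n → κ, ∑ y : Fin n → κ, ∏ j,
          (star (B j (x j) (r j)) * W (α j) (x j) (y j) * B j (y j) (r j)) := by
      intro r
      simp only [hL, PiLp.inner_apply, Matrix.ofLp_toEuclideanCLM, Matrix.mulVec, dotProduct, b,
        Matrix.sum_apply, Matrix.smul_apply, RCLike.inner_apply, smul_eq_mul, matTensor,
        Matrix.of_apply, Finset.prod_mul_distrib, Finset.mul_sum, Finset.sum_mul, map_prod,
        RCLike.star_def]
      rw [Finset.sum_congr rfl fun x _ => Finset.sum_comm, Finset.sum_comm]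
      refine Finset.sum_congr rfl fun α _ => Finset.sum_congr rfl fun x _ =>
        Finset.sum_congr rfl fun y _ => ?_
      ring
    simp only [h1]
    rw [Finset.sum_comm]
    simp only [multiEval]
    refine Finset.sum_congr rfl fun α _ => ?_
    rw [← Finset.mul_sum, ← prod_sum_three (fun j r x y => star (B j x r) * W (α j) x y * B j y r)]
    congr 1
    refine Finset.prod_congr rfl fun j _ => ?_
    rw [hvB j]
    exact trace_mul_mul_conjTranspose _ _
  have hb : ∑ r, ‖b r‖ ^ 2 = 1 := by
    simp only [b, EuclideanSpace.norm_sq_eq, norm_prod, ← Finset.prod_pow]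
    have : ∏ j, ∑ r, ∑ x, ‖B j x r‖ ^ 2 = 1 := by simp [hB]
    rw [← this]
    simp only [Fintype.prod_sum]
  rw [key]
  calc ‖∑ r, inner ℂ (b r) (L (b r))‖ ≤ ∑ r, ‖L‖ * ‖b r‖ ^ 2 := by
        refine norm_sum_le_of_le _ fun r _ => ?_
        calc _ ≤ ‖b r‖ * ‖L (b r)‖ := norm_inner_le_norm _ _
          _ ≤ ‖b r‖ * (‖L‖ * ‖b r‖) := by gcongr; exact L.le_opNorm _
          _ = _ := by ring
    _ = ‖L‖ := by rw [← Finset.mul_sum, hb, mul_one]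

lemma multiEval_update {T : Type*} [Fintype T] {n : ℕ} (g : (Fin n → T) → ℂ) (v : Fin n → T → ℂ)
    (j : Fin n) (y : T → ℂ) :
    multiEval g (Function.update v j y) =
      ∑ α, g α * (y (α j) * ∏ i ∈ univ.erase j, v i (α i)) := by
  classical
  refine Finset.sum_congr rfl fun α _ => ?_
  rw [← Finset.mul_prod_erase univ _ (mem_univ j), Function.update_self]
  congr 2
  refine Finset.prod_congr rfl fun i hi => ?_
  rw [Function.update_of_ne (Finset.ne_of_mem_erase hi)]

lemma norm_multiEval_le_of_mem_convexHull {T : Type*} [Fintype T] {n : ℕ}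
    (g : (Fin n → T) → ℂ) {S : Set (T → ℂ)} {M : ℝ}
    (hS : ∀ v : Fin n → T → ℂ, (∀ j, v j ∈ S) → ‖multiEval g v‖ ≤ M)
    (v : Fin n → T → ℂ) (hv : ∀ j, v j ∈ convexHull ℝ S) : ‖multiEval g v‖ ≤ M := by
  classical
  suffices H : ∀ s : Finset (Fin n), ∀ v : Fin n → T → ℂ, (∀ j ∈ s, v j ∈ convexHull ℝ S) →
      (∀ j ∉ s, v j ∈ S) → ‖multiEval g v‖ ≤ M from
    H univ v (fun j _ => hv j) (by simp)
  intro s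
  induction s using Finset.induction_on with
  | empty => exact fun v _ h => hS v fun j => h j (by simp)
  | insert a s ha ih =>
    intro v h1 h2
    have hsub : convexHull ℝ S ⊆ {y | ‖multiEval g (Function.update v a y)‖ ≤ M} := by
      refine convexHull_min (fun y hy => ih _ (fun j hj => ?_) fun j hj => ?_) ?_
      · rw [Function.update_of_ne (by rintro rfl; exact ha hj)]
        exact h1 j (Finset.mem_insert_of_mem hj)
      · by_cases hja : j = a
        · subst hja; simpa using hy
        · rw [Function.update_of_ne hja]
          exact h2 j (by simp [hja, hj])
      · intro y hy z hz p q hp hq hpq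
        simp only [Set.mem_ofPred_eq] at hy hz ⊢
        have : multiEval g (Function.update v a (p • y + q • z)) =
            p * multiEval g (Function.update v a y) + q * multiEval g (Function.update v a z) := by
          simp only [multiEval_update, Finset.mul_sum, ← Finset.sum_add_distrib, Pi.add_apply,
            Pi.smul_apply, Complex.real_smul]
          exact Finset.sum_congr rfl fun α _ => by ring
        rw [this]
        calc _ ≤ p * ‖multiEval g (Function.update v a y)‖ +
              q * ‖multiEval g (Function.update v a z)‖ := by
              refine (norm_add_le _ _).trans_eq ?_
              simp [abs_of_nonneg hp, abs_of_nonneg hq]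
          _ ≤ p * M + q * M := by gcongr
          _ = M := by rw [← add_mul, hpq, one_mul]
    have := hsub (h1 a (Finset.mem_insert_self _ _))
    simpa using this
lemma exists_norm_coeff_one_le (d : ℕ) : ∃ C : ℝ, 0 ≤ C ∧ ∀ p : Polynomial ℂ, p.natDegree ≤ d →
    ∀ M : ℝ, (∀ t : ℝ, 0 ≤ t → t ≤ 1 → ‖p.eval (t : ℂ)‖ ≤ M) → ‖p.coeff 1‖ ≤ C * M := by
  classical
  let node : ℕ → ℂ := fun i => ((i / (d + 1) : ℝ) : ℂ)
  have hinj : Set.InjOn node (range (d + 1)) := by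
    intro i _ j _ hij
    have hd : ((d : ℝ) + 1) ≠ 0 := by positivity
    have h := Complex.ofReal_injective hij
    field_simp at h
    exact_mod_cast h
  refine ⟨∑ i ∈ range (d + 1), ‖(Lagrange.basis (range (d + 1)) node i).coeff 1‖,
    Finset.sum_nonneg fun _ _ => norm_nonneg _, fun p hp M hM => ?_⟩
  have hdeg : p.degree < #(range (d + 1)) := by
    rw [card_range]
    exact (Polynomial.degree_le_of_natDegree_le hp).trans_lt (by exact_mod_cast Nat.lt_succ_self d)
  conv_lhs => rw [Lagrange.eq_interpolate hinj hdeg]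
  rw [Lagrange.interpolate_apply, Polynomial.finsetSum_coeff, Finset.sum_mul]
  refine norm_sum_le_of_le _ fun i hi => ?_
  rw [Polynomial.coeff_C_mul, norm_mul, mul_comm]
  gcongr
  refine hM _ (by positivity) ?_
  rw [div_le_one (by positivity)]
  exact_mod_cast (mem_range.mp hi).le

/-- The coefficient of `v j τ` in the multilinear form `multiEval g v`. -/
noncomputable def partialEval {T : Type*} [Fintype T] [DecidableEq T] {n : ℕ}
    (g : (Fin n → T) → ℂ) (j : Fin n) (τ : T) (v : Fin n → T → ℂ) : ℂ :=
  ∑ α, if α j = τ then g α * ∏ i ∈ univ.erase j, v i (α i) else 0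

/-- The derivative at `v` in a direction `y - v` of a form bounded by `M` on a convex set
is controlled by `M`. -/
lemma exists_norm_sum_partialEval_le (d : ℕ) : ∃ C : ℝ, 0 ≤ C ∧
    ∀ {T : Type} [Fintype T] [DecidableEq T] (o : T) {n : ℕ} (g : (Fin n → T) → ℂ),
      (∀ α, d < #{j | α j ≠ o} → g α = 0) →
      ∀ (S : Set (T → ℂ)), Convex ℝ S → (∀ v ∈ S, v o = 1) → ∀ M : ℝ,
        (∀ v : Fin n → T → ℂ, (∀ j, v j ∈ S) → ‖multiEval g v‖ ≤ M) →
        ∀ v y : Fin n → T → ℂ, (∀ j, v j ∈ S) → (∀ j, y j ∈ S) →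
          ‖∑ j, ∑ τ, (y j τ - v j τ) * partialEval g j τ v‖ ≤ C * M := by
  classical
  obtain ⟨C, hC, hcoeff⟩ := exists_norm_coeff_one_le d
  refine ⟨C, hC, ?_⟩
  intro T _ _ o n g hg S hS hSo M hM v y hv hy
  let P : Polynomial ℂ := ∑ α, Polynomial.C (g α) *
    ∏ j, (Polynomial.C (v j (α j)) + Polynomial.C (y j (α j) - v j (α j)) * Polynomial.X)
  have hdeg : P.natDegree ≤ d := by
    refine Polynomial.natDegree_sum_le_of_forall_le _ _ fun α _ => ?_
    by_cases hα : d < #{j | α j ≠ o}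
    · simp [hg α hα]
    · refine (Polynomial.natDegree_C_mul_le _ _).trans ?_
      refine (Polynomial.natDegree_prod_le _ _).trans ?_
      refine le_trans ?_ (not_lt.mp hα)
      rw [Finset.card_filter]
      refine Finset.sum_le_sum fun j _ => ?_
      split_ifs with h
      · rw [add_comm]; exact Polynomial.natDegree_linear_le
      · rw [not_not] at h
        simp [h, hSo _ (hv j), hSo _ (hy j)]
  have heval : ∀ t : ℝ, P.eval (t : ℂ) = multiEval g fun j => (1 - t) • v j + t • y j := by
    intro t
    simp only [P, multiEval, Polynomial.eval_finsetSum, Polynomial.eval_mul, Polynomial.eval_C,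
      Polynomial.eval_prod, Polynomial.eval_add, Polynomial.eval_X, Pi.add_apply, Pi.smul_apply,
      Complex.real_smul]
    refine Finset.sum_congr rfl fun α _ => ?_
    congr 1
    refine Finset.prod_congr rfl fun j _ => ?_
    push_cast
    ring
  have h1 : P.coeff 1 = ∑ j, ∑ τ, (y j τ - v j τ) * partialEval g j τ v := by
    have hd : P.coeff 1 = P.derivative.eval 0 := by
      rw [← Polynomial.coeff_zero_eq_eval_zero, Polynomial.coeff_derivative]
      simp
    rw [hd]
    simp only [P, Polynomial.derivative_sum, Polynomial.derivative_C_mul,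
      Polynomial.derivative_prod_finset, Polynomial.eval_finsetSum, Polynomial.eval_mul,
      Polynomial.eval_C, Polynomial.eval_prod, Polynomial.derivative_add,
      Polynomial.derivative_C, Polynomial.derivative_X, Polynomial.eval_add, Polynomial.eval_X,
      mul_zero, add_zero, zero_add, mul_one, Finset.mul_sum, partialEval]
    rw [Finset.sum_comm]
    refine Finset.sum_congr rfl fun j _ => ?_
    rw [Finset.sum_comm]
    refine Finset.sum_congr rfl fun α _ => ?_
    simp only [mul_ite, mul_zero, Finset.sum_ite_eq, mem_univ, if_true]
    ring
  rw [← h1]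
  refine hcoeff P hdeg M fun t ht0 ht1 => ?_
  rw [heval]
  exact hM _ fun j => hS (hv j) (hy j) (by linarith) ht0 (by ring)

lemma sum_fin_succ {T R : Type*} [Fintype T] [AddCommMonoid R] {n : ℕ}
    (f : (Fin (n + 1) → T) → R) : ∑ α, f α = ∑ τ, ∑ α : Fin n → T, f (Fin.cons τ α) := by
  rw [← Fintype.sum_prod_type' fun τ (α : Fin n → T) => f (Fin.cons τ α)]
  exact (Equiv.sum_comp (Fin.consEquiv fun _ => T) f).symm

lemma multiEval_cons {T X : Type*} [Fintype T] {n : ℕ} (ψ : X → T → ℂ)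
    (g : (Fin (n + 1) → T) → ℂ) (a : X) (x : Fin n → X) :
    multiEval g (fun j => ψ ((Fin.cons a x : Fin (n + 1) → X) j)) =
      ∑ τ, ψ a τ * multiEval (fun α => g (Fin.cons τ α)) fun j => ψ (x j) := by
  simp only [multiEval, sum_fin_succ, Fin.prod_univ_succ, Fin.cons_zero, Fin.cons_succ,
    Finset.mul_sum]
  exact Finset.sum_congr rfl fun τ _ => Finset.sum_congr rfl fun α _ => by ring

/-- Tensorization of a one-site lower bound for the second moment. -/
lemma sum_prod_mul_sq_le_of_site {T X : Type*} [Fintype T] [Fintype X] (ψ : X → T → ℂ) (q : ℝ)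
    (hq : 0 ≤ q) (w : T → ℝ) (hw : ∀ τ, 0 ≤ w τ)
    (h : ∀ z : T → ℂ, ∑ τ, w τ * ‖z τ‖ ^ 2 ≤ q * ∑ a, ‖∑ τ, ψ a τ * z τ‖ ^ 2) (n : ℕ)
    (g : (Fin n → T) → ℂ) :
    ∑ α, (∏ j, w (α j)) * ‖g α‖ ^ 2 ≤
      q ^ n * ∑ x : Fin n → X, ‖multiEval g fun j => ψ (x j)‖ ^ 2 := by
  induction n with
  | zero => simp [multiEval]
  | succ n ih =>
    simp only [sum_fin_succ (T := T), sum_fin_succ (T := X), multiEval_cons, Fin.prod_univ_succ,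
      Fin.cons_zero, Fin.cons_succ]
    calc _ = ∑ τ, w τ * ∑ α : Fin n → T, (∏ j, w (α j)) * ‖g (Fin.cons τ α)‖ ^ 2 := by
          simp only [Finset.mul_sum, mul_assoc]
      _ ≤ ∑ τ, w τ * (q ^ n * ∑ x : Fin n → X,
            ‖multiEval (fun α => g (Fin.cons τ α)) fun j => ψ (x j)‖ ^ 2) := by
          gcongr with τ _
          · exact hw τ
          · exact ih _
      _ = q ^ n * ∑ x : Fin n → X, ∑ τ, w τ *
            ‖multiEval (fun α => g (Fin.cons τ α)) fun j => ψ (x j)‖ ^ 2 := by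
          simp only [Finset.mul_sum]
          rw [Finset.sum_comm]
          exact Finset.sum_congr rfl fun _ _ => Finset.sum_congr rfl fun _ _ => by ring
      _ ≤ q ^ n * ∑ x : Fin n → X, q * ∑ a, ‖∑ τ, ψ a τ *
            multiEval (fun α => g (Fin.cons τ α)) fun j => ψ (x j)‖ ^ 2 := by
          gcongr with x _
          exact h _
      _ = _ := by
          rw [← Finset.mul_sum, Finset.sum_comm]
          ring

/-- Tensorization of a one-site hypercontractive bound for the fourth moment. -/
lemma sum_norm_pow_four_le_of_site {T X : Type*} [Fintype T] [Fintype X] (ψ : X → T → ℂ) (q : ℝ)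
    (hq : 0 ≤ q) (w : T → ℝ) (hw : ∀ τ, 0 ≤ w τ)
    (h : ∀ z : T → ℂ, q * ∑ a, ‖∑ τ, ψ a τ * z τ‖ ^ 4 ≤ (∑ τ, w τ * ‖z τ‖ ^ 2) ^ 2) (n : ℕ)
    (g : (Fin n → T) → ℂ) :
    q ^ n * ∑ x : Fin n → X, ‖multiEval g fun j => ψ (x j)‖ ^ 4 ≤
      (∑ α, (∏ j, w (α j)) * ‖g α‖ ^ 2) ^ 2 := by
  induction n with
  | zero => simp [multiEval, ← pow_mul]
  | succ n ih =>
    simp only [sum_fin_succ (T := T), sum_fin_succ (T := X), multiEval_cons, Fin.prod_univ_succ,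
      Fin.cons_zero, Fin.cons_succ]
    set G : T → (Fin n → X) → ℂ :=
      fun τ x => multiEval (fun α => g (Fin.cons τ α)) fun j => ψ (x j) with hG
    set N : T → ℝ := fun τ => ∑ α : Fin n → T, (∏ j, w (α j)) * ‖g (Fin.cons τ α)‖ ^ 2 with hN
    have hN0 : ∀ τ, 0 ≤ N τ := fun τ => Finset.sum_nonneg fun α _ =>
      mul_nonneg (Finset.prod_nonneg fun j _ => hw _) (by positivity)
    have ih' : ∀ τ, q ^ n * ∑ x, ‖G τ x‖ ^ 4 ≤ N τ ^ 2 := fun τ => ih _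
    have hpair : ∀ τ σ, q ^ n * ∑ x, ‖G τ x‖ ^ 2 * ‖G σ x‖ ^ 2 ≤ N τ * N σ := by
      intro τ σ
      refine le_of_sq_le_sq ?_ (mul_nonneg (hN0 τ) (hN0 σ))
      calc _ = (q ^ n) ^ 2 * (∑ x, ‖G τ x‖ ^ 2 * ‖G σ x‖ ^ 2) ^ 2 := by ring
        _ ≤ (q ^ n) ^ 2 * ((∑ x, (‖G τ x‖ ^ 2) ^ 2) * ∑ x, (‖G σ x‖ ^ 2) ^ 2) := by
            gcongr
            exact Finset.sum_mul_sq_le_sq_mul_sq _ _ _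
        _ = (q ^ n * ∑ x, ‖G τ x‖ ^ 4) * (q ^ n * ∑ x, ‖G σ x‖ ^ 4) := by
            simp only [← pow_mul]
            ring
        _ ≤ N τ ^ 2 * N σ ^ 2 := by
            gcongr
            · exact ih' τ
            · exact ih' σ
        _ = _ := by ring
    calc _ = q ^ n * ∑ x, q * ∑ a, ‖∑ τ, ψ a τ * G τ x‖ ^ 4 := by
          rw [← Finset.mul_sum, Finset.sum_comm]
          ring
      _ ≤ q ^ n * ∑ x, (∑ τ, w τ * ‖G τ x‖ ^ 2) ^ 2 := by
          gcongr with x _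
          exact h _
      _ = ∑ τ, ∑ σ, w τ * w σ * (q ^ n * ∑ x, ‖G τ x‖ ^ 2 * ‖G σ x‖ ^ 2) := by
          have hx : ∀ x, q ^ n * (∑ τ, w τ * ‖G τ x‖ ^ 2) ^ 2 =
              ∑ τ, ∑ σ, w τ * w σ * (q ^ n * (‖G τ x‖ ^ 2 * ‖G σ x‖ ^ 2)) := by
            intro x
            rw [sq (∑ τ, w τ * ‖G τ x‖ ^ 2), Finset.sum_mul_sum]
            simp only [Finset.mul_sum]
            exact Finset.sum_congr rfl fun τ _ => Finset.sum_congr rfl fun σ _ => by ring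
          rw [Finset.mul_sum]
          simp only [hx, Finset.mul_sum]
          rw [Finset.sum_comm]
          exact Finset.sum_congr rfl fun τ _ => Finset.sum_comm
      _ ≤ ∑ τ, ∑ σ, w τ * w σ * (N τ * N σ) := by
          exact Finset.sum_le_sum fun τ _ => Finset.sum_le_sum fun σ _ =>
            mul_le_mul_of_nonneg_left (hpair τ σ) (mul_nonneg (hw _) (hw _))
      _ = (∑ τ, w τ * N τ) ^ 2 := by
          rw [sq, Finset.sum_mul_sum]
          exact Finset.sum_congr rfl fun _ _ => Finset.sum_congr rfl fun _ _ => by ring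
      _ = _ := by simp only [hN, Finset.mul_sum, mul_assoc]

lemma second_moment_le_of_fourth_moment_le {Ω : Type*} [Fintype Ω] (q : ℝ) (hq : 0 ≤ q)
    (f : Ω → ℝ) (hf : ∀ x, 0 ≤ f x) (Λ : ℝ) (hΛ : 0 < Λ)
    (h : q * ∑ x, f x ^ 4 ≤ Λ * (q * ∑ x, f x ^ 2) ^ 2) :
    q * ∑ x, f x ^ 2 ≤ 8 * Λ * (q * ∑ x, f x) ^ 2 := by
  set m₂ := q * ∑ x, f x ^ 2 with hm₂
  set m₁ := q * ∑ x, f x with hm₁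
  have hm₂0 : 0 ≤ m₂ := mul_nonneg hq (Finset.sum_nonneg fun _ _ => by positivity)
  have hm₁0 : 0 ≤ m₁ := mul_nonneg hq (Finset.sum_nonneg fun x _ => hf x)
  rcases hm₂0.eq_or_lt with h0 | h0
  · rw [← h0]; positivity
  set l := √(2 * Λ * m₂) with hl
  have hl0 : 0 < l := Real.sqrt_pos.mpr (by positivity)
  have hl2 : l ^ 2 = 2 * Λ * m₂ := Real.sq_sqrt (by positivity)
  have hpt : ∀ t : ℝ, 0 ≤ t → t ^ 2 ≤ l * t + t ^ 4 / l ^ 2 := by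
    intro t ht
    rcases le_total t l with htl | htl
    · have : 0 ≤ t ^ 4 / l ^ 2 := by positivity
      nlinarith
    · have : t ^ 2 ≤ t ^ 4 / l ^ 2 := by
        rw [le_div_iff₀ (by positivity)]
        have : l ^ 2 ≤ t ^ 2 := by gcongr
        nlinarith [sq_nonneg t]
      nlinarith
  have h1 : m₂ ≤ l * m₁ + (q * ∑ x, f x ^ 4) / l ^ 2 := by
    calc m₂ ≤ q * ∑ x, (l * f x + f x ^ 4 / l ^ 2) := by
          rw [hm₂]; gcongr with x _; exact hpt _ (hf x)
      _ = _ := by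
          rw [Finset.sum_add_distrib, ← Finset.mul_sum, ← Finset.sum_div, hm₁]; ring
  have h2 : (q * ∑ x, f x ^ 4) / l ^ 2 ≤ m₂ / 2 := by
    rw [div_le_iff₀ (by positivity), hl2]
    linarith [h, sq m₂]
  have h3 : m₂ ≤ 2 * (l * m₁) := by linarith
  have h4 : m₂ ^ 2 ≤ (2 * (l * m₁)) ^ 2 := by gcongr
  have h5 : m₂ * m₂ ≤ (8 * Λ * m₁ ^ 2) * m₂ := by
    calc m₂ * m₂ = m₂ ^ 2 := (sq _).symm
      _ ≤ _ := h4
      _ = 4 * l ^ 2 * m₁ ^ 2 := by ring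
      _ = _ := by rw [hl2]; ring
  exact le_of_mul_le_mul_right h5 h0

/-- Any `2k/(k+1)`-th power is at most the sum of `k + 1` numbers with product `a ^ (2k)`. -/
lemma rpow_le_sum_add {ι : Type*} (s : Finset ι) (x : ι → ℝ) (y a : ℝ)
    (hx : ∀ j ∈ s, 0 ≤ x j) (hy : 0 ≤ y) (ha : 0 ≤ a)
    (h : a ^ (2 * #s) = (∏ j ∈ s, x j) * y) :
    a ^ ((2 * (#s : ℝ)) / ((#s : ℝ) + 1)) ≤ ∑ j ∈ s, x j + y := by
  by_contra! hlt
  have hs0 : 0 ≤ ∑ j ∈ s, x j := Finset.sum_nonneg hx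
  have h1 : ∏ j ∈ s, x j ≤ (∑ j ∈ s, x j + y) ^ #s := by
    rw [← Finset.prod_const]
    exact Finset.prod_le_prod hx fun j hj => (Finset.single_le_sum hx hj).trans (by linarith)
  have h2 : a ^ (2 * #s) < a ^ (2 * #s) :=
    calc a ^ (2 * #s) = (∏ j ∈ s, x j) * y := h
      _ ≤ (∑ j ∈ s, x j + y) ^ #s * (∑ j ∈ s, x j + y) := by gcongr; linarith
      _ = (∑ j ∈ s, x j + y) ^ (#s + 1) := (pow_succ _ _).symm
      _ < (a ^ ((2 * (#s : ℝ)) / ((#s : ℝ) + 1))) ^ (#s + 1) := by gcongr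
      _ = a ^ (2 * #s) := by
          rw [← Real.rpow_natCast, ← Real.rpow_mul ha]
          rw [← Real.rpow_natCast]
          congr 1
          push_cast
          field_simp
  exact lt_irrefl _ h2

/-- A Blei-type inequality: a coefficient array of locality `d` whose one-coordinate
`ℓ²`-influences are summable is in `ℓ^{2d/(d+1)}`. -/
lemma sum_rpow_le_of_influence_le_one {T : Type*} [Fintype T] [DecidableEq T] (o : T) {n d : ℕ}
    (hd : 1 ≤ d) (a : (Fin n → T) → ℝ) (ha : ∀ α, 0 ≤ a α)
    (hloc : ∀ α, d < #{j | α j ≠ o} → a α = 0) (h0 : a (fun _ => o) ≤ 1)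
    (hinf : ∑ j, ∑ τ ∈ univ.erase o, √(∑ α with α j = τ, a α ^ 2) ≤ 1) :
    ∑ α, a α ^ ((2 * (d : ℝ)) / ((d : ℝ) + 1)) ≤ 2 + Real.exp 1 := by
  set p : ℝ := (2 * (d : ℝ)) / ((d : ℝ) + 1) with hp
  have hp0 : 0 < p := by positivity
  set A : Fin n → T → ℝ := fun j τ => √(∑ α with α j = τ, a α ^ 2) with hA
  have hA0 : ∀ j τ, 0 ≤ A j τ := fun j τ => Real.sqrt_nonneg _
  have hAsq : ∀ j τ, A j τ ^ 2 = ∑ α with α j = τ, a α ^ 2 := fun j τ =>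
    Real.sq_sqrt (Finset.sum_nonneg fun _ _ => by positivity)
  have haA : ∀ α j, a α ≤ A j (α j) := fun α j => Real.le_sqrt_of_sq_le <|
    Finset.single_le_sum (f := fun β => a β ^ 2) (fun _ _ => by positivity) (by simp)
  have hA1 : ∀ j, ∀ τ ≠ o, A j τ ≤ 1 := fun j τ hτ => calc
    A j τ ≤ ∑ τ ∈ univ.erase o, A j τ :=
      Finset.single_le_sum (fun τ _ => hA0 j τ) (by simp [hτ])
    _ ≤ ∑ j, ∑ τ ∈ univ.erase o, A j τ :=
      Finset.single_le_sum (f := fun j => ∑ τ ∈ univ.erase o, A j τ)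
        (fun j _ => Finset.sum_nonneg fun τ _ => hA0 j τ) (mem_univ j)
    _ ≤ 1 := hinf
  have hpt : ∀ α, a α ^ p ≤ (if α = fun _ => o then 1 else 0) +
      ∑ j, (if α j = o then 0 else a α ^ 2 / A j (α j)) +
      ∏ j, (if α j = o then 1 else A j (α j)) := by
    intro α
    have hs0 : 0 ≤ ∑ j, (if α j = o then 0 else a α ^ 2 / A j (α j)) :=
      Finset.sum_nonneg fun j _ => by split_ifs <;> [rfl; exact div_nonneg (sq_nonneg _) (hA0 _ _)]
    have hp0' : 0 ≤ ∏ j, (if α j = o then 1 else A j (α j)) :=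
      Finset.prod_nonneg fun j _ => by split_ifs <;> [exact zero_le_one; exact hA0 _ _]
    by_cases hαo : α = fun _ => o
    · have : a α ^ p ≤ 1 := Real.rpow_le_one (ha _) (hαo ▸ h0) hp0.le
      rw [if_pos hαo]
      linarith
    rw [if_neg hαo, zero_add]
    rcases (ha α).eq_or_lt with hz | hpos
    · rw [← hz] at hs0 ⊢
      rw [Real.zero_rpow hp0.ne']
      linarith
    obtain ⟨i, hi⟩ : ∃ i, α i ≠ o := by
      by_contra! hcon
      exact hαo (funext hcon)
    set s : Finset (Fin n) := {j | α j ≠ o} with hs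
    have hsd : #s ≤ d := by
      by_contra! hlt
      exact hpos.ne' (hloc α hlt)
    have h1 : a α ^ p ≤ a α ^ ((2 * (#s : ℝ)) / ((#s : ℝ) + 1)) := by
      refine Real.rpow_le_rpow_of_exponent_ge hpos ((haA α i).trans (hA1 i _ hi)) ?_
      rw [hp, div_le_div_iff₀ (by positivity) (by positivity)]
      have : (#s : ℝ) ≤ d := by exact_mod_cast hsd
      nlinarith
    have hApos : ∀ j, 0 < A j (α j) := fun j => hpos.trans_le (haA α j)
    refine h1.trans ((rpow_le_sum_add s (fun j => a α ^ 2 / A j (α j)) (∏ j ∈ s, A j (α j)) (a α)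
      (fun j _ => div_nonneg (sq_nonneg _) (hA0 _ _)) (Finset.prod_nonneg fun j _ => hA0 _ _)
      hpos.le ?_).trans_eq ?_)
    · rw [← Finset.prod_mul_distrib, Finset.prod_congr rfl fun j _ =>
        div_mul_cancel₀ (a α ^ 2) (hApos j).ne', Finset.prod_const, pow_mul]
    · rw [hs, Finset.sum_filter, Finset.prod_filter]
      simp only [ite_not]
  have hsum : ∑ α, ∑ j, (if α j = o then 0 else a α ^ 2 / A j (α j)) ≤ 1 := by
    refine le_trans (le_of_eq ?_) hinf
    rw [Finset.sum_comm]
    refine Finset.sum_congr rfl fun j _ => ?_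
    rw [← Finset.sum_fiberwise (s := univ) (g := fun α : Fin n → T => α j),
      ← Finset.sum_erase univ (a := o)]
    · refine Finset.sum_congr rfl fun τ hτ => ?_
      calc _ = ∑ α with α j = τ, a α ^ 2 / A j τ := by
            refine Finset.sum_congr rfl fun α hα => ?_
            rw [(Finset.mem_filter.mp hα).2, if_neg (Finset.ne_of_mem_erase hτ)]
        _ = A j τ := by
            rw [← Finset.sum_div, ← hAsq, sq, mul_self_div_self]
    · refine Finset.sum_eq_zero fun α hα => ?_
      rw [if_pos (Finset.mem_filter.mp hα).2]
  have hprod : ∑ α : Fin n → T, ∏ j, (if α j = o then 1 else A j (α j)) ≤ Real.exp 1 := by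
    rw [← Fintype.prod_sum fun j τ => if τ = o then 1 else A j τ]
    calc _ = ∏ j, (∑ τ ∈ univ.erase o, A j τ + 1) := by
          refine Finset.prod_congr rfl fun j _ => ?_
          rw [← Finset.sum_erase_add _ _ (mem_univ o), if_pos rfl]
          congr 1
          exact Finset.sum_congr rfl fun τ hτ => if_neg (Finset.ne_of_mem_erase hτ)
      _ ≤ ∏ j, Real.exp (∑ τ ∈ univ.erase o, A j τ) :=
          Finset.prod_le_prod
            (fun j _ => add_nonneg (Finset.sum_nonneg fun τ _ => hA0 j τ) zero_le_one)
            fun j _ => Real.add_one_le_exp _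
      _ = Real.exp (∑ j, ∑ τ ∈ univ.erase o, A j τ) := (Real.exp_sum _ _).symm
      _ ≤ Real.exp 1 := Real.exp_le_exp.mpr hinf
  calc _ ≤ ∑ α, ((if α = fun _ => o then 1 else 0) +
        ∑ j, (if α j = o then 0 else a α ^ 2 / A j (α j)) +
        ∏ j, (if α j = o then 1 else A j (α j))) := Finset.sum_le_sum fun α _ => hpt α
    _ ≤ 1 + 1 + Real.exp 1 := by
        rw [Finset.sum_add_distrib, Finset.sum_add_distrib]
        gcongr
        simp
    _ = _ := by norm_num

lemma rpow_sum_le_of_influence_le {T : Type*} [Fintype T] [DecidableEq T] (o : T) {n d : ℕ}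
    (hd : 1 ≤ d) (a : (Fin n → T) → ℝ) (ha : ∀ α, 0 ≤ a α)
    (hloc : ∀ α, d < #{j | α j ≠ o} → a α = 0) {M : ℝ} (h0 : a (fun _ => o) ≤ M)
    (hinf : ∑ j, ∑ τ ∈ univ.erase o, √(∑ α with α j = τ, a α ^ 2) ≤ M) :
    (∑ α, a α ^ ((2 * (d : ℝ)) / ((d : ℝ) + 1))) ^ (((d : ℝ) + 1) / (2 * (d : ℝ))) ≤
      (2 + Real.exp 1) ^ (((d : ℝ) + 1) / (2 * (d : ℝ))) * M := by
  have he : 0 < 2 + Real.exp 1 := by positivity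
  have hd0 : (0 : ℝ) < d := by exact_mod_cast hd
  set q := ((d : ℝ) + 1) / (2 * (d : ℝ)) with hq
  set p := (2 * (d : ℝ)) / ((d : ℝ) + 1) with hp
  have hpq : p * q = 1 := by rw [hp, hq]; field_simp
  have hq0 : 0 < q := by positivity
  rw [mul_comm, ← div_le_iff₀ (by positivity)]
  refine le_of_forall_gt_imp_ge_of_dense fun N hN => ?_
  have hN0 : 0 < N := ((ha _).trans h0).trans_lt hN
  rw [div_le_iff₀ (by positivity), mul_comm]
  have key := sum_rpow_le_of_influence_le_one o hd (fun α => a α / N)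
    (fun α => div_nonneg (ha α) hN0.le) (fun α hα => by simp [hloc α hα])
    ((div_le_one hN0).mpr (h0.trans hN.le)) (by
      simp only [div_pow, ← Finset.sum_div, Real.sqrt_div' _ (sq_nonneg N), Real.sqrt_sq hN0.le]
      exact (div_le_one hN0).mpr (hinf.trans hN.le))
  simp only [Real.div_rpow (ha _) hN0.le, ← Finset.sum_div] at key
  rw [← hp, div_le_iff₀ (by positivity)] at key
  calc _ ≤ ((2 + Real.exp 1) * N ^ p) ^ q := by
        gcongr
        exact Finset.sum_nonneg fun α _ => Real.rpow_nonneg (ha α) _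
    _ = _ := by
        rw [Real.mul_rpow he.le (by positivity), ← Real.rpow_mul hN0.le, hpq, Real.rpow_one]

lemma norm_add_pow_four_le_s12 (z y : ℂ) :
    ‖z + y‖ ^ 4 ≤ ‖z‖ ^ 4 + 4 * ‖z‖ ^ 2 * (inner ℂ z y).re + 8 * ‖z‖ ^ 2 * ‖y‖ ^ 2 +
      3 * ‖y‖ ^ 4 := by
  have h : ‖z + y‖ ^ 4 = (‖z‖ ^ 2 + 2 * (inner ℂ z y).re + ‖y‖ ^ 2) ^ 2 := by
    rw [show ‖z + y‖ ^ 4 = (‖z + y‖ ^ 2) ^ 2 by ring, norm_add_sq (𝕜 := ℂ)]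
    rfl
  have hr : |(inner ℂ z y).re| ≤ ‖z‖ * ‖y‖ :=
    (Complex.abs_re_le_norm _).trans (norm_inner_le_norm _ _)
  rw [h]
  set r := (inner ℂ z y).re
  obtain ⟨h1, h2⟩ := abs_le.mp hr
  have hz := norm_nonneg z
  have hy := norm_nonneg y
  set a := ‖z‖
  set b := ‖y‖
  have h3 : r ^ 2 ≤ a ^ 2 * b ^ 2 := by nlinarith
  have h4 : r * b ^ 2 ≤ a * b * b ^ 2 := by gcongr
  nlinarith [sq_nonneg (a * b - b ^ 2)]

/-- One-site hypercontractivity for centred families of functions. -/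
lemma exists_site_fourth_moment_le {T X : Type*} [Fintype T] [DecidableEq T] [Fintype X]
    [Nonempty X] (o : T) (ψ : X → T → ℂ) (ho : ∀ a, ψ a o = 1)
    (hmean : ∀ τ ≠ o, ∑ a, ψ a τ = 0) :
    ∃ b : ℝ, 1 ≤ b ∧ ∀ z : T → ℂ,
      (Fintype.card X : ℝ)⁻¹ * ∑ a, ‖∑ τ, ψ a τ * z τ‖ ^ 4 ≤
        (∑ τ, (if τ = o then 1 else b) * ‖z τ‖ ^ 2) ^ 2 := by
  set D : ℝ := ∑ a, ∑ τ, ‖ψ a τ‖ ^ 2 with hD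
  have hDa : ∀ a, ∑ τ, ‖ψ a τ‖ ^ 2 ≤ D := fun a =>
    Finset.single_le_sum (f := fun a => ∑ τ, ‖ψ a τ‖ ^ 2)
      (fun _ _ => Finset.sum_nonneg fun _ _ => by positivity) (mem_univ a)
  have hD1 : 1 ≤ D := by
    obtain ⟨a⟩ := ‹Nonempty X›
    refine le_trans ?_ (hDa a)
    refine le_trans ?_ (Finset.single_le_sum (f := fun τ => ‖ψ a τ‖ ^ 2)
      (fun _ _ => by positivity) (mem_univ o))
    simp [ho]
  clear_value D
  refine ⟨4 * D, by linarith, fun z => ?_⟩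
  have hX : (Fintype.card X : ℝ) ≠ 0 := by simp
  set s : ℝ := ∑ τ ∈ univ.erase o, ‖z τ‖ ^ 2 with hs
  have hs0 : 0 ≤ s := Finset.sum_nonneg fun _ _ => by positivity
  let y : X → ℂ := fun a => ∑ τ ∈ univ.erase o, ψ a τ * z τ
  have hy : ∑ a, y a = 0 := by
    simp only [y]
    rw [Finset.sum_comm]
    refine Finset.sum_eq_zero fun τ hτ => ?_
    rw [← Finset.sum_mul, hmean τ (Finset.ne_of_mem_erase hτ), zero_mul]
  have hysq : ∀ a, ‖y a‖ ^ 2 ≤ D * s := by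
    intro a
    calc ‖y a‖ ^ 2 ≤ (∑ τ ∈ univ.erase o, ‖ψ a τ‖ * ‖z τ‖) ^ 2 := by
          gcongr
          exact norm_sum_le_of_le _ fun τ _ => norm_mul_le _ _
      _ ≤ (∑ τ ∈ univ.erase o, ‖ψ a τ‖ ^ 2) * s := Finset.sum_mul_sq_le_sq_mul_sq _ _ _
      _ ≤ D * s := by
          gcongr
          exact (Finset.sum_le_univ_sum_of_nonneg fun τ => by positivity).trans (hDa a)
  have hsplit : ∀ a, ∑ τ, ψ a τ * z τ = z o + y a := by
    intro a
    rw [← Finset.add_sum_erase _ _ (mem_univ o), ho, one_mul]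
  have hw : ∑ τ, (if τ = o then 1 else 4 * D) * ‖z τ‖ ^ 2 = ‖z o‖ ^ 2 + 4 * D * s := by
    rw [← Finset.add_sum_erase _ _ (mem_univ o), if_pos rfl, one_mul, hs, Finset.mul_sum]
    congr 1
    refine Finset.sum_congr rfl fun τ hτ => ?_
    rw [if_neg (Finset.ne_of_mem_erase hτ)]
  rw [hw]
  have hinner : ∑ a, (inner ℂ (z o) (y a)).re = 0 := by
    rw [← Complex.re_sum, ← inner_sum, hy, inner_zero_right, Complex.zero_re]
  calc _ ≤ (Fintype.card X : ℝ)⁻¹ * ∑ a, (‖z o‖ ^ 4 + 4 * ‖z o‖ ^ 2 * (inner ℂ (z o) (y a)).re +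
        8 * ‖z o‖ ^ 2 * (D * s) + 3 * (D * s) ^ 2) := by
        gcongr with a _
        rw [hsplit]
        refine (norm_add_pow_four_le_s12 _ _).trans ?_
        have h2 := hysq a
        have h4 : ‖y a‖ ^ 4 ≤ (D * s) ^ 2 := by
          rw [show ‖y a‖ ^ 4 = (‖y a‖ ^ 2) ^ 2 by ring]
          gcongr
        gcongr
    _ = ‖z o‖ ^ 4 + 8 * ‖z o‖ ^ 2 * (D * s) + 3 * (D * s) ^ 2 := by
        simp only [Finset.sum_add_distrib, ← Finset.mul_sum, hinner, Finset.sum_const, card_univ,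
          nsmul_eq_mul]
        field_simp
        ring
    _ ≤ _ := by nlinarith [sq_nonneg (D * s)]

lemma prod_ite_eq_pow_card {T : Type*} [DecidableEq T] (o : T) {n : ℕ} (α : Fin n → T) (b : ℝ) :
    ∏ j, (if α j = o then 1 else b) = b ^ #{j | α j ≠ o} := by
  rw [← Finset.prod_const, Finset.prod_filter]
  exact Finset.prod_congr rfl fun j _ => by by_cases h : α j = o <;> simp [h]

/-- Forms of bounded locality have comparable `L¹` norm and `ℓ²` norm of coefficients. -/
lemma exists_sqrt_sum_sq_le {T X : Type*} [Fintype T] [DecidableEq T] [Fintype X]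
    [Nonempty X] (o : T) (ψ : X → T → ℂ) (ho : ∀ a, ψ a o = 1)
    (hmean : ∀ τ ≠ o, ∑ a, ψ a τ = 0) (c : ℝ) (hc : 0 < c) (hc1 : c ≤ 1)
    (hlow : ∀ z : T → ℂ, ∑ τ, (if τ = o then 1 else c) * ‖z τ‖ ^ 2 ≤
      (Fintype.card X : ℝ)⁻¹ * ∑ a, ‖∑ τ, ψ a τ * z τ‖ ^ 2) (d : ℕ) :
    ∃ C : ℝ, 0 ≤ C ∧ ∀ (n : ℕ) (g : (Fin n → T) → ℂ), (∀ α, d < #{j | α j ≠ o} → g α = 0) →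
      √(∑ α, ‖g α‖ ^ 2) ≤ C * ((Fintype.card X : ℝ)⁻¹ ^ n *
        ∑ x : Fin n → X, ‖multiEval g fun j => ψ (x j)‖) := by
  obtain ⟨b, hb, hfour⟩ := exists_site_fourth_moment_le o ψ ho hmean
  set q := (Fintype.card X : ℝ)⁻¹ with hq
  have hq0 : 0 ≤ q := by positivity
  set Λ : ℝ := (b ^ d / c ^ d) ^ 2 with hΛ
  have hΛ0 : 0 < Λ := by positivity
  refine ⟨√(8 * Λ / c ^ d), Real.sqrt_nonneg _, fun n g hg => ?_⟩
  have h2 : c ^ d * ∑ α, ‖g α‖ ^ 2 ≤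
      q ^ n * ∑ x : Fin n → X, ‖multiEval g fun j => ψ (x j)‖ ^ 2 := by
    refine le_trans ?_ (sum_prod_mul_sq_le_of_site ψ q hq0 _ (fun τ => ?_) hlow n g)
    · rw [Finset.mul_sum]
      refine Finset.sum_le_sum fun α _ => ?_
      rw [prod_ite_eq_pow_card]
      by_cases h : d < #{j | α j ≠ o}
      · simp [hg α h]
      · exact mul_le_mul_of_nonneg_right (pow_le_pow_of_le_one hc.le hc1 (not_lt.mp h))
          (by positivity)
    · split_ifs <;> positivity
  have h4 : q ^ n * ∑ x : Fin n → X, ‖multiEval g fun j => ψ (x j)‖ ^ 4 ≤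
      (b ^ d * ∑ α, ‖g α‖ ^ 2) ^ 2 := by
    refine (sum_norm_pow_four_le_of_site ψ q hq0 _ (fun τ => ?_) hfour n g).trans ?_
    · split_ifs <;> positivity
    · refine pow_le_pow_left₀ (Finset.sum_nonneg fun α _ => ?_) ?_ 2
      · rw [prod_ite_eq_pow_card]
        positivity
      rw [Finset.mul_sum]
      refine Finset.sum_le_sum fun α _ => ?_
      rw [prod_ite_eq_pow_card]
      by_cases h : d < #{j | α j ≠ o}
      · simp [hg α h]
      · exact mul_le_mul_of_nonneg_right (pow_le_pow_right₀ hb (not_lt.mp h)) (by positivity)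
  have h42 : q ^ n * ∑ x : Fin n → X, ‖multiEval g fun j => ψ (x j)‖ ^ 4 ≤
      Λ * (q ^ n * ∑ x : Fin n → X, ‖multiEval g fun j => ψ (x j)‖ ^ 2) ^ 2 := by
    refine h4.trans ?_
    rw [hΛ, ← mul_pow]
    refine pow_le_pow_left₀ (by positivity) ?_ 2
    rw [div_mul_eq_mul_div, le_div_iff₀ (by positivity)]
    calc _ = b ^ d * (c ^ d * ∑ α, ‖g α‖ ^ 2) := by ring
      _ ≤ _ := by gcongr
  have h1 := h2.trans (second_moment_le_of_fourth_moment_le (q ^ n) (by positivity) _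
    (fun x => norm_nonneg _) Λ hΛ0 h42)
  have hm : 0 ≤ q ^ n * ∑ x : Fin n → X, ‖multiEval g fun j => ψ (x j)‖ := by positivity
  rw [← Real.sqrt_sq hm, ← Real.sqrt_mul (by positivity)]
  refine Real.sqrt_le_sqrt ?_
  rw [div_mul_eq_mul_div, le_div_iff₀ (by positivity), mul_comm]
  exact h1

/-- The cube roots of unity and the corresponding Parseval identity. -/
lemma exists_cube_roots : ∃ u : Fin 3 → ℂ, (∀ s, ‖u s‖ = 1) ∧ ∑ s, u s = 0 ∧
    ∑ s, star (u s) = 0 ∧ ∑ s, star (u s) ^ 2 = 0 ∧ ∀ A B C : ℂ,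
      ∑ s, ‖A + u s * B + star (u s) * C‖ ^ 2 = 3 * (‖A‖ ^ 2 + ‖B‖ ^ 2 + ‖C‖ ^ 2) := by
  obtain ⟨ζ, hζ, hstar⟩ : ∃ ζ : ℂ, 1 + ζ + ζ ^ 2 = 0 ∧ star ζ = ζ ^ 2 := by
    have h3 : ((√3 : ℝ) : ℂ) ^ 2 = 3 := by
      rw [← Complex.ofReal_pow, Real.sq_sqrt (by norm_num)]
      norm_num
    have hI := Complex.I_sq
    refine ⟨-1 / 2 + (√3 : ℝ) / 2 * Complex.I, ?_, ?_⟩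
    · linear_combination (1 / 4 : ℂ) * h3 * Complex.I ^ 2 + (3 / 4 : ℂ) * hI
    · simp only [RCLike.star_def, map_add, map_mul, map_div₀, map_neg, map_one, map_ofNat,
        Complex.conj_I, Complex.conj_ofReal]
      linear_combination -(1 / 4 : ℂ) * h3 * Complex.I ^ 2 - (3 / 4 : ℂ) * hI
  have hcube : ζ ^ 3 = 1 := by linear_combination (ζ - 1) * hζ
  have hstar2 : star (ζ ^ 2) = ζ := by
    rw [star_pow, hstar]
    linear_combination ζ * hcube
  have hnorm : ‖ζ‖ = 1 := by
    have h : ‖ζ‖ ^ 3 = 1 := by rw [← norm_pow, hcube, norm_one]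
    exact (pow_eq_one_iff_of_nonneg (norm_nonneg _) (by norm_num)).mp h
  refine ⟨![1, ζ, ζ ^ 2], fun s => ?_, ?_, ?_, ?_, fun A B C => ?_⟩
  · fin_cases s <;> simp [hnorm]
  · simpa [Fin.sum_univ_three] using hζ
  · simp only [Fin.sum_univ_three, Matrix.cons_val, star_one, hstar, hstar2]
    linear_combination hζ
  · simp only [Fin.sum_univ_three, Matrix.cons_val, star_one, hstar, hstar2]
    linear_combination hζ + ζ * hcube
  · have hsq : ∀ x : ℂ, ((‖x‖ ^ 2 : ℝ) : ℂ) = x * star x := fun x => by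
      rw [RCLike.star_def, Complex.mul_conj, Complex.normSq_eq_norm_sq]
    rw [← Complex.ofReal_inj]
    push_cast
    simp only [← Complex.ofReal_pow, hsq, Fin.sum_univ_three, Matrix.cons_val, star_one, star_add,
      star_mul', hstar, hstar2]
    generalize star A = a
    generalize star B = b
    generalize star C = c
    grind

lemma multiEval_ite {T : Type*} [Fintype T] [DecidableEq T] {n : ℕ} (g : (Fin n → T) → ℂ)
    (j : Fin n) (τ : T) (v : Fin n → T → ℂ) :
    multiEval (fun α => if α j = τ then g α else 0) v = v j τ * partialEval g j τ v := by
  simp only [multiEval, partialEval, Finset.mul_sum]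
  refine Finset.sum_congr rfl fun α _ => ?_
  split_ifs with h
  · rw [← Finset.mul_prod_erase univ _ (mem_univ j), h]
    ring
  · simp

/-- Values on the basis elements `σ` of the state obtained by perturbing the centre in the
direction `τ` with phase `w`. -/
noncomputable def perturbedState {T : Type*} [DecidableEq T] (o : T) (m : T → T → ℂ) (τ : T)
    (w : ℂ) (σ : T) : ℂ :=
  (if σ = o then 1 else 0) + w * (if σ = τ ∧ τ ≠ o then 1 / 2 else 0) + star w * m σ τ

lemma exists_sum_norm_partialEval_le (d : ℕ) : ∃ C : ℝ, 0 ≤ C ∧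
    ∀ {T : Type} [Fintype T] [DecidableEq T] (o : T) (m : T → T → ℂ) {n : ℕ}
      (g : (Fin n → T) → ℂ), (∀ α, d < #{j | α j ≠ o} → g α = 0) →
      ∀ (S : Set (T → ℂ)), Convex ℝ S → (∀ v ∈ S, v o = 1) →
        (∀ τ w, ‖w‖ = 1 → perturbedState o m τ w ∈ S) → ∀ M : ℝ,
        (∀ v : Fin n → T → ℂ, (∀ j, v j ∈ S) → ‖multiEval g v‖ ≤ M) →
        ∀ v : Fin n → T → ℂ, (∀ j, v j ∈ S) → ∀ τ ≠ o,
          ∑ j, ‖partialEval g j τ v‖ ≤ C * M := by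
  obtain ⟨C, hC, hder⟩ := exists_norm_sum_partialEval_le d
  obtain ⟨u, hu1, hu, hus, hus2, -⟩ := exists_cube_roots
  refine ⟨2 * C, by positivity, ?_⟩
  intro T _ _ o m n g hg S hS hSo hSV M hM v hv τ hτ
  have hphase : ∀ z : ℂ, ∃ w : ℂ, ‖w‖ = 1 ∧ w * z = ‖z‖ := fun z => by
    by_cases hz : z = 0
    · exact ⟨1, by simp [hz]⟩
    · have hz' : (‖z‖ : ℂ) ≠ 0 := by simpa using hz
      refine ⟨star z / ‖z‖, by simp [hz], ?_⟩
      rw [div_mul_eq_mul_div, div_eq_iff hz', RCLike.star_def, Complex.conj_mul']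
      ring
  choose w hw1 hw using fun j => hphase (partialEval g j τ v)
  let L : Fin 3 → ℂ := fun s =>
    ∑ j, ∑ σ, (perturbedState o m τ (u s * w j) σ - v j σ) * partialEval g j σ v
  have hL : ∀ s, ‖L s‖ ≤ C * M := fun s => hder o g hg S hS hSo M hM v _ hv fun j =>
    hSV _ _ (by rw [norm_mul, hu1, hw1, one_mul])
  have huu : ∀ s, star (u s) * u s = 1 := fun s => by
    rw [RCLike.star_def, Complex.conj_mul', hu1]; norm_num
  have hext : ∀ j σ, ∑ s, star (u s) * (perturbedState o m τ (u s * w j) σ - v j σ) =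
      3 * (w j * (if σ = τ then 1 / 2 else 0)) := by
    intro j σ
    have : ∀ s, star (u s) * (perturbedState o m τ (u s * w j) σ - v j σ) =
        star (u s) * ((if σ = o then 1 else 0) - v j σ) + w j * (if σ = τ then 1 / 2 else 0) +
          star (u s) ^ 2 * (star (w j) * m σ τ) := by
      intro s
      simp only [perturbedState, star_mul', hτ, ne_eq, not_false_eq_true, and_true]
      linear_combination (w j * (if σ = τ then 1 / 2 else 0)) * huu s
    simp only [this, Finset.sum_add_distrib, ← Finset.sum_mul, hus, hus2]
    rw [zero_mul, zero_mul, zero_add, add_zero, Finset.sum_const, card_univ, Fintype.card_fin,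
      nsmul_eq_mul]
    push_cast
    ring
  have hsum : ∑ s, star (u s) * L s = 3 / 2 * ∑ j, (‖partialEval g j τ v‖ : ℂ) := by
    simp only [L, Finset.mul_sum]
    rw [Finset.sum_comm]
    refine Finset.sum_congr rfl fun j _ => ?_
    rw [Finset.sum_comm]
    simp only [← mul_assoc, ← Finset.sum_mul, hext]
    rw [Finset.sum_eq_single τ (fun σ _ hσ => by simp [hσ]) (by simp), if_pos rfl]
    linear_combination (3 / 2 : ℂ) * hw j
  have hn : ‖∑ s, star (u s) * L s‖ ≤ 3 * (C * M) := by
    calc _ ≤ ∑ s : Fin 3, C * M := norm_sum_le_of_le _ fun s _ => by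
          rw [norm_mul, norm_star, hu1, one_mul]; exact hL s
      _ = _ := by simp
  rw [hsum, norm_mul, ← Complex.ofReal_sum, Complex.norm_real, Real.norm_of_nonneg
    (Finset.sum_nonneg fun j _ => norm_nonneg _)] at hn
  norm_num at hn
  linarith

/-- A Bohnenblust–Hille inequality for multilinear forms of locality `d` bounded on products
of states. -/
lemma exists_bohnenblust_hille {T : Type} [Fintype T] [DecidableEq T] (o : T) (m : T → T → ℂ)
    {d : ℕ} (hd : 1 ≤ d) (S : Set (T → ℂ)) (hS : Convex ℝ S) (hSo : ∀ v ∈ S, v o = 1)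
    (hSV : ∀ τ w, ‖w‖ = 1 → perturbedState o m τ w ∈ S) :
    ∃ C : ℝ, 0 ≤ C ∧ ∀ (n : ℕ) (g : (Fin n → T) → ℂ),
      (∀ α, d < #{j | α j ≠ o} → g α = 0) → ∀ M : ℝ,
        (∀ v : Fin n → T → ℂ, (∀ j, v j ∈ S) → ‖multiEval g v‖ ≤ M) →
        (∑ α, ‖g α‖ ^ ((2 * (d : ℝ)) / ((d : ℝ) + 1))) ^ (((d : ℝ) + 1) / (2 * (d : ℝ))) ≤
          C * M := by
  obtain ⟨C₂, hC₂, hinf⟩ := exists_sum_norm_partialEval_le d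
  obtain ⟨u, hu1, hu, hus, -, hpars⟩ := exists_cube_roots
  let ψ : T × Fin 3 → T → ℂ := fun a => perturbedState o m a.1 (u a.2)
  have hψS : ∀ a, ψ a ∈ S := fun a => hSV _ _ (hu1 _)
  have : Nonempty (T × Fin 3) := ⟨(o, 0)⟩
  have : Nonempty T := ⟨o⟩
  have hmean : ∀ τ ≠ o, ∑ a, ψ a τ = 0 := by
    intro τ hτ
    rw [Fintype.sum_prod_type]
    refine Finset.sum_eq_zero fun σ _ => ?_
    simp only [ψ, perturbedState, Finset.sum_add_distrib, ← Finset.sum_mul, hus]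
    simp only [hτ, if_false, Finset.sum_const_zero, zero_mul, zero_add, add_zero]
    by_cases h : τ = σ ∧ σ ≠ o
    · simp only [if_pos h]
      rw [← Finset.sum_mul, hu, zero_mul]
    · simp only [if_neg h, mul_zero, Finset.sum_const_zero]
  have hcard : (1 : ℝ) ≤ Fintype.card T := by exact_mod_cast Fintype.card_pos
  set c : ℝ := 1 / (4 * Fintype.card T) with hc
  have hlow : ∀ z : T → ℂ, ∑ τ, (if τ = o then 1 else c) * ‖z τ‖ ^ 2 ≤
      (Fintype.card (T × Fin 3) : ℝ)⁻¹ * ∑ a, ‖∑ τ, ψ a τ * z τ‖ ^ 2 := by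
    intro z
    have h1 : ∀ τ, ∑ s, ‖∑ σ, ψ (τ, s) σ * z σ‖ ^ 2 ≥
        3 * (‖z o‖ ^ 2 + (if τ = o then 0 else 1 / 4 * ‖z τ‖ ^ 2)) := by
      intro τ
      have h2 : ∀ s, ∑ σ, ψ (τ, s) σ * z σ =
          z o + u s * (if τ = o then 0 else z τ / 2) + star (u s) * ∑ σ, m σ τ * z σ := by
        intro s
        simp only [ψ, perturbedState, add_mul, Finset.sum_add_distrib, mul_assoc,
          ← Finset.mul_sum]
        congr 2
        · simp
        · by_cases h : τ = o
          · simp [h]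
          · simp [h, div_eq_inv_mul]
      simp only [h2, hpars]
      have h3 : ‖(if τ = o then 0 else z τ / 2 : ℂ)‖ ^ 2 =
          (if τ = o then 0 else 1 / 4 * ‖z τ‖ ^ 2) := by
        split_ifs
        · simp
        · rw [norm_div, div_pow]; norm_num; ring
      rw [h3]
      have : 0 ≤ ‖∑ σ, m σ τ * z σ‖ ^ 2 := by positivity
      linarith
    rw [Fintype.sum_prod_type, Fintype.card_prod, Fintype.card_fin, inv_mul_eq_div,
      le_div_iff₀ (by positivity)]
    refine le_trans (le_of_eq ?_) (Finset.sum_le_sum fun τ _ => h1 τ)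
    rw [← Finset.mul_sum, Finset.sum_add_distrib, Finset.sum_const, card_univ, nsmul_eq_mul,
      ← Finset.add_sum_erase _ _ (mem_univ o), if_pos rfl,
      ← Finset.add_sum_erase (a := o) _ (fun τ => if τ = o then 0 else 1 / 4 * ‖z τ‖ ^ 2)
        (mem_univ o), if_pos rfl, zero_add]
    have e1 : ∑ τ ∈ univ.erase o, (if τ = o then 1 else c) * ‖z τ‖ ^ 2 =
        c * ∑ τ ∈ univ.erase o, ‖z τ‖ ^ 2 := by
      rw [Finset.mul_sum]
      refine Finset.sum_congr rfl fun τ hτ => ?_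
      rw [if_neg (Finset.ne_of_mem_erase hτ)]
    have e2 : ∑ τ ∈ univ.erase o, (if τ = o then 0 else 1 / 4 * ‖z τ‖ ^ 2) =
        1 / 4 * ∑ τ ∈ univ.erase o, ‖z τ‖ ^ 2 := by
      rw [Finset.mul_sum]
      refine Finset.sum_congr rfl fun τ hτ => ?_
      rw [if_neg (Finset.ne_of_mem_erase hτ)]
    rw [e1, e2, hc]
    push_cast
    field_simp
  obtain ⟨C₁, hC₁, hL⟩ := exists_sqrt_sum_sq_le o ψ (fun a => hSo _ (hψS a)) hmean c
    (by positivity) (by rw [hc, div_le_one (by positivity)]; linarith) hlow d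
  set q : ℝ := (Fintype.card (T × Fin 3) : ℝ)⁻¹ with hq
  have hq0 : 0 < q := by positivity
  set Ψ : ℝ := ∑ a, ∑ τ, ‖ψ a τ‖ with hΨ
  have hΨ0 : 0 ≤ Ψ := Finset.sum_nonneg fun _ _ => Finset.sum_nonneg fun _ _ => norm_nonneg _
  have hψΨ : ∀ a τ, ‖ψ a τ‖ ≤ Ψ := fun a τ =>
    (Finset.single_le_sum (f := fun τ => ‖ψ a τ‖) (fun _ _ => norm_nonneg _) (mem_univ τ)).trans
      (Finset.single_le_sum (f := fun a => ∑ τ, ‖ψ a τ‖)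
        (fun _ _ => Finset.sum_nonneg fun _ _ => norm_nonneg _) (mem_univ a))
  set C₃ : ℝ := Fintype.card T * (C₁ * (Ψ * C₂)) + 1 with hC₃
  refine ⟨(2 + Real.exp 1) ^ (((d : ℝ) + 1) / (2 * (d : ℝ))) * C₃, by positivity, ?_⟩
  intro n g hg M hM
  have hM0 : 0 ≤ M := (norm_nonneg _).trans (hM (fun _ => ψ (o, 0)) fun _ => hψS _)
  rw [mul_assoc]
  refine rpow_sum_le_of_influence_le o hd (fun α => ‖g α‖) (fun α => norm_nonneg _)
    (fun α hα => by simp [hg α hα]) ?_ ?_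
  · have hcentre : (fun σ => if σ = o then 1 else 0 : T → ℂ) ∈ S := by
      have h := hS (hSV o 1 norm_one) (hSV o (-1) (by simp)) (a := 1 / 2) (b := 1 / 2)
        (by norm_num) (by norm_num) (by norm_num)
      convert h using 1
      ext σ
      simp only [perturbedState, Pi.add_apply, Pi.smul_apply, Complex.real_smul]
      push_cast
      simp only [star_neg, star_one]
      ring
    have h := hM (fun _ σ => if σ = o then 1 else 0) fun _ => hcentre
    have h2 : multiEval g (fun _ σ => if σ = o then 1 else 0) = g fun _ => o := by
      rw [multiEval, Finset.sum_eq_single fun _ => o]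
      · simp
      · intro α _ hα
        obtain ⟨i, hi⟩ := Function.ne_iff.mp hα
        rw [Finset.prod_eq_zero (mem_univ i) (if_neg hi), mul_zero]
      · simp
    rw [h2] at h
    refine h.trans (le_mul_of_one_le_left hM0 ?_)
    rw [hC₃]
    have : 0 ≤ Fintype.card T * (C₁ * (Ψ * C₂)) := by positivity
    linarith
  · have hτ : ∀ τ ∈ univ.erase o, ∑ j, √(∑ α with α j = τ, ‖g α‖ ^ 2) ≤
        C₁ * (Ψ * C₂) * M := by
      intro τ hτ
      have h1 : ∀ j, √(∑ α with α j = τ, ‖g α‖ ^ 2) ≤ C₁ * (q ^ n *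
          ∑ x : Fin n → T × Fin 3, Ψ * ‖partialEval g j τ fun j => ψ (x j)‖) := by
        intro j
        have h := hL n (fun α => if α j = τ then g α else 0) fun α hα => by simp [hg α hα]
        simp only [multiEval_ite, norm_mul] at h
        refine le_trans (le_of_eq ?_) (h.trans ?_)
        · rw [Finset.sum_filter]
          congr 1
          refine Finset.sum_congr rfl fun α _ => ?_
          split_ifs <;> simp
        · gcongr
          exact hψΨ _ _
      calc _ ≤ ∑ j, C₁ * (q ^ n *
            ∑ x : Fin n → T × Fin 3, Ψ * ‖partialEval g j τ fun j => ψ (x j)‖) :=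
            Finset.sum_le_sum fun j _ => h1 j
        _ = C₁ * (q ^ n * ∑ x : Fin n → T × Fin 3,
            Ψ * ∑ j, ‖partialEval g j τ fun j => ψ (x j)‖) := by
            simp only [Finset.mul_sum]
            exact Finset.sum_comm
        _ ≤ C₁ * (q ^ n * ∑ x : Fin n → T × Fin 3, Ψ * (C₂ * M)) := by
            gcongr with x _
            exact hinf o m g hg S hS hSo hSV M hM _ (fun j => hψS _) τ
              (Finset.ne_of_mem_erase hτ)
        _ = _ := by
            have : q ^ n * (Fintype.card (T × Fin 3) : ℝ) ^ n = 1 := by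
              rw [hq, inv_pow, inv_mul_cancel₀ (by positivity)]
            rw [Finset.sum_const, card_univ, Fintype.card_fun, Fintype.card_fin, nsmul_eq_mul,
              Nat.cast_pow]
            linear_combination (C₁ * (Ψ * C₂) * M) * this
    rw [Finset.sum_comm]
    calc _ ≤ ∑ τ ∈ univ.erase o, C₁ * (Ψ * C₂) * M := Finset.sum_le_sum hτ
      _ ≤ ∑ τ : T, C₁ * (Ψ * C₂) * M :=
          Finset.sum_le_univ_sum_of_nonneg fun τ => by positivity
      _ = Fintype.card T * (C₁ * (Ψ * C₂)) * M := by
          rw [Finset.sum_const, card_univ, nsmul_eq_mul]; ring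
      _ ≤ _ := by gcongr; rw [hC₃]; linarith

lemma sum_norm_sq_eq_one_iff {κ : Type*} [Fintype κ] (B : Matrix κ κ ℂ) :
    ∑ r, ∑ x, ‖B x r‖ ^ 2 = 1 ↔ Matrix.trace (B * B.conjTranspose) = 1 := by
  have : Matrix.trace (B * B.conjTranspose) = ((∑ r, ∑ x, ‖B x r‖ ^ 2 : ℝ) : ℂ) := by
    simp only [Matrix.trace, Matrix.diag, Matrix.mul_apply, Matrix.conjTranspose_apply]
    rw [Finset.sum_comm]
    push_cast
    simp only [RCLike.star_def, Complex.mul_conj']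
  rw [this, Complex.ofReal_eq_one]

lemma apply_eq_one_of_mem_convexHull_stateValues {T κ : Type*} [Fintype κ] [DecidableEq κ]
    {W : T → Matrix κ κ ℂ} {o : T} (hWo : W o = 1) {v : T → ℂ}
    (hv : v ∈ convexHull ℝ (stateValues W)) : v o = 1 := by
  have hsub : convexHull ℝ (stateValues W) ⊆ {v | v o = 1} := by
    refine convexHull_min ?_ ?_
    · rintro v ⟨B, hB, rfl⟩
      simpa [hWo] using (sum_norm_sq_eq_one_iff B).mp hB
    · intro x hx y hy a b _ _ hab
      simp only [Set.mem_ofPred_eq] at hx hy ⊢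
      simp only [Pi.add_apply, Pi.smul_apply, hx, hy, Complex.real_smul, mul_one]
      exact_mod_cast hab
  exact hsub hv

lemma perturbedState_mem_stateValues {T κ : Type*} [DecidableEq T] [Fintype κ] [DecidableEq κ]
    [Nonempty κ] {W : T → Matrix κ κ ℂ} {o : T} (hWo : W o = 1)
    (hU : ∀ τ, (W τ).conjTranspose * W τ = 1)
    (horth : ∀ σ τ, Matrix.trace (W σ * (W τ).conjTranspose) =
      if σ = τ then (Fintype.card κ : ℂ) else 0) (τ : T) {w : ℂ} (hw : ‖w‖ = 1) :
    perturbedState o (fun σ τ => if σ = o ∨ τ = o then 0 else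
      Matrix.trace (W σ * W τ) / (2 * Fintype.card κ)) τ w ∈ stateValues W := by
  have htr : ∀ σ, Matrix.trace (W σ) = if σ = o then (Fintype.card κ : ℂ) else 0 := fun σ => by
    simpa [hWo] using horth σ o
  have hww : w * star w = 1 := by
    rw [RCLike.star_def, Complex.mul_conj', hw]; norm_num
  have hsqrt : ∀ x : ℝ, 0 ≤ x → ((√x : ℝ) : ℂ) * (√x : ℝ) = x := fun x hx => by
    rw [← Complex.ofReal_mul, Real.mul_self_sqrt hx]
  obtain ⟨B, hB⟩ : ∃ B : Matrix κ κ ℂ, ∀ σ, Matrix.trace (W σ * (B * B.conjTranspose)) =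
      perturbedState o (fun σ τ => if σ = o ∨ τ = o then 0 else
        Matrix.trace (W σ * W τ) / (2 * Fintype.card κ)) τ w σ := by
    by_cases hτ : τ = o
    · refine ⟨((√((Fintype.card κ : ℝ)⁻¹) : ℝ) : ℂ) • 1, fun σ => ?_⟩
      have : (((√((Fintype.card κ : ℝ)⁻¹) : ℝ) : ℂ) • (1 : Matrix κ κ ℂ)) *
          (((√((Fintype.card κ : ℝ)⁻¹) : ℝ) : ℂ) • (1 : Matrix κ κ ℂ)).conjTranspose =
          ((Fintype.card κ : ℂ)⁻¹) • 1 := by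
        rw [Matrix.conjTranspose_smul, RCLike.star_def, Complex.conj_ofReal,
          Matrix.conjTranspose_one, smul_mul_smul_comm, hsqrt _ (by positivity), mul_one]
        simp
      rw [this, Matrix.mul_smul, mul_one, Matrix.trace_smul, htr]
      simp only [perturbedState, hτ, ne_eq, not_true_eq_false, and_false, if_false, or_true,
        if_true, mul_zero, add_zero]
      split_ifs <;> simp
    · refine ⟨((√((2 * Fintype.card κ : ℝ)⁻¹) : ℝ) : ℂ) •
        (1 + w • (W τ).conjTranspose), fun σ => ?_⟩
      have : (((√((2 * Fintype.card κ : ℝ)⁻¹) : ℝ) : ℂ) • (1 + w • (W τ).conjTranspose)) *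
          (((√((2 * Fintype.card κ : ℝ)⁻¹) : ℝ) : ℂ) •
            (1 + w • (W τ).conjTranspose)).conjTranspose =
          ((2 * Fintype.card κ : ℂ)⁻¹) •
            ((2 : ℂ) • 1 + w • (W τ).conjTranspose + star w • W τ) := by
        rw [Matrix.conjTranspose_smul, RCLike.star_def, Complex.conj_ofReal, smul_mul_smul_comm,
          hsqrt _ (by positivity), Matrix.conjTranspose_add, Matrix.conjTranspose_one,
          Matrix.conjTranspose_smul, Matrix.conjTranspose_conjTranspose, mul_add, add_mul, add_mul,
          smul_mul_smul_comm, hU, hww, one_smul, two_smul]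
        push_cast
        simp only [mul_one, one_mul]
        congr 1
        abel
      rw [this, Matrix.mul_smul, Matrix.trace_smul, mul_add, mul_add, Matrix.mul_smul,
        Matrix.mul_smul, Matrix.mul_smul, mul_one, Matrix.trace_add, Matrix.trace_add,
        Matrix.trace_smul, Matrix.trace_smul, Matrix.trace_smul, htr, horth]
      simp only [perturbedState, hτ, ne_eq, not_false_eq_true, and_true, or_false, smul_eq_mul]
      by_cases hσ : σ = o
      · have h2 : σ ≠ τ := fun h => hτ (h ▸ hσ)
        rw [if_pos hσ, if_neg h2, if_pos hσ, if_neg h2, if_pos hσ, hσ, hWo, one_mul, htr,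
          if_neg hτ]
        field_simp
        ring
      · rw [if_neg hσ, if_neg hσ, if_neg hσ]
        split_ifs
        · field_simp
          ring
        · field_simp
          ring
  refine ⟨B, (sum_norm_sq_eq_one_iff B).mpr ?_, funext fun σ => (hB σ).symm⟩
  have h := hB o
  have h2 : ¬ (o = τ ∧ τ ≠ o) := fun h => h.2 h.1.symm
  simpa [hWo, perturbedState, h2] using h

lemma shiftMat_pow_apply {K : ℕ} (l : ℕ) (x y : Fin K) :
    (shiftMat K ^ l) x y = if (x : ℕ) = (y + l) % K then 1 else 0 := by
  induction l generalizing x with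
  | zero => simp [Matrix.one_apply, Fin.ext_iff, Nat.mod_eq_of_lt y.2]
  | succ l ih =>
    rw [pow_succ', Matrix.mul_apply]
    have hz : ((y : ℕ) + l) % K < K := Nat.mod_lt _ (Nat.zero_lt_of_lt y.2)
    rw [Finset.sum_eq_single ⟨_, hz⟩]
    · rw [ih, if_pos rfl, mul_one]
      simp [shiftMat, ← add_assoc]
    · intro z _ hzne
      rw [ih, if_neg fun h => hzne (Fin.ext h), mul_zero]
    · simp

lemma clockMat_pow (K m : ℕ) : clockMat K ^ m = Matrix.diagonal fun j : Fin K =>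
    (Complex.exp (2 * Real.pi * Complex.I / K) ^ m) ^ (j : ℕ) := by
  rw [clockMat, Matrix.diagonal_pow]
  congr 1
  ext j
  rw [Pi.pow_apply, ← Complex.exp_nat_mul, ← Complex.exp_nat_mul, ← Complex.exp_nat_mul]
  congr 1
  ring

/-- The Heisenberg–Weyl basis of `M_K(ℂ)`. -/
noncomputable def heisenbergWeyl (K : ℕ) (τ : Fin K × Fin K) : Matrix (Fin K) (Fin K) ℂ :=
  shiftMat K ^ (τ.1 : ℕ) * clockMat K ^ (τ.2 : ℕ)

lemma heisenbergWeyl_apply {K : ℕ} (τ : Fin K × Fin K) (x y : Fin K) :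
    heisenbergWeyl K τ x y = if (x : ℕ) = (y + τ.1) % K then
      (Complex.exp (2 * Real.pi * Complex.I / K) ^ (τ.2 : ℕ)) ^ (y : ℕ) else 0 := by
  rw [heisenbergWeyl, clockMat_pow, Matrix.mul_diagonal, shiftMat_pow_apply]
  split_ifs <;> simp

lemma norm_exp_two_pi_mul_I_div (K : ℕ) : ‖Complex.exp (2 * Real.pi * Complex.I / K)‖ = 1 := by
  have : (2 * Real.pi * Complex.I / K : ℂ) = ((2 * Real.pi / K : ℝ) : ℂ) * Complex.I := by
    push_cast; ring
  rw [this, Complex.norm_exp_ofReal_mul_I]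

lemma trace_heisenbergWeyl_mul_conjTranspose {K : ℕ} (σ τ : Fin K × Fin K) :
    Matrix.trace (heisenbergWeyl K σ * (heisenbergWeyl K τ).conjTranspose) =
      if σ = τ then (Fintype.card (Fin K) : ℂ) else 0 := by
  have hK : K ≠ 0 := (Nat.zero_lt_of_lt σ.1.2).ne'
  have hprim := Complex.isPrimitiveRoot_exp K hK
  have hnorm := norm_exp_two_pi_mul_I_div K
  set ω := Complex.exp (2 * Real.pi * Complex.I / K)
  have hterm : Matrix.trace (heisenbergWeyl K σ * (heisenbergWeyl K τ).conjTranspose) =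
      ∑ y : Fin K, if ((y : ℕ) + σ.1) % K = (y + τ.1) % K then
        (ω ^ (σ.2 : ℕ) * star (ω ^ (τ.2 : ℕ))) ^ (y : ℕ) else 0 := by
    simp only [Matrix.trace, Matrix.diag, Matrix.mul_apply, Matrix.conjTranspose_apply]
    rw [Finset.sum_comm]
    refine Finset.sum_congr rfl fun y _ => ?_
    have hz : ((y : ℕ) + σ.1) % K < K := Nat.mod_lt _ (Nat.pos_of_ne_zero hK)
    rw [Finset.sum_eq_single ⟨_, hz⟩]
    · rw [heisenbergWeyl_apply, heisenbergWeyl_apply, if_pos rfl]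
      split_ifs
      · rw [mul_pow, star_pow]
      · simp
    · intro z _ hzne
      rw [heisenbergWeyl_apply, if_neg fun h => hzne (Fin.ext h), zero_mul]
    · simp
  have hmod : ∀ y : Fin K, ((y : ℕ) + σ.1) % K = (y + τ.1) % K ↔ σ.1 = τ.1 := by
    intro y
    refine ⟨fun h => ?_, fun h => by rw [h]⟩
    have := Nat.ModEq.add_left_cancel' (y : ℕ) h
    exact Fin.ext (this.eq_of_lt_of_lt σ.1.2 τ.1.2)
  simp only [hterm, hmod]
  by_cases h1 : σ.1 = τ.1
  · simp only [h1, if_true]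
    rw [Fin.sum_univ_eq_sum_range (fun i => (ω ^ (σ.2 : ℕ) * star (ω ^ (τ.2 : ℕ))) ^ i)]
    have hinv : ω ^ (τ.2 : ℕ) * star (ω ^ (τ.2 : ℕ)) = 1 := by
      rw [RCLike.star_def, Complex.mul_conj', norm_pow, hnorm]; norm_num
    by_cases h2 : σ.2 = τ.2
    · rw [if_pos (Prod.ext h1 h2), h2, hinv]
      simp
    · rw [if_neg fun h => h2 (congrArg Prod.snd h)]
      have hne : ω ^ (σ.2 : ℕ) * star (ω ^ (τ.2 : ℕ)) ≠ 1 := fun h => by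
        refine h2 (Fin.ext (hprim.pow_inj σ.2.2 τ.2.2 ?_))
        linear_combination (ω ^ (τ.2 : ℕ)) * h - ω ^ (σ.2 : ℕ) * hinv
      rw [geom_sum_eq hne, mul_pow, ← star_pow, ← pow_mul, ← pow_mul, mul_comm _ K, mul_comm _ K,
        pow_mul, pow_mul, hprim.pow_eq_one]
      simp
  · rw [if_neg fun h => h1 (congrArg Prod.fst h)]
    simp [h1]

lemma conjTranspose_heisenbergWeyl_mul_self {K : ℕ} (τ : Fin K × Fin K) :
    (heisenbergWeyl K τ).conjTranspose * heisenbergWeyl K τ = 1 := by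
  have hnorm := norm_exp_two_pi_mul_I_div K
  set ω := Complex.exp (2 * Real.pi * Complex.I / K) with hω
  have hK : 0 < K := Nat.zero_lt_of_lt τ.1.2
  ext x y
  rw [Matrix.mul_apply, Finset.sum_eq_single ⟨_, Nat.mod_lt ((y : ℕ) + τ.1) hK⟩]
  · rw [Matrix.conjTranspose_apply, heisenbergWeyl_apply, heisenbergWeyl_apply, if_pos rfl,
      Matrix.one_apply, ← hω]
    by_cases hxy : x = y
    · rw [hxy, if_pos rfl, if_pos rfl, RCLike.star_def, Complex.conj_mul', norm_pow, norm_pow,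
        hnorm]
      norm_num
    · rw [if_neg hxy, if_neg, star_zero, zero_mul]
      intro h
      exact hxy (Fin.ext ((Nat.ModEq.add_right_cancel' (τ.1 : ℕ) h).eq_of_lt_of_lt y.2 x.2).symm)
  · intro z _ hz
    rw [heisenbergWeyl_apply τ z y, if_neg fun h => hz (Fin.ext h), mul_zero]
  · simp

/-- Qudit Bohnenblust–Hille inequality in the Heisenberg–Weyl basis, prime case: for a prime
`K ≥ 3` and `d ≥ 1` there is `C(d,K) > 0` such that for all `n ≥ 1` and every
`A = ∑ Â(ℓ⃗,m⃗) X^{ℓ₁}Z^{m₁} ⊗ ⋯ ⊗ X^{ℓₙ}Z^{mₙ}` of degree at most `d`,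
`(∑ |Â(ℓ⃗,m⃗)|^{2d/(d+1)})^{(d+1)/(2d)} ≤ C(d,K) ‖A‖`. -/
theorem stmt12 (K : ℕ) (hK : 3 ≤ K) (hKprime : Nat.Prime K) (d : ℕ) (hd : 1 ≤ d) :
    ∃ C : ℝ, 0 < C ∧ ∀ n : ℕ, 1 ≤ n →
      ∀ Ahat : (Fin n → Fin K) × (Fin n → Fin K) → ℂ,
        (∀ lm : (Fin n → Fin K) × (Fin n → Fin K),
          d < ∑ j, ((lm.1 j : ℕ) + (lm.2 j : ℕ)) → Ahat lm = 0) →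
        (∑ lm : (Fin n → Fin K) × (Fin n → Fin K),
              ‖Ahat lm‖ ^ ((2 * (d : ℝ)) / ((d : ℝ) + 1)))
            ^ (((d : ℝ) + 1) / (2 * (d : ℝ)))
          ≤ C * ‖Matrix.toEuclideanCLM (𝕜 := ℂ)
              (∑ lm : (Fin n → Fin K) × (Fin n → Fin K),
                Ahat lm • hwTensor lm.1 lm.2)‖ := by
  obtain ⟨k, rfl⟩ : ∃ k, K = k + 1 := ⟨K - 1, by omega⟩
  have hWo : heisenbergWeyl (k + 1) (0, 0) = 1 := by simp [heisenbergWeyl]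
  obtain ⟨C, hC, hBH⟩ := exists_bohnenblust_hille ((0, 0) : Fin (k + 1) × Fin (k + 1)) _ hd
    (convexHull ℝ (stateValues (heisenbergWeyl (k + 1)))) (convex_convexHull ℝ _)
    (fun v hv => apply_eq_one_of_mem_convexHull_stateValues hWo hv)
    (fun τ w hw => subset_convexHull ℝ _ (perturbedState_mem_stateValues hWo
      conjTranspose_heisenbergWeyl_mul_self trace_heisenbergWeyl_mul_conjTranspose τ hw))
  refine ⟨C + 1, by positivity, fun n _ Ahat hA => ?_⟩
  let e := Equiv.arrowProdEquivProdArrow (Fin n) (fun _ => Fin (k + 1)) (fun _ => Fin (k + 1))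
  have hop : ∑ lm : (Fin n → Fin (k + 1)) × (Fin n → Fin (k + 1)),
      Ahat lm • hwTensor lm.1 lm.2 =
      ∑ α, Ahat (e α) • matTensor (heisenbergWeyl (k + 1)) α :=
    (e.sum_comp fun lm => Ahat lm • hwTensor lm.1 lm.2).symm
  rw [← e.sum_comp, hop]
  refine (hBH n (fun α => Ahat (e α)) (fun α hα => hA _ (hα.trans_le ?_)) _
    (norm_multiEval_le_of_mem_convexHull _
      (norm_multiEval_le_of_mem_stateValues (heisenbergWeyl (k + 1)) _))).trans ?_
  · rw [Finset.card_filter]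
    refine Finset.sum_le_sum fun j _ => ?_
    split_ifs with h
    · by_contra! hlt
      simp only [Nat.lt_one_iff, Nat.add_eq_zero_iff, Fin.val_eq_zero_iff] at hlt
      exact h (Prod.ext hlt.1 hlt.2)
    · exact Nat.zero_le _
  · gcongr
    linarith
end

section
/- Fix integers d ≥ 1 and K ≥ 3. There exists a constant C(d,K) > 0 depending only on d and K such that for every n ≥ 1 and every analytic polynomial f(z) = ∑_α c_α z^α on ℂ^n, with multi-indices α ∈ {0,1,…,K−1}^n (so individual degree at most K−1) satisfying |α| = ∑_j α_j ≤ d (total degree at most d), one has sup_{z ∈ 𝕋^n} |f(z)| ≤ C(d,K) · sup_{z ∈ Ω_K^n} |f(z)|. -/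
open Finset

/-- Polynomials of degree at most `N` bounded by `M` on `[0, r]` are bounded at any complex point
by a constant multiple of `M`. -/
theorem Polynomial.exists_norm_eval_le (N : ℕ) {r : ℝ} (hr : 0 < r) (w : ℂ) :
    ∃ C : ℝ, 0 < C ∧ ∀ (P : Polynomial ℂ) (M : ℝ), P.natDegree ≤ N →
      (∀ t : ℝ, 0 ≤ t → t ≤ r → ‖P.eval (t : ℂ)‖ ≤ M) → ‖P.eval w‖ ≤ C * M := by
  let s : Finset ℕ := range (N + 1)
  let v : ℕ → ℂ := fun i => ((r / (i + 1) : ℝ) : ℂ)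
  have hv : Set.InjOn v s := by
    intro a _ b _ hab
    have h1 : r / ((a : ℝ) + 1) = r / ((b : ℝ) + 1) := Complex.ofReal_injective hab
    have ha : (0 : ℝ) < a + 1 := by positivity
    have hb : (0 : ℝ) < b + 1 := by positivity
    rw [div_eq_div_iff ha.ne' hb.ne'] at h1
    have h2 := mul_left_cancel₀ hr.ne' h1
    have h3 : (a : ℝ) = b := by linarith
    exact_mod_cast h3
  refine ⟨∑ i ∈ s, ‖(Lagrange.basis s v i).eval w‖ + 1, by positivity, ?_⟩
  intro P M hP hM
  have hM0 : 0 ≤ M := (norm_nonneg _).trans (hM 0 le_rfl hr.le)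
  have hdeg : P.degree < #s := by
    refine lt_of_le_of_lt Polynomial.degree_le_natDegree ?_
    simp only [s, card_range]
    exact_mod_cast Nat.lt_succ_of_le hP
  have hval : P.eval w = ∑ i ∈ s, P.eval (v i) * (Lagrange.basis s v i).eval w := by
    conv_lhs => rw [Lagrange.eq_interpolate hv hdeg]
    simp [Lagrange.interpolate_apply, Polynomial.eval_finsetSum]
  rw [hval]
  calc ‖∑ i ∈ s, P.eval (v i) * (Lagrange.basis s v i).eval w‖
      ≤ ∑ i ∈ s, M * ‖(Lagrange.basis s v i).eval w‖ := by
        refine norm_sum_le_of_le _ fun i _ => ?_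
        rw [norm_mul]
        gcongr
        refine hM _ (by positivity) (div_le_self hr.le ?_)
        linarith [Nat.cast_nonneg (α := ℝ) i]
    _ ≤ _ := by rw [← mul_sum]; nlinarith

/-- The masses of the complex measure on the `K`-th roots of unity whose moments of order
`0, …, K - 1` are the powers of `z`. -/
noncomputable def rootInterpolationWeight (K : ℕ) (ω z : ℂ) (k : Fin K) : ℂ :=
  (K : ℂ)⁻¹ * ∑ m : Fin K, z ^ (m : ℕ) * (ω ^ ((k : ℕ) * m))⁻¹

theorem IsPrimitiveRoot.sum_pow_mul_inv_pow {K : ℕ} {ω : ℂ} (hω : IsPrimitiveRoot ω K)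
    (a m : Fin K) :
    ∑ k : Fin K, ω ^ ((k : ℕ) * a) * (ω ^ ((k : ℕ) * m))⁻¹ = if a = m then (K : ℂ) else 0 := by
  have hK : K ≠ 0 := fun h => (h ▸ a).elim0
  have hω0 : ω ≠ 0 := hω.ne_zero hK
  have hpow (k : Fin K) : ω ^ ((k : ℕ) * a) * (ω ^ ((k : ℕ) * m))⁻¹
      = (ω ^ (a : ℕ) * (ω ^ (m : ℕ))⁻¹) ^ (k : ℕ) := by
    rw [mul_pow, inv_pow, ← pow_mul, ← pow_mul, mul_comm (a : ℕ), mul_comm (m : ℕ)]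
  simp_rw [hpow]
  rw [Fin.sum_univ_eq_sum_range (fun k => (ω ^ (a : ℕ) * (ω ^ (m : ℕ))⁻¹) ^ k)]
  split_ifs with h
  · subst h
    simp [hω0]
  · have hne : ω ^ (a : ℕ) * (ω ^ (m : ℕ))⁻¹ ≠ 1 := by
      intro h1
      rw [mul_inv_eq_one₀ (pow_ne_zero _ hω0)] at h1
      exact h (Fin.ext (hω.pow_inj a.2 m.2 h1))
    rw [geom_sum_eq hne, mul_pow, inv_pow, ← pow_mul, ← pow_mul, mul_comm (a : ℕ),
      mul_comm (m : ℕ), pow_mul, pow_mul, hω.pow_eq_one]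
    simp

theorem sum_rootInterpolationWeight_mul_pow {K : ℕ} {ω : ℂ} (hω : IsPrimitiveRoot ω K) (z : ℂ)
    (a : Fin K) :
    ∑ k, rootInterpolationWeight K ω z k * ω ^ ((k : ℕ) * a) = z ^ (a : ℕ) := by
  have hK : (K : ℂ) ≠ 0 := Nat.cast_ne_zero.mpr fun h => (h ▸ a).elim0
  calc ∑ k, rootInterpolationWeight K ω z k * ω ^ ((k : ℕ) * a)
      = (K : ℂ)⁻¹ * ∑ m : Fin K, z ^ (m : ℕ) *
          ∑ k : Fin K, ω ^ ((k : ℕ) * a) * (ω ^ ((k : ℕ) * m))⁻¹ := by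
        simp_rw [rootInterpolationWeight, mul_sum, sum_mul]
        rw [sum_comm]
        refine sum_congr rfl fun _ _ => sum_congr rfl fun _ _ => by ring
    _ = z ^ (a : ℕ) := by
        simp_rw [hω.sum_pow_mul_inv_pow]
        simp only [mul_ite, mul_zero, sum_ite_eq, mem_univ, if_true]
        field_simp

theorem norm_rootInterpolationWeight_le {K : ℕ} {ω z : ℂ} (hω : ‖ω‖ = 1) (hz : ‖z‖ = 1)
    (k : Fin K) : ‖rootInterpolationWeight K ω z k‖ ≤ 1 := by
  have hK : (0 : ℝ) < K := Nat.cast_pos.mpr k.pos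
  have h : ‖∑ m : Fin K, z ^ (m : ℕ) * (ω ^ ((k : ℕ) * m))⁻¹‖ ≤ K := by
    refine (norm_sum_le _ _).trans ?_
    simp [hω, hz]
  rw [rootInterpolationWeight, norm_mul, norm_inv, Complex.norm_natCast, inv_mul_le_iff₀ hK]
  simpa using h

/-- A polynomial path through weights on `K` points: near `0` on the real axis it consists of
perturbations of the uniform weight, and at `Complex.I` it takes the value `b`. -/
noncomputable def weightPath (K : ℕ) (b : ℂ) : Polynomial ℂ :=
  Polynomial.C ((K : ℂ)⁻¹) - Polynomial.C ((b.re : ℂ) - (K : ℂ)⁻¹) * Polynomial.X ^ 2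
    + Polynomial.C (b.im : ℂ) * Polynomial.X

theorem eval_I_weightPath (K : ℕ) (b : ℂ) : (weightPath K b).eval Complex.I = b := by
  simp only [weightPath, Polynomial.eval_add, Polynomial.eval_sub, Polynomial.eval_mul,
    Polynomial.eval_C, Polynomial.eval_pow, Polynomial.eval_X, Complex.I_sq]
  linear_combination Complex.re_add_im b

theorem natDegree_weightPath_le (K : ℕ) (b : ℂ) : (weightPath K b).natDegree ≤ 2 := by
  unfold weightPath
  compute_degree

theorem sum_weightPath {K : ℕ} (hK : K ≠ 0) {b : Fin K → ℂ} (hb : ∑ k, b k = 1) :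
    ∑ k, weightPath K (b k) = 1 := by
  have hKC : (K : ℂ) ≠ 0 := Nat.cast_ne_zero.mpr hK
  have hre : ∑ k, ((b k).re : ℂ) = 1 := by
    rw [← Complex.ofReal_sum, ← Complex.re_sum, hb]
    simp
  have him : ∑ k, ((b k).im : ℂ) = 0 := by
    rw [← Complex.ofReal_sum, ← Complex.im_sum, hb]
    simp
  simp only [weightPath, sum_add_distrib, sum_sub_distrib, ← sum_mul, ← map_sum, hre, him]
  simp [hKC]

/-- Near `0` on the real axis the path consists of nonnegative weights. -/
theorem exists_nonneg_eval_weightPath {K : ℕ} (hK : K ≠ 0) {b : ℂ} (hb : ‖b‖ ≤ 1) {t : ℝ}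
    (ht : 0 ≤ t) (ht' : t ≤ 1 / (3 * K)) :
    ∃ a : ℝ, 0 ≤ a ∧ (weightPath K b).eval (t : ℂ) = a := by
  refine ⟨(K : ℝ)⁻¹ - (b.re - (K : ℝ)⁻¹) * t ^ 2 + b.im * t, ?_, ?_⟩
  · have hK1 : (1 : ℝ) ≤ K := Nat.one_le_cast.mpr (Nat.one_le_iff_ne_zero.mpr hK)
    have hinv : 0 < (K : ℝ)⁻¹ := by positivity
    have hre := abs_le.mp ((Complex.abs_re_le_norm b).trans hb)
    have him := abs_le.mp ((Complex.abs_im_le_norm b).trans hb)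
    have hinv1 : (K : ℝ)⁻¹ ≤ 1 := inv_le_one_of_one_le₀ hK1
    have ht3 : 3 * t ≤ (K : ℝ)⁻¹ := by
      have h : 1 / (3 * (K : ℝ)) = (K : ℝ)⁻¹ / 3 := by field_simp
      linarith
    have h1 : t ^ 2 ≤ t := by nlinarith
    have h2 : (b.re - (K : ℝ)⁻¹) * t ^ 2 ≤ t ^ 2 := by nlinarith [sq_nonneg t]
    have h3 : -t ≤ b.im * t := by nlinarith
    linarith
  · simp [weightPath]

/-- If a polynomial of individual degree less than `K` is bounded by `M` on the `K`-th roots of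
unity, then so are its averages against products of probability weights. -/
theorem norm_sum_mul_prod_average_le {n K : ℕ} {ω : ℂ} (hω : ω ^ K = 1)
    {c : (Fin n → Fin K) → ℂ} {M : ℝ}
    (hM : ∀ z : Fin n → ℂ, (∀ j, z j ^ K = 1) →
      ‖∑ α : Fin n → Fin K, c α * ∏ j, z j ^ (α j : ℕ)‖ ≤ M)
    {p : Fin n → Fin K → ℝ} (hp : ∀ j k, 0 ≤ p j k) (hp1 : ∀ j, ∑ k, p j k = 1) :
    ‖∑ α : Fin n → Fin K, c α * ∏ j, ∑ k : Fin K, (p j k : ℂ) * ω ^ ((k : ℕ) * α j)‖ ≤ M := by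
  have hswap : ∑ α : Fin n → Fin K, c α * ∏ j, ∑ k : Fin K, (p j k : ℂ) * ω ^ ((k : ℕ) * α j)
      = ∑ κ : Fin n → Fin K, (∏ j, (p j (κ j) : ℂ)) *
          ∑ α : Fin n → Fin K, c α * ∏ j, (ω ^ (κ j : ℕ)) ^ (α j : ℕ) := by
    simp_rw [prod_univ_sum, Fintype.piFinset_univ, mul_sum]
    rw [sum_comm]
    refine sum_congr rfl fun κ _ => sum_congr rfl fun α _ => ?_
    simp_rw [prod_mul_distrib, pow_mul]
    ring
  rw [hswap]
  calc _ ≤ ∑ κ : Fin n → Fin K, (∏ j, p j (κ j)) * M := by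
        refine norm_sum_le_of_le _ fun κ _ => ?_
        rw [norm_mul, ← Complex.ofReal_prod, Complex.norm_real,
          Real.norm_of_nonneg (prod_nonneg fun j _ => hp j _)]
        refine mul_le_mul_of_nonneg_left (hM _ fun j => ?_) (prod_nonneg fun j _ => hp j _)
        rw [← pow_mul, mul_comm, pow_mul, hω, one_pow]
    _ = M := by
        rw [← sum_mul, ← Fintype.piFinset_univ, ← prod_univ_sum]
        simp [hp1]

/-- Pointwise form of the dimension-free discrete Remez inequality. -/
theorem exists_norm_le_of_norm_le_on_roots (d : ℕ) {K : ℕ} (hK : K ≠ 0) :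
    ∃ C : ℝ, 0 < C ∧ ∀ (n : ℕ) (c : (Fin n → Fin K) → ℂ) (M : ℝ),
      (∀ α : Fin n → Fin K, d < ∑ j, (α j : ℕ) → c α = 0) →
      (∀ z : Fin n → ℂ, (∀ j, z j ^ K = 1) →
        ‖∑ α : Fin n → Fin K, c α * ∏ j, z j ^ (α j : ℕ)‖ ≤ M) →
      ∀ z : Fin n → ℂ, (∀ j, ‖z j‖ = 1) →
        ‖∑ α : Fin n → Fin K, c α * ∏ j, z j ^ (α j : ℕ)‖ ≤ C * M := by
  have hr : (0 : ℝ) < 1 / (3 * K) := by positivity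
  obtain ⟨C, hC, hbound⟩ := Polynomial.exists_norm_eval_le (2 * d) hr Complex.I
  refine ⟨C, hC, fun n c M hc hM z hz => ?_⟩
  obtain ⟨ω, hω⟩ : ∃ ω : ℂ, IsPrimitiveRoot ω K := ⟨_, Complex.isPrimitiveRoot_exp K hK⟩
  have hωn : ‖ω‖ = 1 := hω.norm'_eq_one hK
  let b : Fin n → Fin K → ℂ := fun j => rootInterpolationWeight K ω (z j)
  have hb1 (j) : ∑ k, b j k = 1 := by
    simpa using sum_rootInterpolationWeight_mul_pow hω (z j) ⟨0, Nat.pos_of_ne_zero hK⟩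
  let F : Fin n → Fin K → Polynomial ℂ := fun j a =>
    ∑ k : Fin K, weightPath K (b j k) * Polynomial.C (ω ^ ((k : ℕ) * a))
  let P : Polynomial ℂ := ∑ α : Fin n → Fin K, Polynomial.C (c α) * ∏ j, F j (α j)
  have hF (j a) : (F j a).natDegree ≤ 2 * a := by
    rcases Nat.eq_zero_or_pos (a : ℕ) with ha | ha
    · simp [F, ha, sum_weightPath hK (hb1 j)]
    · refine (Polynomial.natDegree_sum_le_of_forall_le (n := 2) _ _ fun k _ => ?_).trans (by omega)
      exact (Polynomial.natDegree_mul_C_le _ _).trans (natDegree_weightPath_le _ _)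
  have hP : P.natDegree ≤ 2 * d := by
    refine Polynomial.natDegree_sum_le_of_forall_le _ _ fun α _ => ?_
    by_cases hα : d < ∑ j, (α j : ℕ)
    · simp [hc α hα]
    · refine (Polynomial.natDegree_C_mul_le _ _).trans ((Polynomial.natDegree_prod_le _ _).trans ?_)
      refine (sum_le_sum fun j _ => hF j (α j)).trans ?_
      rw [← mul_sum]
      omega
  have heval (w : ℂ) : P.eval w = ∑ α : Fin n → Fin K, c α *
      ∏ j, ∑ k : Fin K, (weightPath K (b j k)).eval w * ω ^ ((k : ℕ) * α j) := by
    simp [P, F, Polynomial.eval_finsetSum, Polynomial.eval_prod]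
  have hI : P.eval Complex.I = ∑ α : Fin n → Fin K, c α * ∏ j, z j ^ (α j : ℕ) := by
    simp_rw [heval, eval_I_weightPath, b, sum_rootInterpolationWeight_mul_pow hω]
  rw [← hI]
  refine hbound P M hP fun t ht ht' => ?_
  choose p hp hpe using fun j k => exists_nonneg_eval_weightPath hK (b := b j k)
    (norm_rootInterpolationWeight_le hωn (hz j) k) ht ht'
  have hp1 (j) : ∑ k, p j k = 1 := by
    have h := congrArg (Polynomial.eval (t : ℂ)) (sum_weightPath hK (hb1 j))
    rw [Polynomial.eval_finsetSum, Polynomial.eval_one] at h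
    simp_rw [hpe] at h
    exact_mod_cast h
  rw [heval]
  simp_rw [hpe]
  exact norm_sum_mul_prod_average_le hω.pow_eq_one hM hp hp1

/-- Dimension-free discrete Remez-type inequality: for `d ≥ 1` and `K ≥ 3` there is
`C(d,K) > 0`, independent of `n`, such that every analytic polynomial
`f(z) = ∑_α c_α z^α` with `α ∈ {0,…,K-1}ⁿ` and total degree at most `d` satisfies
`sup_{z ∈ 𝕋ⁿ} |f(z)| ≤ C(d,K) · sup_{z ∈ Ω_Kⁿ} |f(z)|`. -/
theorem stmt13 (d K : ℕ) (hd : 1 ≤ d) (hK : 3 ≤ K) :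
    ∃ C : ℝ, 0 < C ∧ ∀ n : ℕ, 1 ≤ n → ∀ c : (Fin n → Fin K) → ℂ,
      (∀ α : Fin n → Fin K, d < ∑ j, (α j : ℕ) → c α = 0) →
      (⨆ (z : Fin n → ℂ) (_ : ∀ j, ‖z j‖ = 1),
          ‖∑ α : Fin n → Fin K, c α * ∏ j, z j ^ (α j : ℕ)‖)
        ≤ C * ⨆ (z : Fin n → ℂ) (_ : ∀ j, z j ^ K = 1),
            ‖∑ α : Fin n → Fin K, c α * ∏ j, z j ^ (α j : ℕ)‖ := by
  have hK0 : K ≠ 0 := by omega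
  obtain ⟨C, hC, h⟩ := exists_norm_le_of_norm_le_on_roots d hK0
  refine ⟨C, hC, fun n _ c hc => ?_⟩
  set f : (Fin n → ℂ) → ℂ := fun z => ∑ α : Fin n → Fin K, c α * ∏ j, z j ^ (α j : ℕ) with hf
  have hS : 0 ≤ ⨆ (z : Fin n → ℂ) (_ : ∀ j, z j ^ K = 1), ‖f z‖ :=
    Real.iSup_nonneg fun z => Real.iSup_nonneg fun _ => norm_nonneg _
  have hbdd : BddAbove (Set.range fun z : Fin n → ℂ => ⨆ _ : ∀ j, z j ^ K = 1, ‖f z‖) := by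
    refine ⟨∑ α, ‖c α‖, ?_⟩
    rintro _ ⟨z, rfl⟩
    refine Real.iSup_le (fun hz => norm_sum_le_of_le _ fun α _ => ?_) (by positivity)
    have hz1 (j) : ‖z j‖ = 1 := Complex.norm_eq_one_of_pow_eq_one (hz j) hK0
    simp [hz1]
  have hM (z : Fin n → ℂ) (hz : ∀ j, z j ^ K = 1) :
      ‖f z‖ ≤ ⨆ (z : Fin n → ℂ) (_ : ∀ j, z j ^ K = 1), ‖f z‖ := by
    refine le_trans ?_ (le_ciSup hbdd z)
    exact (ciSup_pos (f := fun _ : ∀ j, z j ^ K = 1 => ‖f z‖) hz).ge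
  have hCS := mul_nonneg hC.le hS
  exact Real.iSup_le (fun z => Real.iSup_le (fun hz => h n c _ hc hM z hz) hCS) hCS
end

section
/- Fix integers d ≥ 1, n ≥ 1, and K ≥ 3. There exists a constant C_K ≥ 1 depending only on K such that every analytic polynomial f(z) = ∑_α c_α z^α on ℂ^n with multi-indices α ∈ {0,1,…,K−1}^n (individual degree at most K−1) and total degree ∑_j α_j ≤ d satisfies sup_{z ∈ 𝕋^n} |f(z)| ≤ C_K^d · sup_{z ∈ Ω_{2K}^n} |f(z)|. -/
open Finset

lemma sum_range_pow_eq_zero_of_pow_eq_one {N : ℕ} {η : ℂ} (h : η ^ N = 1) (h1 : η ≠ 1) :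
    ∑ m ∈ range N, η ^ m = 0 := by
  have := mul_neg_geom_sum η N
  rw [h, sub_self] at this
  exact (mul_eq_zero.1 this).resolve_left (sub_ne_zero.2 h1.symm)

/-- The truncated Poisson kernel is nonnegative at radius at most `1 / 3`. -/
lemma one_le_two_mul_re_geom_sum {u : ℂ} (hu : ‖u‖ ≤ 1 / 3) {K : ℕ} (hK : 1 ≤ K) :
    1 ≤ 2 * (∑ l ∈ range K, u ^ l).re := by
  obtain ⟨k, rfl⟩ := Nat.exists_eq_add_of_le' hK
  have hgeom : ∑ l ∈ range k, ((1 : ℝ) / 3) ^ l ≤ 3 / 2 := by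
    have := geom_sum_mul ((1 : ℝ) / 3) k
    have : (0 : ℝ) ≤ (1 / 3) ^ k := by positivity
    linarith
  have hnorm : ‖∑ l ∈ range k, u ^ (l + 1)‖ ≤ 1 / 2 :=
    calc ‖∑ l ∈ range k, u ^ (l + 1)‖ ≤ ∑ l ∈ range k, ((1 : ℝ) / 3) ^ (l + 1) := by
          refine (norm_sum_le _ _).trans (sum_le_sum fun l _ => ?_)
          rw [norm_pow]
          gcongr
      _ = (∑ l ∈ range k, ((1 : ℝ) / 3) ^ l) * (1 / 3) := by
          simp_rw [pow_succ, sum_mul]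
      _ ≤ 1 / 2 := by linarith
  have hre := (Complex.abs_re_le_norm (∑ l ∈ range k, u ^ (l + 1))).trans hnorm
  rw [sum_range_succ', Complex.add_re, pow_zero, Complex.one_re]
  linarith [(abs_le.1 hre).1]

/-- Every point of the disc of radius `1 / 3` has the same moments of order less than `K` as some
probability measure on the `2K`-th roots of unity. -/
lemma exists_weights_moments_eq_pow {K : ℕ} (hK : 1 ≤ K) {ζ : ℂ}
    (hζ : IsPrimitiveRoot ζ (2 * K)) {z : ℂ} (hz : ‖z‖ ≤ 1 / 3) :
    ∃ p : Fin (2 * K) → ℝ, (∀ m, 0 ≤ p m) ∧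
      ∀ k < K, ∑ m, (p m : ℂ) * (ζ ^ (m : ℕ)) ^ k = z ^ k := by
  have hζ0 : ζ ≠ 0 := hζ.ne_zero (by omega)
  have hζn : ‖ζ‖ = 1 := hζ.norm'_eq_one (by omega)
  have hconj : (starRingEnd ℂ) ζ = ζ⁻¹ := (Complex.inv_eq_conj hζn).symm
  have hK0 : (K : ℂ) ≠ 0 := by exact_mod_cast (by omega : K ≠ 0)
  have hcoe (m : ℕ) : (((2 * (∑ l ∈ range K, (z * ζ⁻¹ ^ m) ^ l).re - 1) / (2 * K) : ℝ) : ℂ)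
      = (∑ l ∈ range K, z ^ l * (ζ⁻¹ ^ l) ^ m
          + (∑ l ∈ range K, (starRingEnd ℂ) z ^ l * (ζ ^ l) ^ m - 1)) / (2 * K) := by
    have h := Complex.add_conj (∑ l ∈ range K, (z * ζ⁻¹ ^ m) ^ l)
    push_cast at h ⊢
    rw [← h, map_sum]
    simp only [map_pow, map_mul, map_inv₀, hconj, inv_inv, mul_pow]
    simp only [← pow_mul, mul_comm m, add_sub_assoc]
  refine ⟨fun m => (2 * (∑ l ∈ range K, (z * ζ⁻¹ ^ (m : ℕ)) ^ l).re - 1) / (2 * K),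
    fun m => ?_, fun k hk => ?_⟩
  · have := one_le_two_mul_re_geom_sum (u := z * ζ⁻¹ ^ (m : ℕ)) (by simpa [hζn] using hz) hK
    exact div_nonneg (by linarith) (by positivity)
  · simp only [hcoe]
    rw [Fin.sum_univ_eq_sum_range (fun m => (∑ l ∈ range K, z ^ l * (ζ⁻¹ ^ l) ^ m
      + (∑ l ∈ range K, (starRingEnd ℂ) z ^ l * (ζ ^ l) ^ m - 1)) / (2 * K) * (ζ ^ m) ^ k)]
    have hanalytic : ∑ m ∈ range (2 * K), (∑ l ∈ range K, z ^ l * (ζ⁻¹ ^ l) ^ m) * (ζ ^ m) ^ k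
        = 2 * K * z ^ k := by
      simp_rw [sum_mul]
      rw [sum_comm, sum_eq_single_of_mem k (mem_range.2 hk)]
      · have (m : ℕ) : z ^ k * (ζ⁻¹ ^ k) ^ m * (ζ ^ m) ^ k = z ^ k := by
          rw [← pow_mul, ← pow_mul, mul_comm m k, mul_assoc, ← mul_pow, inv_mul_cancel₀ hζ0,
            one_pow, mul_one]
        simp_rw [this]
        simp
      · intro l hl hlk
        have hpow : (ζ⁻¹ ^ l * ζ ^ k) ^ (2 * K) = 1 := by
          rw [mul_pow, pow_right_comm, pow_right_comm ζ, inv_pow, hζ.pow_eq_one]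
          simp
        have hne : ζ⁻¹ ^ l * ζ ^ k ≠ 1 := by
          intro h
          rw [inv_pow, inv_mul_eq_one₀ (pow_ne_zero _ hζ0)] at h
          have := mem_range.1 hl
          exact hlk (hζ.pow_inj (by omega) (by omega) h)
        have := sum_range_pow_eq_zero_of_pow_eq_one hpow hne
        simp_rw [← pow_mul ζ, mul_comm _ k, pow_mul ζ, mul_assoc, ← mul_pow]
        rw [← mul_sum, this, mul_zero]
    have hantianalytic : ∑ m ∈ range (2 * K),
        (∑ l ∈ range K, (starRingEnd ℂ) z ^ l * (ζ ^ l) ^ m - 1) * (ζ ^ m) ^ k = 0 := by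
      obtain ⟨J, rfl⟩ := Nat.exists_eq_add_of_le' hK
      simp_rw [sum_range_succ' _ J, pow_zero, one_pow, mul_one, add_sub_cancel_right, sum_mul]
      rw [sum_comm]
      refine sum_eq_zero fun l hl => ?_
      have hpow : (ζ ^ (l + 1 + k)) ^ (2 * (J + 1)) = 1 := by
        rw [← pow_mul, mul_comm, pow_mul, hζ.pow_eq_one, one_pow]
      have hne : ζ ^ (l + 1 + k) ≠ 1 := by
        have := mem_range.1 hl
        exact hζ.pow_ne_one_of_pos_of_lt (by omega) (by omega)
      have := sum_range_pow_eq_zero_of_pow_eq_one hpow hne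
      simp_rw [← pow_mul ζ _ k, mul_comm _ k, pow_mul ζ k, mul_assoc, ← mul_pow, ← pow_add]
      rw [← mul_sum, this, mul_zero]
    simp_rw [div_mul_eq_mul_div, ← sum_div, add_mul, sum_add_distrib]
    rw [hanalytic, hantianalytic, add_zero, mul_div_cancel_left₀ _ (by simpa using hK0)]

lemma norm_le_on_polydisc_of_norm_le_on_rootsOfUnity {K n : ℕ} (hK : 1 ≤ K)
    (c : (Fin n → Fin K) → ℂ) {M : ℝ}
    (hM : ∀ z : Fin n → ℂ, (∀ j, z j ^ (2 * K) = 1) →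
      ‖∑ α : Fin n → Fin K, c α * ∏ j, z j ^ (α j : ℕ)‖ ≤ M)
    {z : Fin n → ℂ} (hz : ∀ j, ‖z j‖ ≤ 1 / 3) :
    ‖∑ α : Fin n → Fin K, c α * ∏ j, z j ^ (α j : ℕ)‖ ≤ M := by
  have hζ := Complex.isPrimitiveRoot_exp (2 * K) (by omega)
  set ζ := Complex.exp (2 * Real.pi * Complex.I / (2 * K : ℕ))
  choose p hp0 hp using fun j => exists_weights_moments_eq_pow hK hζ (hz j)
  have hrep : ∑ α : Fin n → Fin K, c α * ∏ j, z j ^ (α j : ℕ)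
      = ∑ x : Fin n → Fin (2 * K), ((∏ j, p j (x j) : ℝ) : ℂ) *
          ∑ α : Fin n → Fin K, c α * ∏ j, (ζ ^ (x j : ℕ)) ^ (α j : ℕ) := by
    simp_rw [mul_sum]
    rw [sum_comm]
    refine sum_congr rfl fun α _ => ?_
    simp_rw [← hp _ _ (α _).isLt]
    rw [Fintype.prod_sum, mul_sum]
    refine sum_congr rfl fun x _ => ?_
    rw [prod_mul_distrib]
    push_cast
    ring
  have hsum : ∑ x : Fin n → Fin (2 * K), ∏ j, p j (x j) = 1 := by
    rw [← Fintype.prod_sum]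
    refine prod_eq_one fun j _ => ?_
    have := hp j 0 (by omega)
    simp only [pow_zero, mul_one] at this
    exact_mod_cast this
  rw [hrep]
  calc _ ≤ ∑ x : Fin n → Fin (2 * K), (∏ j, p j (x j)) * M := by
        refine (norm_sum_le _ _).trans (sum_le_sum fun x _ => ?_)
        have hpos : 0 ≤ ∏ j, p j (x j) := prod_nonneg fun j _ => hp0 j _
        rw [norm_mul, Complex.norm_real, Real.norm_of_nonneg hpos]
        refine mul_le_mul_of_nonneg_left (hM _ fun j => ?_) hpos
        rw [← pow_mul, mul_comm, pow_mul, hζ.pow_eq_one, one_pow]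
    _ = M := by rw [← sum_mul, hsum, one_mul]

/-- A polynomial of degree at most `d` grows by at most `R ^ d` under dilation by `R`. -/
lemma norm_le_pow_mul_of_norm_le_on_dilates {ι : Type*} [Fintype ι] (a : ι → ℂ) (e : ι → ℕ)
    {d : ℕ} (hd : ∀ i, d < e i → a i = 0) {R M : ℝ} (hR : 1 < R)
    (hM : ∀ w : ℂ, ‖w‖ = R⁻¹ → ‖∑ i, a i * w ^ e i‖ ≤ M) :
    ‖∑ i, a i‖ ≤ R ^ d * M := by
  have hR0 : R ≠ 0 := by positivity
  have hdiff : Differentiable ℂ fun w : ℂ => ∑ i, a i * w ^ (d - e i) := by fun_prop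
  have hmem : (1 : ℂ) ∈ closure (Metric.ball (0 : ℂ) R) :=
    subset_closure (by simpa using hR)
  have := Complex.norm_le_of_forall_mem_frontier_norm_le (C := R ^ d * M) Metric.isBounded_ball
    hdiff.diffContOnCl (fun w hw => ?_) hmem
  · simpa using this
  rw [frontier_ball _ hR0, mem_sphere_zero_iff_norm] at hw
  have hw0 : w ≠ 0 := norm_ne_zero_iff.1 (hw ▸ hR0)
  have hrev : ∑ i, a i * w ^ (d - e i) = w ^ d * ∑ i, a i * w⁻¹ ^ e i := by
    rw [mul_sum]
    refine sum_congr rfl fun i _ => ?_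
    rcases lt_or_ge d (e i) with h | h
    · simp [hd i h]
    · rw [pow_sub₀ _ hw0 h, inv_pow]
      ring
  simp only [hrev, norm_mul, norm_pow, hw]
  gcongr
  exact hM _ (by rw [norm_inv, hw])

/-- Torus sup-norm bounded via `Ω_{2K}`: for `K ≥ 3` there is `C_K ≥ 1` depending only on `K`
such that for all `d ≥ 1`, `n ≥ 1`, every analytic polynomial `f(z) = ∑_α c_α z^α` with
`α ∈ {0,…,K-1}ⁿ` and total degree at most `d` satisfies
`sup_{z ∈ 𝕋ⁿ} |f(z)| ≤ C_K^d · sup_{z ∈ Ω_{2K}ⁿ} |f(z)|`. -/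
theorem stmt14 (K : ℕ) (hK : 3 ≤ K) :
    ∃ CK : ℝ, 1 ≤ CK ∧ ∀ d : ℕ, 1 ≤ d → ∀ n : ℕ, 1 ≤ n →
      ∀ c : (Fin n → Fin K) → ℂ,
        (∀ α : Fin n → Fin K, d < ∑ j, (α j : ℕ) → c α = 0) →
        (⨆ (z : Fin n → ℂ) (_ : ∀ j, ‖z j‖ = 1),
            ‖∑ α : Fin n → Fin K, c α * ∏ j, z j ^ (α j : ℕ)‖)
          ≤ CK ^ d * ⨆ (z : Fin n → ℂ) (_ : ∀ j, z j ^ (2 * K) = 1),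
              ‖∑ α : Fin n → Fin K, c α * ∏ j, z j ^ (α j : ℕ)‖ := by
  refine ⟨3, by norm_num, fun d _ n _ c hc => ?_⟩
  set M := ⨆ (z : Fin n → ℂ) (_ : ∀ j, z j ^ (2 * K) = 1),
    ‖∑ α : Fin n → Fin K, c α * ∏ j, z j ^ (α j : ℕ)‖ with hMdef
  have hM0 : 0 ≤ M := Real.iSup_nonneg fun z => Real.iSup_nonneg fun _ => norm_nonneg _
  have hbdd : BddAbove (Set.range fun z : Fin n → ℂ => ⨆ (_ : ∀ j, z j ^ (2 * K) = 1),
      ‖∑ α : Fin n → Fin K, c α * ∏ j, z j ^ (α j : ℕ)‖) := by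
    refine ⟨∑ α, ‖c α‖, ?_⟩
    rintro _ ⟨z, rfl⟩
    refine Real.iSup_le (fun hz => (norm_sum_le _ _).trans (sum_le_sum fun α _ => ?_))
      (sum_nonneg fun α _ => norm_nonneg _)
    have hz1 (j) : ‖z j‖ = 1 := Complex.norm_eq_one_of_pow_eq_one (hz j) (by omega)
    simp [norm_prod, hz1]
  have hM (z : Fin n → ℂ) (hz : ∀ j, z j ^ (2 * K) = 1) :
      ‖∑ α : Fin n → Fin K, c α * ∏ j, z j ^ (α j : ℕ)‖ ≤ M := by
    have := le_ciSup hbdd z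
    simp only [ciSup_pos hz] at this
    exact this
  have hRHS : 0 ≤ 3 ^ d * M := by positivity
  refine Real.iSup_le (fun z => Real.iSup_le (fun hz => ?_) hRHS) hRHS
  refine norm_le_pow_mul_of_norm_le_on_dilates (fun α => c α * ∏ j, z j ^ (α j : ℕ))
    (fun α => ∑ j, (α j : ℕ)) (fun α hα => by simp [hc α hα]) (by norm_num) fun w hw => ?_
  have hpoint := norm_le_on_polydisc_of_norm_le_on_rootsOfUnity (by omega) c hM
    (z := fun j => z j * w) (fun j => by rw [norm_mul, hz j, hw]; norm_num)
  simpa only [mul_pow, prod_mul_distrib, prod_pow_eq_pow_sum, ← mul_assoc] using hpoint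
end

section
/- Fix integers K ≥ 3, n ≥ 1, and 0 ≤ ℓ ≤ n, and fix ξ ∈ Ω_K with ξ ≠ 1. Let f : Ω_K^n → ℂ, f(z) = ∑_{α : |supp(α)| ≤ ℓ} a_α z^α, be a polynomial all of whose monomials have support size at most ℓ. Define 𝔇_ξ f : Ω_K^n × {−1,1}^n → ℂ by 𝔇_ξ f(z,x) = ∑_{α : |supp(α)| = ℓ} τ_α^{(ξ)} a_α z^α x^{supp(α)}, where τ_α^{(ξ)} = ∏_{j : α_j ≠ 0} (1 − ξ^{α_j}) and x^{S} = ∏_{j ∈ S} x_j. Then sup_{z ∈ Ω_K^n, x ∈ {−1,1}^n} |𝔇_ξ f(z,x)| ≤ (2 + 2√2)^ℓ · sup_{z ∈ Ω_K^n} |f(z)|. -/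
open Finset

/-- The support of a multi-index `α ∈ {0,…,K-1}ⁿ`. -/
def msupp {n K : ℕ} (α : Fin n → Fin K) : Finset (Fin n) :=
  Finset.univ.filter fun j => (α j : ℕ) ≠ 0

/-- Averaging a bounded polynomial independently over `z j` and `ξ * z j` in each coordinate
preserves the bound. -/
lemma norm_sum_mul_prod_average_le_s16 {n K : ℕ} {ξ : ℂ} (hξ : ξ ^ K = 1)
    (a : (Fin n → Fin K) → ℂ) {B : ℝ}
    (hB : ∀ z : Fin n → ℂ, (∀ j, z j ^ K = 1) →
      ‖∑ α : Fin n → Fin K, a α * ∏ j, z j ^ (α j : ℕ)‖ ≤ B)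
    {z : Fin n → ℂ} (hz : ∀ j, z j ^ K = 1) {p q : Fin n → ℝ}
    (hp : ∀ j, 0 ≤ p j) (hq : ∀ j, 0 ≤ q j) (hpq : ∀ j, p j + q j = 1) :
    ‖∑ α : Fin n → Fin K, a α * (∏ j, z j ^ (α j : ℕ)) *
      ∏ j, ((p j : ℂ) + q j * ξ ^ (α j : ℕ))‖ ≤ B := by
  have expand : ∑ α : Fin n → Fin K, a α * (∏ j, z j ^ (α j : ℕ)) *
      ∏ j, ((p j : ℂ) + q j * ξ ^ (α j : ℕ)) =
      ∑ t ∈ (univ : Finset (Fin n)).powerset,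
        (((∏ j ∈ t, p j) * ∏ j ∈ univ \ t, q j : ℝ) : ℂ) *
          ∑ α : Fin n → Fin K, a α * ∏ j, ((if j ∈ t then 1 else ξ) * z j) ^ (α j : ℕ) := by
    simp_rw [Finset.prod_add, Finset.mul_sum]
    rw [Finset.sum_comm]
    refine Finset.sum_congr rfl fun t _ => Finset.sum_congr rfl fun α _ => ?_
    have hξt : ∏ j, (if j ∈ t then (1 : ℂ) else ξ) ^ (α j : ℕ) =
        ∏ j ∈ univ \ t, ξ ^ (α j : ℕ) := by
      rw [← Finset.prod_sdiff (Finset.subset_univ t)]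
      rw [Finset.prod_congr rfl (g := fun j => ξ ^ (α j : ℕ))
        (fun j hj => by rw [if_neg (Finset.mem_sdiff.1 hj).2]),
        Finset.prod_eq_one (s := t) (fun j hj => by rw [if_pos hj, one_pow]), mul_one]
    simp_rw [mul_pow, Finset.prod_mul_distrib]
    rw [hξt]
    push_cast
    ring
  rw [expand]
  calc _ ≤ ∑ t ∈ (univ : Finset (Fin n)).powerset,
        ((∏ j ∈ t, p j) * ∏ j ∈ univ \ t, q j) * B := by
        refine norm_sum_le_of_le _ fun t _ => ?_
        have hw : 0 ≤ (∏ j ∈ t, p j) * ∏ j ∈ univ \ t, q j :=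
          mul_nonneg (Finset.prod_nonneg fun j _ => hp j) (Finset.prod_nonneg fun j _ => hq j)
        rw [norm_mul, Complex.norm_real, Real.norm_of_nonneg hw]
        refine mul_le_mul_of_nonneg_left (hB _ fun j => ?_) hw
        rw [mul_pow, hz j, mul_one]
        split_ifs <;> simp [hξ]
    _ = B := by
        rw [← Finset.sum_mul, ← Finset.prod_add]
        simp [hpq]

/-- The pointwise bound on `𝔇_ξ f`, with the better constant `4 ^ ℓ`. -/
lemma norm_top_support_part_le {n K ℓ : ℕ} {ξ : ℂ} (hξ : ξ ^ K = 1)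
    (a : (Fin n → Fin K) → ℂ)
    (hsupp : ∀ α : Fin n → Fin K, ℓ < (msupp α).card → a α = 0) {B : ℝ}
    (hB : ∀ z : Fin n → ℂ, (∀ j, z j ^ K = 1) →
      ‖∑ α : Fin n → Fin K, a α * ∏ j, z j ^ (α j : ℕ)‖ ≤ B)
    {z : Fin n → ℂ} (hz : ∀ j, z j ^ K = 1) (x : Fin n → Bool) :
    ‖∑ α ∈ Finset.univ.filter (fun α : Fin n → Fin K => (msupp α).card = ℓ),
        (∏ j ∈ msupp α, (1 - ξ ^ (α j : ℕ))) * a α * (∏ j, z j ^ (α j : ℕ))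
          * ∏ j ∈ msupp α, (if x j then (1 : ℂ) else -1)‖ ≤ 4 ^ ℓ * B := by
  set ε : Fin n → ℝ := fun j => if x j then 1 else -1 with hε
  have hεC : ∀ j, (if x j then (1 : ℂ) else -1) = (ε j : ℂ) := fun j => by
    simp only [hε]; split_ifs <;> simp
  have hεabs : ∀ j, |ε j| = 1 := fun j => by simp only [hε]; split_ifs <;> simp
  -- `Q ω = ω ^ ℓ * h (re ω)` on the unit circle, where `h t` averages `f` with bias `t * x j`
  let Q : ℂ → ℂ := fun ω => ∑ α : Fin n → Fin K, a α * (∏ j, z j ^ (α j : ℕ)) *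
    (ω ^ (ℓ - (msupp α).card) * ∏ j ∈ msupp α,
      (ω * ((1 + ξ ^ (α j : ℕ)) / 2) + ε j * ((ω ^ 2 + 1) / 2) * ((1 - ξ ^ (α j : ℕ)) / 2)))
  have hQd : Differentiable ℂ Q := by fun_prop
  have hQB : ∀ ω : ℂ, ‖ω‖ = 1 → ‖Q ω‖ ≤ B := by
    intro ω hω
    have hre : |ω.re| ≤ 1 := hω ▸ Complex.abs_re_le_norm ω
    have hsq : (ω ^ 2 + 1) / 2 = ω * ω.re := by
      have h1 : ω * (starRingEnd ℂ) ω = 1 := by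
        rw [Complex.mul_conj, Complex.normSq_eq_norm_sq, hω]; simp
      rw [Complex.re_eq_add_conj]
      linear_combination -h1 / 2
    have habs : ∀ j, |ω.re * ε j| ≤ 1 := fun j => by rw [abs_mul, hεabs, mul_one]; exact hre
    have key : Q ω = ω ^ ℓ * ∑ α : Fin n → Fin K, a α * (∏ j, z j ^ (α j : ℕ)) *
        ∏ j, ((((1 + ω.re * ε j) / 2 : ℝ) : ℂ) +
          ((1 - ω.re * ε j) / 2 : ℝ) * ξ ^ (α j : ℕ)) := by
      rw [Finset.mul_sum]
      refine Finset.sum_congr rfl fun α _ => ?_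
      by_cases hα : ℓ < (msupp α).card
      · simp [hsupp α hα]
      have hprod : ∏ j, ((((1 + ω.re * ε j) / 2 : ℝ) : ℂ) +
          ((1 - ω.re * ε j) / 2 : ℝ) * ξ ^ (α j : ℕ)) =
          ∏ j ∈ msupp α, ((((1 + ω.re * ε j) / 2 : ℝ) : ℂ) +
          ((1 - ω.re * ε j) / 2 : ℝ) * ξ ^ (α j : ℕ)) := by
        refine (Finset.prod_subset (Finset.subset_univ _) fun j _ hj => ?_).symm
        have h0 : (α j : ℕ) = 0 := by simpa [msupp] using hj
        rw [h0]
        push_cast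
        ring
      have hfac : ∏ j ∈ msupp α, (ω * ((1 + ξ ^ (α j : ℕ)) / 2) +
            ε j * ((ω ^ 2 + 1) / 2) * ((1 - ξ ^ (α j : ℕ)) / 2)) =
          ω ^ (msupp α).card * ∏ j ∈ msupp α, ((((1 + ω.re * ε j) / 2 : ℝ) : ℂ) +
          ((1 - ω.re * ε j) / 2 : ℝ) * ξ ^ (α j : ℕ)) := by
        rw [← Finset.prod_const, ← Finset.prod_mul_distrib]
        refine Finset.prod_congr rfl fun j _ => ?_
        rw [hsq]
        push_cast
        ring
      rw [hprod, hfac, ← mul_assoc (ω ^ _), ← pow_add, Nat.sub_add_cancel (not_lt.1 hα)]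
      ring
    rw [key, norm_mul, norm_pow, hω, one_pow, one_mul]
    exact norm_sum_mul_prod_average_le_s16 hξ a hB hz
      (fun j => by linarith [(abs_le.1 (habs j)).1])
      (fun j => by linarith [(abs_le.1 (habs j)).2]) (fun j => by ring)
  have hQ0 : ‖Q 0‖ ≤ B := by
    refine Complex.norm_le_of_forall_mem_frontier_norm_le (U := Metric.ball 0 1)
      Metric.isBounded_ball hQd.diffContOnCl (fun ω hω => hQB ω ?_)
      (subset_closure (Metric.mem_ball_self one_pos))
    rw [frontier_ball _ one_ne_zero] at hω
    simpa using hω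
  have hQ0eq : ∑ α ∈ Finset.univ.filter (fun α : Fin n → Fin K => (msupp α).card = ℓ),
        (∏ j ∈ msupp α, (1 - ξ ^ (α j : ℕ))) * a α * (∏ j, z j ^ (α j : ℕ))
          * ∏ j ∈ msupp α, (if x j then (1 : ℂ) else -1) = 4 ^ ℓ * Q 0 := by
    simp only [Q, Finset.mul_sum]
    rw [Finset.sum_filter]
    refine Finset.sum_congr rfl fun α _ => ?_
    rcases lt_trichotomy (msupp α).card ℓ with h | h | h
    · rw [if_neg h.ne, zero_pow (Nat.sub_pos_of_lt h).ne']
      ring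
    · rw [if_pos h, h, Nat.sub_self, pow_zero, one_mul]
      have hfac : (4 : ℂ) ^ ℓ * ∏ j ∈ msupp α, (0 * ((1 + ξ ^ (α j : ℕ)) / 2) +
            ε j * (((0 : ℂ) ^ 2 + 1) / 2) * ((1 - ξ ^ (α j : ℕ)) / 2)) =
          (∏ j ∈ msupp α, (1 - ξ ^ (α j : ℕ))) *
            ∏ j ∈ msupp α, (if x j then (1 : ℂ) else -1) := by
        rw [← h, ← Finset.prod_const, ← Finset.prod_mul_distrib, ← Finset.prod_mul_distrib]
        refine Finset.prod_congr rfl fun j _ => ?_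
        rw [hεC]
        ring
      linear_combination -(a α * ∏ j, z j ^ (α j : ℕ)) * hfac
    · rw [if_neg h.ne', hsupp α h]
      ring
  rw [hQ0eq, norm_mul, norm_pow]
  norm_num
  exact hQ0

/-- A real function on the finite set `Ω_Kⁿ` is bounded by its supremum. -/
lemma le_iSup_rootsOfUnity {n K : ℕ} (hK : 0 < K) (F : (Fin n → ℂ) → ℝ)
    {z : Fin n → ℂ} (hz : ∀ j, z j ^ K = 1) :
    F z ≤ ⨆ (z : Fin n → ℂ) (_ : ∀ j, z j ^ K = 1), F z := by
  have hroots : {w : ℂ | w ^ K = 1}.Finite := by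
    refine (Polynomial.nthRootsFinset K (1 : ℂ)).finite_toSet.subset fun w hw => ?_
    exact (Polynomial.mem_nthRootsFinset hK _).2 hw
  have hfin : {z : Fin n → ℂ | ∀ j, z j ^ K = 1}.Finite := by
    refine (Set.Finite.pi' fun _ : Fin n => hroots).subset fun z hz j => hz j
  have hbdd : BddAbove (Set.range fun z : Fin n → ℂ => ⨆ (_ : ∀ j, z j ^ K = 1), F z) := by
    refine (((hfin.image F).insert 0).subset ?_).bddAbove
    rintro _ ⟨w, rfl⟩
    by_cases hw : ∀ j, w j ^ K = 1
    · exact Or.inr ⟨w, hw, (ciSup_pos (f := fun _ => F w) hw).symm⟩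
    · exact Or.inl (by simp only [hw]; exact Real.iSup_of_isEmpty _)
  exact (ciSup_pos (f := fun _ => F z) hz).symm.le.trans (le_ciSup hbdd z)

/-- Dimension-free boundedness of the maximal-support pseudo-projection `𝔇_ξ`:
if `f(z) = ∑_{|supp α| ≤ ℓ} a_α z^α` on `Ω_Kⁿ` and `ξ ∈ Ω_K \ {1}`, then
`sup_{z ∈ Ω_Kⁿ, x ∈ {-1,1}ⁿ} |𝔇_ξ f(z,x)| ≤ (2+2√2)^ℓ sup_{z ∈ Ω_Kⁿ} |f(z)|`, where
`𝔇_ξ f(z,x) = ∑_{|supp α| = ℓ} τ_α^{(ξ)} a_α z^α x^{supp α}` and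
`τ_α^{(ξ)} = ∏_{j : α_j ≠ 0} (1 - ξ^{α_j})`. -/
theorem stmt16 (K n ℓ : ℕ) (hK : 3 ≤ K) (hn : 1 ≤ n) (hℓ : ℓ ≤ n)
    (ξ : ℂ) (hξK : ξ ^ K = 1) (hξ1 : ξ ≠ 1)
    (a : (Fin n → Fin K) → ℂ)
    (hsupp : ∀ α : Fin n → Fin K, ℓ < (msupp α).card → a α = 0) :
    (⨆ (z : Fin n → ℂ) (_ : ∀ j, z j ^ K = 1) (x : Fin n → Bool),
        ‖∑ α ∈ Finset.univ.filter (fun α : Fin n → Fin K => (msupp α).card = ℓ),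
            (∏ j ∈ msupp α, (1 - ξ ^ (α j : ℕ))) * a α * (∏ j, z j ^ (α j : ℕ))
              * ∏ j ∈ msupp α, (if x j then (1 : ℂ) else -1)‖)
      ≤ (2 + 2 * Real.sqrt 2) ^ ℓ
          * ⨆ (z : Fin n → ℂ) (_ : ∀ j, z j ^ K = 1),
              ‖∑ α : Fin n → Fin K, a α * ∏ j, z j ^ (α j : ℕ)‖ := by
  set B := ⨆ (z : Fin n → ℂ) (_ : ∀ j, z j ^ K = 1),
    ‖∑ α : Fin n → Fin K, a α * ∏ j, z j ^ (α j : ℕ)‖ with hBdef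
  have hB0 : 0 ≤ B := Real.iSup_nonneg fun z => Real.iSup_nonneg fun _ => norm_nonneg _
  have hB : ∀ z : Fin n → ℂ, (∀ j, z j ^ K = 1) →
      ‖∑ α : Fin n → Fin K, a α * ∏ j, z j ^ (α j : ℕ)‖ ≤ B := fun z hz =>
    le_iSup_rootsOfUnity (by omega)
      (fun z => ‖∑ α : Fin n → Fin K, a α * ∏ j, z j ^ (α j : ℕ)‖) hz
  have hsqrt : (1 : ℝ) ≤ Real.sqrt 2 := Real.one_le_sqrt.2 one_le_two
  have hC : (0 : ℝ) ≤ (2 + 2 * Real.sqrt 2) ^ ℓ * B := by positivity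
  refine Real.iSup_le (fun z => Real.iSup_le (fun hz => Real.iSup_le (fun x => ?_) hC) hC) hC
  refine (norm_top_support_part_le hξK a hsupp hB hz x).trans ?_
  gcongr
  linarith
end
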